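/- Let f, g ∈ ℂ[z₁, z₂, z₃] be nonconstant square-free homogeneous polynomials. If there exists a bi-Lipschitz homeomorphism φ : (ℂ³, V(f), 0) → (ℂ³, V(g), 0), then deg f = deg g. -/

import Mathlib

noncomputable section

/-- `ℂ³` with the Euclidean metric. -/
abbrev E3 := EuclideanSpace ℂ (Fin 3)

/-- The zero set `V(p) ⊆ ℂ³` of a polynomial `p ∈ ℂ[z₁, z₂, z₃]`. -/
def pV (p : MvPolynomial (Fin 3) ℂ) : Set E3 :=
  {x | MvPolynomial.eval (x : Fin 3 → ℂ) p = 0}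

/-- A bi-Lipschitz homeomorphism of germs `φ : (ℂ³, X, 0) → (ℂ³, Y, 0)`. -/
def BiLipGermHomeo (X Y : Set E3) : Prop :=
  ∃ (U U' : Set E3) (φ ψ : E3 → E3) (K : NNReal),
    IsOpen U ∧ IsOpen U' ∧ (0 : E3) ∈ U ∧ (0 : E3) ∈ U' ∧
    φ 0 = 0 ∧
    Set.MapsTo φ U U' ∧ Set.MapsTo ψ U' U ∧
    Set.LeftInvOn ψ φ U ∧ Set.RightInvOn ψ φ U' ∧
    LipschitzOnWith K φ U ∧ LipschitzOnWith K ψ U' ∧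
    φ '' (X ∩ U) = Y ∩ U'

set_option linter.all false

section
open Filter Topology Set

section M1
variable {X Y A : Type*} [TopologicalSpace X] [TopologicalSpace Y] [AddCommGroup A]

def Coc (c : X → X → A) : Prop :=
  ∀ q, ∀ᶠ q' in 𝓝 q, ∀ᶠ q'' in 𝓝 q', c q q'' = c q q' + c q' q''

def IsPot (c : X → X → A) (h : X → A) : Prop :=
  ∀ q, ∀ᶠ q' in 𝓝 q, c q q' = h q' - h q

def DivBy (X : Type*) [TopologicalSpace X] (m : ℕ) : Prop :=
  ∀ c : X → X → AddCircle (1:ℝ), Coc c → ∃ c' : X → X → ℝ, Coc c' ∧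
    ∃ h, IsPot (fun x y => m • c x y - (c' x y : AddCircle (1:ℝ))) h

lemma Coc.self {c : X → X → A} (hc : Coc c) (q : X) : c q q = 0 := by
  have h := (hc q).self_of_nhds.self_of_nhds
  simpa using h

lemma Coc.comp {c : X → X → A} (hc : Coc c) {f : Y → X} (hf : Continuous f) :
    Coc (fun a b => c (f a) (f b)) := fun q =>
  ((hf.tendsto q).eventually (hc (f q))).mono fun q' h => (hf.tendsto q').eventually h

lemma IsPot.comp {c : X → X → A} {h : X → A} (hc : IsPot c h) {f : Y → X} (hf : Continuous f) :
    IsPot (fun a b => c (f a) (f b)) (h ∘ f) := fun q =>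
  (hf.tendsto q).eventually (hc (f q))

lemma DivBy.congr (e : X ≃ₜ Y) {m : ℕ} (h : DivBy X m) : DivBy Y m := by
  intro c hc
  obtain ⟨c', hc', k, hk⟩ := h _ (hc.comp e.continuous)
  refine ⟨_, hc'.comp e.symm.continuous, k ∘ e.symm, ?_⟩
  have := hk.comp e.symm.continuous
  simp only [Homeomorph.apply_symm_apply] at this
  exact this

lemma const_of_loc {S : Set X} (hS : IsPreconnected S) {g : X → A}
    (hg : ∀ q ∈ S, ∀ᶠ q' in 𝓝[S] q, g q' = g q) {x y : X} (hx : x ∈ S) (hy : y ∈ S) :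
    g x = g y := by
  let _ : TopologicalSpace A := ⊥
  have : DiscreteTopology A := ⟨rfl⟩
  have : ContinuousOn g S := by
    intro q hq
    rw [ContinuousWithinAt, nhds_discrete, tendsto_pure]
    exact hg q hq
  exact hS.constant this hx hy

/-- Two potentials along maps agreeing on a preconnected set differ by a constant. -/
lemma pot_diff {S : Set Y} (hS : IsPreconnected S) {c : X → X → A} {F G : Y → X}
    {h k : Y → A} (hh : IsPot (fun a b => c (F a) (F b)) h) (hk : IsPot (fun a b => c (G a) (G b)) k)
    (hFG : ∀ y ∈ S, F y = G y) {x y : Y} (hx : x ∈ S) (hy : y ∈ S) :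
    k x - h x = k y - h y := by
  refine const_of_loc hS (g := fun y => k y - h y) ?_ hx hy
  intro q hq
  filter_upwards [self_mem_nhdsWithin, mem_nhdsWithin_of_mem_nhds (hh q),
    mem_nhdsWithin_of_mem_nhds (hk q)] with q' h1 h2 h3
  rw [hFG q hq, hFG q' h1, h3] at h2
  exact sub_eq_sub_iff_sub_eq_sub.mp h2

lemma coc_real_aux {c : ℝ → ℝ → A} (hc : Coc c) :
    ∃ h : ℝ → A, ∀ q ∈ Icc (0:ℝ) 1, ∀ᶠ q' in 𝓝[Icc 0 1] q, c q q' = h q' - h q := by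
  let S : Set ℝ := {T | ∃ h : ℝ → A, ∀ q ∈ Icc (0:ℝ) T, ∀ᶠ q' in 𝓝[Icc 0 T] q, c q q' = h q' - h q}
  have mono : ∀ a b, a ≤ b → b ∈ S → a ∈ S := by
    rintro a b hab ⟨h, hh⟩
    exact ⟨h, fun q hq => (hh q ⟨hq.1, hq.2.trans hab⟩).filter_mono
      (nhdsWithin_mono _ (Icc_subset_Icc le_rfl hab))⟩
  have key : ∀ s, ∀ᶠ t in 𝓝 s, (t ∈ S ↔ s ∈ S) := by
    intro s
    obtain ⟨ε, hε, hN⟩ := Metric.eventually_nhds_iff.mp (hc s)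
    have ext : ∀ a b, a < b → |a - s| < ε → |b - s| < ε → a ∈ S → b ∈ S := by
      rintro a b hab ha hb ⟨h, hh⟩
      have hloc : ∀ t, a ≤ t → t ≤ b → ∀ᶠ t' in 𝓝 t, c t t' = c s t' - c s t := by
        intro t h1 h2
        have : dist t s < ε := by
          rw [Real.dist_eq, abs_lt] at *
          constructor <;> linarith
        filter_upwards [hN this] with t' ht'
        rw [ht']; abel
      refine ⟨fun t => if t ≤ a then h t else h a + c s t - c s a, ?_⟩
      intro q hq
      rcases lt_trichotomy q a with hqa | hqa | hqa
      · have h1 := hh q ⟨hq.1, hqa.le⟩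
        rw [eventually_nhdsWithin_iff] at h1 ⊢
        filter_upwards [h1, eventually_lt_nhds hqa] with t h2 h3 h4
        rw [if_pos h3.le, if_pos hqa.le]
        exact h2 ⟨h4.1, h3.le⟩
      · subst hqa
        have h1 := hh q ⟨hq.1, le_rfl⟩
        rw [eventually_nhdsWithin_iff] at h1 ⊢
        filter_upwards [h1, hloc q le_rfl hq.2] with t h2 h3 h4
        rw [if_pos le_rfl]
        split_ifs with h5
        · exact h2 ⟨h4.1, h5⟩
        · rw [h3]; abel
      · refine mem_nhdsWithin_of_mem_nhds ?_
        filter_upwards [hloc q hqa.le hq.2, eventually_gt_nhds hqa] with t h3 h4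
        rw [if_neg (not_le.mpr h4), if_neg (not_le.mpr hqa), h3]; abel
    filter_upwards [Metric.ball_mem_nhds s hε] with t ht
    rw [Metric.mem_ball, Real.dist_eq] at ht
    have h0 : |s - s| < ε := by simpa using hε
    rcases lt_trichotomy t s with h | h | h
    · exact ⟨ext t s h ht h0, mono t s h.le⟩
    · rw [h]
    · exact ⟨mono s t h.le, ext s t h h0 ht⟩
  have hcl : IsClopen S := by
    constructor
    · rw [← isOpen_compl_iff, isOpen_iff_mem_nhds]
      intro s hs
      filter_upwards [key s] with t ht
      exact fun h => hs (ht.mp h)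
    · rw [isOpen_iff_mem_nhds]
      intro s hs
      filter_upwards [key s] with t ht
      exact ht.mpr hs
  have : S = univ := hcl.eq_univ ⟨-1, fun _ => 0, fun q hq => by
    have := hq.1.trans hq.2; norm_num at this⟩
  have h1 : (1:ℝ) ∈ S := this ▸ mem_univ _
  exact h1

/-- Every weak cocycle on a real topological vector space is a coboundary. -/
lemma coc_tvs [AddCommGroup Y] [Module ℝ Y] [ContinuousSMul ℝ Y] {c : Y → Y → A} (hc : Coc c) :
    ∃ h, IsPot c h := by
  let cl : ℝ → ℝ := fun t => max 0 (min 1 t)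
  have hcl : Continuous cl := by fun_prop
  have hcl01 : ∀ t, cl t ∈ Icc (0:ℝ) 1 := fun t => ⟨le_max_left _ _, max_le zero_le_one (min_le_left _ _)⟩
  let γ : Y → ℝ → Y := fun y t => cl t • y
  have hγ : Continuous (fun p : Y × ℝ => γ p.1 p.2) := by
    show Continuous (fun p : Y × ℝ => cl p.2 • p.1); fun_prop
  have ex : ∀ y, ∃ h : ℝ → A, IsPot (fun s t => c (γ y s) (γ y t)) h ∧ h 0 = 0 := by
    intro y
    have hc1 : Coc (fun s t : ℝ => c (s • y) (t • y)) := hc.comp (f := fun s : ℝ => s • y) (by fun_prop)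
    obtain ⟨h, hh⟩ := coc_real_aux hc1
    refine ⟨fun t => h (cl t) - h (cl 0), fun t => ?_, by simp⟩
    have h1 : Tendsto cl (𝓝 t) (𝓝[Icc 0 1] (cl t)) :=
      tendsto_nhdsWithin_iff.mpr ⟨hcl.tendsto t, Eventually.of_forall hcl01⟩
    filter_upwards [h1.eventually (hh _ (hcl01 t))] with t' ht'
    simp only [γ]
    rw [ht']; abel
  choose h hh h0 using ex
  refine ⟨fun y => h y 1, fun y => ?_⟩
  let C : Set ℝ := {t | ∀ᶠ y' in 𝓝 y, h y' t - h y t = c (γ y t) (γ y' t)}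
  have key : ∀ t0, ∀ᶠ t in 𝓝 t0, (t ∈ C ↔ t0 ∈ C) := by
    intro t0
    have hN := hc (γ y t0)
    obtain ⟨N, hN1, hN2, hN3⟩ := eventually_nhds_iff.mp hN
    have h1 : ∀ᶠ p : Y × ℝ in 𝓝 (y, t0), γ p.1 p.2 ∈ N :=
      (hγ.tendsto (y, t0)).eventually (hN2.mem_nhds hN3)
    rw [nhds_prod_eq] at h1
    obtain ⟨pa, ha, pb, hb, hab⟩ := eventually_prod_iff.mp h1
    obtain ⟨ε, hε, hball⟩ := Metric.eventually_nhds_iff_ball.mp hb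
    have cst : ∀ y', pa y' → ∀ t ∈ Metric.ball t0 ε, ∀ t1 ∈ Metric.ball t0 ε,
        h y' t - c (γ y t0) (γ y' t) = h y' t1 - c (γ y t0) (γ y' t1) := by
      intro y' hy' t ht t1 ht1
      refine const_of_loc (S := Metric.ball t0 ε) (convex_ball t0 ε).isPreconnected
        (g := fun t => h y' t - c (γ y t0) (γ y' t)) ?_ ht ht1
      intro u hu
      refine mem_nhdsWithin_of_mem_nhds ?_
      have e1 := hh y' u
      have hcont : Continuous (γ y') := hγ.comp (Continuous.prodMk_right y')
      have e2 := (hcont.tendsto u).eventually (hN1 _ (hab hy' (hball u hu)))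
      filter_upwards [e1, e2] with u' e1 e2
      rw [e2, e1]; abel
    have hy : pa y := ha.self_of_nhds
    have ev : ∀ t ∈ Metric.ball t0 ε, ∀ᶠ y' in 𝓝 y,
        c (γ y t0) (γ y' t) = c (γ y t0) (γ y t) + c (γ y t) (γ y' t) := by
      intro t ht
      have hcont : Continuous (fun y' => γ y' t) := hγ.comp (Continuous.prodMk_left t)
      exact (hcont.tendsto y).eventually (hN1 _ (hab hy (hball t ht)))
    have tr : ∀ t ∈ Metric.ball t0 ε, ∀ t1 ∈ Metric.ball t0 ε, t ∈ C → t1 ∈ C := by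
      intro t ht t1 ht1 hC
      show ∀ᶠ y' in 𝓝 y, _
      filter_upwards [hC, ev t ht, ev t1 ht1, ha] with y' e1 e2 e3 e4
      have a1 := cst y' e4 t ht t1 ht1
      have a2 := cst y hy t ht t1 ht1
      rw [e2, e3, ← e1] at a1
      have : c (γ y t1) (γ y' t1) = h y' t1 - h y t1 := by
        have b1 : h y' t1 = h y' t - (c (γ y t0) (γ y t) + (h y' t - h y t)) + (c (γ y t0) (γ y t1) + c (γ y t1) (γ y' t1)) := by
          rw [a1]; abel
        have b2 : h y t1 = h y t - c (γ y t0) (γ y t) + c (γ y t0) (γ y t1) := by rw [a2]; abel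
        rw [b1, b2]; abel
      exact this.symm
    filter_upwards [Metric.ball_mem_nhds t0 hε] with t ht
    exact ⟨tr t ht t0 (Metric.mem_ball_self hε), tr t0 (Metric.mem_ball_self hε) t ht⟩
  have hcl : IsClopen C := by
    constructor
    · rw [← isOpen_compl_iff, isOpen_iff_mem_nhds]
      intro s hs
      filter_upwards [key s] with t ht
      exact fun h => hs (ht.mp h)
    · rw [isOpen_iff_mem_nhds]
      intro s hs
      filter_upwards [key s] with t ht
      exact ht.mpr hs
  have hu : C = univ := hcl.eq_univ ⟨0, by
    refine Eventually.of_forall fun y' => ?_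
    simp [h0, γ, cl, hc.self]⟩
  have h1 : (1:ℝ) ∈ C := hu ▸ mem_univ _
  filter_upwards [h1] with y' hy'
  have : ∀ y, γ y 1 = y := fun y => by simp [γ, cl]
  rw [hy', this, this]
end M1
end

section
open Filter Topology Set
open Complex (exp I)
open scoped Real

abbrev PP := ℝ × ℝ × ℂ

structure SData (K : Type) where
  m : ℕ
  th : ℕ → ℝ
  ph : ℕ → ℝ
  σ : ℕ → Equiv.Perm K
  ξ : ℕ → K → ℝ → ℝ → ℂ
  ζ : K → ℂ
  η : ℕ → K → ℂ
  th0 : th 0 = -π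
  thm : th (m+1) = π
  thlt : ∀ j ≤ m, th j < th (j+1)
  ph0 : ∀ i < m, 0 < ph i
  ph1 : ∀ i < m, ph i < π/2
  cont : ∀ j k, Continuous (fun p : ℝ × ℝ => ξ j k p.1 p.2)
  ha : ∀ j ≤ m, ∀ k, ∀ θ ∈ Icc (th j) (th (j+1)), ξ j k 0 θ = ζ k
  hb1 : ∀ i < m, ∀ k, ∀ φ ∈ Icc 0 (ph i), ξ i k φ (th (i+1)) = ξ (i+1) k φ (th (i+1))
  hb2 : ∀ i < m, ∀ k, ∀ φ ∈ Icc (ph i) (π/2), ξ i k φ (th (i+1)) = ξ (i+1) (σ i k) φ (th (i+1))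
  hc : ∀ k, ∀ φ ∈ Icc 0 (π/2), ξ 0 k φ (-π) = ξ m k φ π
  hd : ∀ j ≤ m, ∀ k, ∀ θ ∈ Icc (th j) (th (j+1)), ξ j k (π/2) θ = exp (θ * I) * η j k
  he : ∀ j ≤ m, ∀ φ ∈ Icc 0 (π/2), ∀ θ ∈ Icc (th j) (th (j+1)),
    (∀ i < m, φ = ph i → θ ≠ th (i+1)) → Function.Injective (fun k => ξ j k φ θ)

namespace SData
variable {K : Type} (D : SData K)

def F (j : ℕ) (k : K) (y : PP) : ℂ × ℂ × ℂ :=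
  (exp y.2.2 * (Real.cos y.1 : ℝ), exp y.2.2 * ((Real.sin y.1 : ℝ) * exp (y.2.1 * I)),
    exp y.2.2 * D.ξ j k y.1 y.2.1)

def QC (j : ℕ) : Set PP := Icc 0 (π/2) ×ˢ Icc (D.th j) (D.th (j+1)) ×ˢ univ

def X : Set (ℂ × ℂ × ℂ) := {x | ∃ j ≤ D.m, ∃ k, ∃ y ∈ D.QC j, D.F j k y = x}

lemma F_cont (j k) : Continuous (D.F j k) := by
  have := (D.cont j k).comp (f := fun y : PP => (y.1, y.2.1)) (by fun_prop)
  simp only [Function.comp_def] at this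
  unfold F
  fun_prop

lemma pi2 : (0:ℝ) ≤ π/2 := by positivity

lemma norm1 (j k) {y : PP} (hy : y ∈ D.QC j) : ‖(D.F j k y).1‖ = Real.exp y.2.2.re * Real.cos y.1 := by
  have : 0 ≤ Real.cos y.1 := Real.cos_nonneg_of_neg_pi_div_two_le_of_le (by linarith [hy.1.1, pi2]) hy.1.2
  simp only [F, norm_mul, Complex.norm_exp, Complex.norm_real, Real.norm_of_nonneg this]

lemma norm2 (j k) {y : PP} (hy : y ∈ D.QC j) : ‖(D.F j k y).2.1‖ = Real.exp y.2.2.re * Real.sin y.1 := by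
  have : 0 ≤ Real.sin y.1 := Real.sin_nonneg_of_nonneg_of_le_pi hy.1.1 (by linarith [hy.1.2, pi2])
  simp only [F, norm_mul, Complex.norm_exp, Complex.norm_real, Real.norm_of_nonneg this]
  simp

lemma normsq (j k) {y : PP} (hy : y ∈ D.QC j) :
    ‖(D.F j k y).1‖^2 + ‖(D.F j k y).2.1‖^2 = Real.exp (2 * y.2.2.re) := by
  rw [D.norm1 j k hy, D.norm2 j k hy, two_mul, Real.exp_add]
  have := Real.cos_sq_add_sin_sq y.1
  linear_combination (Real.exp y.2.2.re)^2 * this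

lemma ex_param {x} (hx : x ∈ D.X) : ∃ j ≤ D.m, ∃ k, ∃ y ∈ D.QC j, y.2.2.im ∈ Icc (-π) π ∧ D.F j k y = x := by
  obtain ⟨j, hj, k, y, hy, rfl⟩ := hx
  refine ⟨j, hj, k, (y.1, y.2.1, Complex.log (exp y.2.2)), ⟨hy.1, hy.2.1, trivial⟩,
    ⟨?_, ?_⟩, ?_⟩
  · exact (Complex.neg_pi_lt_log_im _).le
  · exact Complex.log_im_le_pi _
  · simp only [F, Complex.exp_log (Complex.exp_ne_zero _)]

lemma LC [Finite K] (q : D.X) (Pr : ℕ → K → PP → Prop)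
    (h : ∀ j ≤ D.m, ∀ k, ∀ y ∈ D.QC j, D.F j k y = q → ∀ᶠ y' in 𝓝 y, y' ∈ D.QC j → Pr j k y') :
    ∀ᶠ x : D.X in 𝓝 q, ∀ j ≤ D.m, ∀ k, ∀ y ∈ D.QC j, y.2.2.im ∈ Icc (-π) π → D.F j k y = x → Pr j k y := by
  set r0 := ‖(q:ℂ × ℂ × ℂ).1‖^2 + ‖(q:ℂ × ℂ × ℂ).2.1‖^2 with hr0
  have hr : 0 < r0 := by
    obtain ⟨j, hj, k, y, hy, e⟩ := q.2
    rw [hr0, ← e, D.normsq j k hy]; positivity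
  have hcont : Continuous (fun x : D.X => ‖(x:ℂ × ℂ × ℂ).1‖^2 + ‖(x:ℂ × ℂ × ℂ).2.1‖^2) := by fun_prop
  have e1 : ∀ᶠ x : D.X in 𝓝 q, ‖(x:ℂ × ℂ × ℂ).1‖^2 + ‖(x:ℂ × ℂ × ℂ).2.1‖^2 ∈ Ioo (r0/2) (2*r0) :=
    (hcont.tendsto q).eventually (Ioo_mem_nhds (by linarith) (by linarith))
  have main : ∀ j ≤ D.m, ∀ k, ∀ᶠ x : D.X in 𝓝 q, ∀ y ∈ D.QC j, y.2.2.im ∈ Icc (-π) π → D.F j k y = x → Pr j k y := by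
    intro j hj k
    let C : Set PP := Icc 0 (π/2) ×ˢ Icc (D.th j) (D.th (j+1)) ×ˢ
      ((Icc (Real.log (r0/2) / 2) (Real.log (2*r0)/2)) ×ℂ Icc (-π) π)
    have hC : IsCompact C := isCompact_Icc.prod (isCompact_Icc.prod (isCompact_Icc.reProdIm isCompact_Icc))
    let N := interior {y' | y' ∈ D.QC j → Pr j k y'}
    have hZ : IsCompact (C \ N) := hC.diff isOpen_interior
    have hcl : IsClosed (D.F j k '' (C \ N)) := (hZ.image (D.F_cont j k)).isClosed
    have hq : (q : ℂ × ℂ × ℂ) ∉ D.F j k '' (C \ N) := by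
      rintro ⟨y, ⟨h1, h2⟩, h3⟩
      exact h2 (mem_interior_iff_mem_nhds.mpr (h j hj k y ⟨h1.1, h1.2.1, trivial⟩ h3))
    have e2 : ∀ᶠ x : D.X in 𝓝 q, (x : ℂ × ℂ × ℂ) ∉ D.F j k '' (C \ N) :=
      (continuous_subtype_val.tendsto q).eventually (hcl.isOpen_compl.mem_nhds hq)
    filter_upwards [e1, e2] with x h1 h2 y hy hyi hx
    rw [← hx, D.normsq j k hy] at h1
    have hyC : y ∈ C := by
      refine ⟨hy.1, hy.2.1, ?_, hyi⟩
      constructor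
      · have := (Real.log_lt_iff_lt_exp (by positivity)).mpr h1.1
        show _ ≤ _; linarith
      · have := (Real.lt_log_iff_exp_lt (by positivity)).mpr h1.2
        show _ ≤ _; linarith
    have : y ∈ N := by
      by_contra hN
      exact h2 ⟨y, ⟨hyC, hN⟩, hx⟩
    exact (interior_subset this) hy
  have : ∀ᶠ x : D.X in 𝓝 q, ∀ j ∈ Iic D.m, ∀ k, ∀ y ∈ D.QC j, y.2.2.im ∈ Icc (-π) π → D.F j k y = x → Pr j k y := by
    rw [eventually_all_finite (finite_Iic _)]
    intro j hj
    rw [eventually_all]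
    exact main j hj
  exact this

lemma th_mono {i j : ℕ} (h : i < j) (hj : j ≤ D.m + 1) : D.th i < D.th j := by
  induction j, h using Nat.le_induction with
  | base => exact D.thlt i (by omega)
  | succ n hn ih => exact (ih (by omega)).trans (D.thlt n (by omega))

lemma th_mono' {i j : ℕ} (h : i ≤ j) (hj : j ≤ D.m + 1) : D.th i ≤ D.th j := by
  rcases h.eq_or_lt with rfl | h
  · exact le_rfl
  · exact (D.th_mono h hj).le

lemma th_rng {i : ℕ} (h : i < D.m) : -π < D.th (i+1) ∧ D.th (i+1) < π := by
  rw [← D.th0, ← D.thm]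
  exact ⟨D.th_mono (by omega) (by omega), D.th_mono (by omega) (by omega)⟩

lemma Q_rng {j : ℕ} (hj : j ≤ D.m) {θ} (h : θ ∈ Icc (D.th j) (D.th (j+1))) : θ ∈ Icc (-π) π := by
  rw [← D.th0, ← D.thm]
  exact ⟨(D.th_mono' (by omega) (by omega)).trans h.1, h.2.trans (D.th_mono' (by omega) (by omega))⟩

/-- params agree in `φ` and `Re w`. -/
lemma par_eq {j k j' k'} {y y' : PP} (hy : y ∈ D.QC j) (hy' : y' ∈ D.QC j') (h : D.F j k y = D.F j' k' y') :
    y.1 = y'.1 ∧ (y.1 < π/2 → exp y.2.2 = exp y'.2.2) ∧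
    (0 < y.1 → exp (y.2.2 + y.2.1 * I) = exp (y'.2.2 + y'.2.1 * I)) := by
  have n := D.normsq j k hy
  have n1 := D.norm1 j k hy
  rw [h, D.normsq j' k' hy'] at n
  rw [h, D.norm1 j' k' hy'] at n1
  have re : y.2.2.re = y'.2.2.re := by
    have := Real.exp_injective n; linarith
  have hφ : y.1 = y'.1 := by
    rw [re] at n1
    have := mul_left_cancel₀ (Real.exp_ne_zero _) n1
    refine Real.injOn_cos ⟨hy.1.1, ?_⟩ ⟨hy'.1.1, ?_⟩ this.symm <;> linarith [hy.1.2, hy'.1.2, pi2]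
  refine ⟨hφ, fun h1 => ?_, fun h1 => ?_⟩
  · have h2 := congrArg Prod.fst h
    simp only [F, hφ] at h2
    refine mul_right_cancel₀ ?_ h2
    have : 0 < Real.cos y'.1 := Real.cos_pos_of_mem_Ioo ⟨by linarith [hy'.1.1, pi2, Real.pi_pos], by linarith⟩
    exact_mod_cast this.ne'
  · have h2 := congrArg (fun p => p.2.1) h
    simp only [F, hφ] at h2
    have : 0 < Real.sin y'.1 := Real.sin_pos_of_pos_of_lt_pi (by linarith) (by linarith [hy'.1.2, Real.pi_pos])
    have h3 : ((Real.sin y'.1 : ℝ) : ℂ) ≠ 0 := by exact_mod_cast this.ne'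
    rw [Complex.exp_add, Complex.exp_add]
    refine mul_left_cancel₀ h3 ?_
    linear_combination h2

lemma exp_angle {θ θ' : ℝ} (h : θ ∈ Icc (-π) π) (h' : θ' ∈ Icc (-π) π)
    (e : exp (θ * I) = exp (θ' * I)) : θ = θ' ∨ (θ = -π ∧ θ' = π) ∨ (θ = π ∧ θ' = -π) := by
  obtain ⟨n, hn⟩ := Complex.exp_eq_exp_iff_exists_int.mp e
  have h1 : θ = θ' + n * (2 * π) := by
    have := congrArg Complex.im hn
    simpa using this
  have hp := Real.pi_pos
  have a1 : (n:ℝ) < 2 := by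
    by_contra hh; push Not at hh
    nlinarith [h.2, h'.1]
  have a2 : (-2:ℝ) < n := by
    by_contra hh; push Not at hh
    nlinarith [h.1, h'.2]
  have b1 : n < 2 := by exact_mod_cast a1
  have b2 : -2 < n := by exact_mod_cast a2
  obtain rfl | rfl | rfl : n = -1 ∨ n = 0 ∨ n = 1 := by omega
  · right; left; push_cast at h1
    constructor <;> linarith [h.1, h.2, h'.1, h'.2]
  · left; simpa using h1
  · right; right; push_cast at h1
    constructor <;> linarith [h.1, h.2, h'.1, h'.2]

/-- sector comparison -/
lemma sector_cmp {j j' : ℕ} (hj' : j' ≤ D.m) (hlt : j < j') {θ} (h : θ ∈ Icc (D.th j) (D.th (j+1)))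
    (h' : θ ∈ Icc (D.th j') (D.th (j'+1))) : j' = j + 1 ∧ θ = D.th (j+1) := by
  have h1 : D.th (j+1) ≤ D.th j' := D.th_mono' hlt (by omega)
  have h2 : θ = D.th (j+1) := le_antisymm h.2 (h1.trans h'.1)
  refine ⟨?_, h2⟩
  by_contra hne
  have := D.th_mono (show j+1 < j' by omega) (by omega)
  linarith [h'.1]

def NonTip (q : ℂ × ℂ × ℂ) : Prop :=
  ∀ j ≤ D.m, ∀ k, ∀ y ∈ D.QC j, D.F j k y = q → ∀ i < D.m, y.1 = D.ph i → y.2.1 ≠ D.th (i+1)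

lemma glue {B : Type*} (q : ℂ × ℂ × ℂ) (hq : D.NonTip q) (g : ℕ → K → PP → B)
    (hlow : ∀ i < D.m, ∀ k φ w, φ ∈ Icc 0 (D.ph i) → D.F i k (φ, D.th (i+1), w) = q →
      g i k (φ, D.th (i+1), w) = g (i+1) k (φ, D.th (i+1), w))
    (hup : ∀ i < D.m, ∀ k φ w, φ ∈ Icc (D.ph i) (π/2) → D.F i k (φ, D.th (i+1), w) = q →
      g i k (φ, D.th (i+1), w) = g (i+1) (D.σ i k) (φ, D.th (i+1), w))
    (hwrap : ∀ k φ w, φ ∈ Ico 0 (π/2) → D.F 0 k (φ, -π, w) = q → g 0 k (φ, -π, w) = g D.m k (φ, π, w))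
    (hzero : ∀ j ≤ D.m, ∀ j' ≤ D.m, ∀ k w, ∀ θ ∈ Icc (D.th j) (D.th (j+1)), ∀ θ' ∈ Icc (D.th j') (D.th (j'+1)),
      D.F j k (0, θ, w) = q → g j k (0, θ, w) = g j' k (0, θ', w))
    (htop : ∀ j ≤ D.m, ∀ k w w', ∀ θ ∈ Icc (D.th j) (D.th (j+1)), ∀ θ' ∈ Icc (D.th j) (D.th (j+1)),
      w + θ * I = w' + θ' * I →
      D.F j k (π/2, θ, w) = q → g j k (π/2, θ, w) = g j k (π/2, θ', w'))
    (hper : ∀ j ≤ D.m, ∀ k φ θ w w', (φ, θ, w) ∈ D.QC j → exp w = exp w' → D.F j k (φ, θ, w) = q → g j k (φ, θ, w) = g j k (φ, θ, w'))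
    {j j' : ℕ} {k k' : K} {y y' : PP} (hj : j ≤ D.m) (hj' : j' ≤ D.m) (hy : y ∈ D.QC j) (hy' : y' ∈ D.QC j')
    (e : D.F j k y = q) (e' : D.F j' k' y' = q) : g j k y = g j' k' y' := by
  obtain ⟨φ, θ, w⟩ := y
  obtain ⟨φ', θ', w'⟩ := y'
  obtain ⟨p1, p2, p3⟩ := D.par_eq hy hy' (e.trans e'.symm)
  simp only at p1 p2 p3
  subst p1
  have hφ := hy.1
  have hθ := hy.2.1
  have hθ' := hy'.2.1
  simp only at hφ hθ hθ'
  rcases hφ.2.eq_or_lt with htp | hlt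
  · -- top
    subst htp
    have p3 := p3 (by positivity)
    -- reduce to sector 0
    have red : ∀ j ≤ D.m, ∀ k θ w, θ ∈ Icc (D.th j) (D.th (j+1)) → D.F j k (π/2, θ, w) = q →
        ∃ k0 w0, D.F 0 k0 (π/2, -π, w0) = q ∧ g j k (π/2, θ, w) = g 0 k0 (π/2, -π, w0) := by
      have eqF : ∀ j ≤ D.m, ∀ k θ w θ' w', θ ∈ Icc (D.th j) (D.th (j+1)) → θ' ∈ Icc (D.th j) (D.th (j+1)) →
          w + θ * I = w' + θ' * I → D.F j k (π/2, θ, w) = D.F j k (π/2, θ', w') := by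
        intro j hj k θ w θ' w' h h' e
        have e1 : exp w * exp (θ * I) = exp w' * exp (θ' * I) := by
          rw [← Complex.exp_add, ← Complex.exp_add, e]
        simp only [F, D.hd j hj k θ h, D.hd j hj k θ' h', Real.cos_pi_div_two, Real.sin_pi_div_two]
        refine Prod.ext (by simp) (Prod.ext ?_ ?_)
        · simpa using e1
        · simp only; rw [← mul_assoc, ← mul_assoc, e1]
      intro j
      induction j with
      | zero =>
        intro hj k θ w hθ e
        have h0 : (-π) ∈ Icc (D.th 0) (D.th (0+1)) := ⟨D.th0.le, by rw [← D.th0]; exact (D.thlt 0 hj).le⟩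
        have hw : w + θ * I = (w + θ * I + π * I) + ((-π : ℝ):ℂ) * I := by push_cast; ring
        refine ⟨k, w + θ * I + π * I, ?_, ?_⟩
        · rw [← e]; exact (eqF 0 hj k _ _ _ _ hθ h0 hw).symm
        · exact htop 0 hj k _ _ θ hθ _ h0 hw e
      | succ i ih =>
        intro hj k θ w hθ e
        have h0 : D.th (i+1) ∈ Icc (D.th (i+1)) (D.th (i+1+1)) := ⟨le_rfl, (D.thlt _ hj).le⟩
        have h1 : D.th (i+1) ∈ Icc (D.th i) (D.th (i+1)) := ⟨(D.thlt _ (by omega)).le, le_rfl⟩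
        set w1 := w + θ * I - D.th (i+1) * I with hw1
        have hw : w + θ * I = w1 + (D.th (i+1)) * I := by rw [hw1]; ring
        have e1 : D.F (i+1) k (π/2, D.th (i+1), w1) = q := by
          rw [← e]; exact (eqF _ hj k _ _ _ _ hθ h0 hw).symm
        have g1 := htop _ hj k _ _ θ hθ _ h0 hw e
        have hp := D.hb2 i (by omega) ((D.σ i).symm k) (π/2) ⟨(D.ph1 i (by omega)).le, le_rfl⟩
        rw [Equiv.apply_symm_apply] at hp
        have e2 : D.F i ((D.σ i).symm k) (π/2, D.th (i+1), w1) = q := by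
          rw [← e1]; simp only [F]; rw [hp]
        have g2 := hup i (by omega) ((D.σ i).symm k) (π/2) w1 ⟨(D.ph1 i (by omega)).le, le_rfl⟩ e2
        rw [Equiv.apply_symm_apply] at g2
        obtain ⟨k0, w0, a1, a2⟩ := ih (by omega) _ _ _ h1 e2
        exact ⟨k0, w0, a1, by rw [g1, ← g2, a2]⟩
    obtain ⟨k0, w0, a1, a2⟩ := red j hj k θ w hθ e
    obtain ⟨k1, w1, b1, b2⟩ := red j' hj' k' θ' w' hθ' e'
    have h0 : (-π) ∈ Icc (D.th 0) (D.th (0+1)) := ⟨D.th0.le, by rw [← D.th0]; exact (D.thlt 0 (by omega)).le⟩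
    have m0 : ∀ w, ((π/2, -π, w) : PP) ∈ D.QC 0 := fun w => ⟨⟨pi2, le_rfl⟩, h0, trivial⟩
    obtain ⟨-, -, c3⟩ := D.par_eq (m0 w0) (m0 w1) (a1.trans b1.symm)
    have c4 := c3 (by simp only; positivity)
    simp only [Complex.exp_add] at c4
    have c5 : exp w0 = exp w1 := mul_right_cancel₀ (Complex.exp_ne_zero _) c4
    have c6 : k0 = k1 := by
      have := congrArg (fun p => p.2.2) (a1.trans b1.symm)
      simp only [F] at this
      rw [c5] at this
      exact D.he 0 (by omega) (π/2) ⟨pi2, le_rfl⟩ (-π) h0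
        (fun i hi _ => (D.th_rng hi).1.ne) (mul_left_cancel₀ (Complex.exp_ne_zero _) this)
    rw [a2, b2, c6]
    exact hper 0 (by omega) k1 _ _ _ _ (m0 w0) c5 (c6 ▸ a1)
  · have ew := p2 hlt
    rw [hper j' hj' k' φ θ' w' w hy' ew.symm e']
    have e'' : D.F j' k' (φ, θ', w) = q := by
      rw [← e']; simp only [F]; rw [ew]
    have exi : D.ξ j k φ θ = D.ξ j' k' φ θ' := by
      have := congrArg (fun p => p.2.2) (e.trans e''.symm)
      simp only [F] at this
      exact mul_left_cancel₀ (Complex.exp_ne_zero _) this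
    rcases hφ.1.eq_or_lt with hz | hpos
    · subst hz
      have : k = k' := by
        rw [D.ha j hj k θ hθ, D.ha j' hj' k' θ' hθ', ← D.ha j hj k θ hθ, ← D.ha j hj k' θ hθ] at exi
        exact D.he j hj 0 hφ θ hθ (fun i hi h => absurd h (D.ph0 i hi).ne) exi
      subst this
      exact hzero j hj j' hj' k w θ hθ θ' hθ' e
    · have e3 : exp (θ * I) = exp (θ' * I) := by
        have := p3 hpos
        rw [Complex.exp_add, Complex.exp_add, ← ew] at this
        exact mul_left_cancel₀ (Complex.exp_ne_zero _) this
      -- ordered case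
      have ord : ∀ j j' k k', j ≤ D.m → j' ≤ D.m → θ ∈ Icc (D.th j) (D.th (j+1)) → θ ∈ Icc (D.th j') (D.th (j'+1)) →
          D.F j k (φ, θ, w) = q → D.F j' k' (φ, θ, w) = q → D.ξ j k φ θ = D.ξ j' k' φ θ → j ≤ j' → g j k (φ, θ, w) = g j' k' (φ, θ, w) := by
        intro j j' k k' hj hj' h h' e e' ex hjj
        have nt : ∀ i < D.m, φ = D.ph i → θ ≠ D.th (i+1) := hq j hj k (φ, θ, w) ⟨hφ, h, trivial⟩ e
        have inj := D.he j' hj' φ hφ θ h' nt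
        rcases hjj.eq_or_lt with rfl | hjj
        · rw [inj ex]
        · obtain ⟨rfl, ht⟩ := D.sector_cmp hj' hjj h h'
          have hjm : j < D.m := by omega
          have e2 : D.F j k (φ, D.th (j+1), w) = q := ht ▸ e
          rw [ht] at ex inj ⊢
          rcases le_total φ (D.ph j) with hl | hl
          · rw [D.hb1 j hjm k φ ⟨hφ.1, hl⟩] at ex
            rw [← inj ex]
            exact hlow j hjm k φ w ⟨hφ.1, hl⟩ e2
          · rw [D.hb2 j hjm k φ ⟨hl, hφ.2⟩] at ex
            rw [← inj ex]
            exact hup j hjm k φ w ⟨hl, hφ.2⟩ e2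
      have wr : ∀ j j' k k', j ≤ D.m → j' ≤ D.m → -π ∈ Icc (D.th j) (D.th (j+1)) → π ∈ Icc (D.th j') (D.th (j'+1)) →
          D.F j k (φ, -π, w) = q → D.ξ j k φ (-π) = D.ξ j' k' φ π → g j k (φ, -π, w) = g j' k' (φ, π, w) := by
        intro j j' k k' hj hj' h h' e ex
        have j0 : j = 0 := by
          by_contra hne
          have := D.th_mono (Nat.pos_of_ne_zero hne) (by omega)
          rw [D.th0] at this; linarith [h.1]
        have jm : j' = D.m := by
          by_contra hne
          have := D.th_mono (show j' + 1 < D.m + 1 by omega) le_rfl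
          rw [D.thm] at this; linarith [h'.2]
        subst j0; subst jm
        rw [D.hc k φ hφ] at ex
        have := D.he _ le_rfl φ hφ π h' (fun i hi _ => (D.th_rng hi).2.ne') ex
        subst this
        exact hwrap k φ w ⟨hφ.1, hlt⟩ e
      rcases exp_angle (D.Q_rng hj hθ) (D.Q_rng hj' hθ') e3 with h | ⟨h, h'⟩ | ⟨h, h'⟩
      · subst h
        rcases le_total j j' with hjj | hjj
        · exact ord j j' k k' hj hj' hθ hθ' e e'' exi hjj
        · exact (ord j' j k' k hj' hj hθ' hθ e'' e exi.symm hjj).symm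
      · subst h; subst h'
        exact wr j j' k k' hj hj' hθ hθ' e exi
      · subst h; subst h'
        exact (wr j' j k' k hj' hj hθ' hθ e'' exi.symm).symm
end SData
end

section
open Filter Topology Set
open Complex (exp I)
open scoped Real

lemma arg_mul_of_re {a b : ℂ} (ha : 0 < a.re) (hb : 0 < b.re) : (a*b).arg = a.arg + b.arg := by
  have ha0 : a ≠ 0 := by rintro rfl; simp at ha
  have hb0 : b ≠ 0 := by rintro rfl; simp at hb
  have h1 := abs_lt.mp (Complex.abs_arg_lt_pi_div_two_iff.mpr (Or.inl ha))
  have h2 := abs_lt.mp (Complex.abs_arg_lt_pi_div_two_iff.mpr (Or.inl hb))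
  exact Complex.arg_mul ha0 hb0 ⟨by linarith [h1.1, h2.1], by linarith [h1.2, h2.2]⟩

lemma ev_re_pos {X : Type*} [TopologicalSpace X] {l : X → ℂ} (hl : Continuous l) {q : X} (h : l q ≠ 0) :
    ∀ᶠ x in 𝓝 q, 0 < (l x / l q).re := by
  have : ContinuousAt (fun x => (l x / l q).re) q := by fun_prop
  refine this.eventually (lt_mem_nhds ?_)
  simp [div_self h]

lemma coc_build {X A ι : Type*} [TopologicalSpace X] [AddCommGroup A] (T : X → ι) (γ : ι → X → A)
    (l : ι → X → ℂ) (hl : ∀ i, Continuous (l i)) (h0 : ∀ q, l (T q) q ≠ 0) (t : ℝ →+ A)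
    (H : ∀ q, ∀ᶠ q' in 𝓝 q, ∀ᶠ x in 𝓝 q',
      γ (T q) x - γ (T q) q' + t ((l (T q) x / l (T q) q').arg / (2*π)) =
      γ (T q') x - γ (T q') q' + t ((l (T q') x / l (T q') q').arg / (2*π))) :
    Coc (fun q x => γ (T q) x - γ (T q) q + t ((l (T q) x / l (T q) q).arg / (2*π))) := by
  intro q
  filter_upwards [H q, ev_re_pos (hl (T q)) (h0 q), ((hl (T q)).continuousAt).eventually_ne (h0 q)]
    with q' h1 h2 h3
  filter_upwards [h1, ev_re_pos (hl (T q)) h3] with x h4 h5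
  rw [← h4]
  have : l (T q) x / l (T q) q = (l (T q) q' / l (T q) q) * (l (T q) x / l (T q) q') := by
    field_simp
  rw [this, arg_mul_of_re h2 h5, add_div, map_add]
  abel

namespace SData
variable {K : Type} (D : SData K)

def pj (x : D.X) : ℕ := (D.ex_param x.2).choose
lemma pj_le (x : D.X) : D.pj x ≤ D.m := (D.ex_param x.2).choose_spec.1
def pk (x : D.X) : K := (D.ex_param x.2).choose_spec.2.choose
def py (x : D.X) : PP := (D.ex_param x.2).choose_spec.2.choose_spec.choose
lemma py_mem (x : D.X) : D.py x ∈ D.QC (D.pj x) := (D.ex_param x.2).choose_spec.2.choose_spec.choose_spec.1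
lemma py_im (x : D.X) : (D.py x).2.2.im ∈ Icc (-π) π := (D.ex_param x.2).choose_spec.2.choose_spec.choose_spec.2.1
lemma py_eq (x : D.X) : D.F (D.pj x) (D.pk x) (D.py x) = x := (D.ex_param x.2).choose_spec.2.choose_spec.choose_spec.2.2

lemma LCp [Finite K] (q : D.X) (R : ℕ → K → PP → PP → Prop)
    (hR : ∀ j ≤ D.m, ∀ k, ∀ y ∈ D.QC j, D.F j k y = q → ∀ᶠ y' in 𝓝 y, R j k y y') :
    ∀ᶠ x : D.X in 𝓝 q, ∃ y0 ∈ D.QC (D.pj x), D.F (D.pj x) (D.pk x) y0 = q ∧ R (D.pj x) (D.pk x) y0 (D.py x) := by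
  filter_upwards [D.LC q (fun j k y => ∃ y0 ∈ D.QC j, D.F j k y0 = q ∧ R j k y0 y)
    (fun j hj k y hy e => (hR j hj k y hy e).mono fun y' h _ => ⟨y, hy, e, h⟩)] with x hx
  exact hx _ (D.pj_le x) _ _ (D.py_mem x) (D.py_im x) (D.py_eq x)

/-- LC for properties of `(φ,θ)` only -/
lemma LC2 [Finite K] (q : D.X) (R : ℕ → ℝ → ℝ → Prop)
    (hR : ∀ j ≤ D.m, ∀ k φ θ w, (φ, θ, w) ∈ D.QC j → D.F j k (φ, θ, w) = q →
      ∀ᶠ p : ℝ × ℝ in 𝓝 (φ, θ), R j p.1 p.2) :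
    ∀ᶠ x : D.X in 𝓝 q, ∀ j ≤ D.m, ∀ k φ θ w, (φ, θ, w) ∈ D.QC j → D.F j k (φ, θ, w) = x → R j φ θ := by
  filter_upwards [D.LC q (fun j k y => R j y.1 y.2.1) (by
    rintro j hj k ⟨φ, θ, w⟩ hy e
    have : Continuous (fun y : PP => (y.1, y.2.1)) := by fun_prop
    exact ((this.tendsto (φ, θ, w)).eventually (hR j hj k φ θ w hy e)).mono fun y h _ => h)] with x hx j hj k φ θ w hy e
  refine hx j hj k (φ, θ, Complex.log (exp w)) ⟨hy.1, hy.2.1, trivial⟩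
    ⟨(Complex.neg_pi_lt_log_im _).le, Complex.log_im_le_pi _⟩ ?_
  rw [← e]
  simp only [F, Complex.exp_log (Complex.exp_ne_zero _)]

def Sl (i : ℕ) : Set (ℂ × ℂ × ℂ) := {x | ∃ k φ w, φ ∈ Icc (D.ph i) (π/2) ∧ D.F i k (φ, D.th (i+1), w) = x}

lemma phpos {i} (hi : i < D.m) {φ} (h : φ ∈ Icc (D.ph i) (π/2)) : φ ∈ Icc 0 (π/2) :=
  ⟨(D.ph0 i hi).le.trans h.1, h.2⟩

lemma thR {i} (hi : i ≤ D.m) : D.th (i+1) ∈ Icc (D.th i) (D.th (i+1)) := ⟨(D.thlt i hi).le, le_rfl⟩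
lemma thL {i} (hi : i ≤ D.m) : D.th i ∈ Icc (D.th i) (D.th (i+1)) := ⟨le_rfl, (D.thlt i hi).le⟩

lemma fst_zero (j k) {y : PP} (hy : y ∈ D.QC j) : (D.F j k y).1 = 0 ↔ y.1 = π/2 := by
  constructor
  · intro h
    have := D.norm1 j k hy
    rw [h, norm_zero, zero_eq_mul] at this
    rcases this with h1 | h1
    · exact absurd h1 (Real.exp_ne_zero _)
    · refine Real.injOn_cos ⟨hy.1.1, by linarith [hy.1.2, pi2]⟩ ⟨pi2, by linarith [pi2]⟩ ?_
      rw [h1, Real.cos_pi_div_two]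
  · intro h
    simp [F, h]

lemma snd_zero (j k) {y : PP} (hy : y ∈ D.QC j) (h : (D.F j k y).2.1 = 0) : y.1 = 0 := by
  have := D.norm2 j k hy
  rw [h, norm_zero, zero_eq_mul] at this
  rcases this with h1 | h1
  · exact absurd h1 (Real.exp_ne_zero _)
  · by_contra h2
    have := Real.sin_pos_of_pos_of_lt_pi (lt_of_le_of_ne hy.1.1 (Ne.symm h2)) (by linarith [hy.1.2, Real.pi_pos])
    exact this.ne' h1

/-- a point of a slit has angle `th (i+1)` in every parametrisation -/
lemma slit_par {i} (hi : i < D.m) {x : ℂ × ℂ × ℂ} (hx : x ∈ D.Sl i) (h1 : x.1 ≠ 0) {j k φ θ w} (hj : j ≤ D.m)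
    (hy : (φ, θ, w) ∈ D.QC j) (e : D.F j k (φ, θ, w) = x) : θ = D.th (i+1) ∧ D.ph i ≤ φ := by
  obtain ⟨k', φ', w', h2, e'⟩ := hx
  have hy' : (φ', D.th (i+1), w') ∈ D.QC i := ⟨D.phpos hi h2, D.thR hi.le, trivial⟩
  obtain ⟨p1, p2, p3⟩ := D.par_eq hy hy' (e.trans e'.symm)
  simp only at p1 p2 p3
  subst p1
  refine ⟨?_, h2.1⟩
  have hlt : φ < π/2 := lt_of_le_of_ne h2.2 fun h => h1 (by rw [← e]; exact (D.fst_zero j k hy).mpr h)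
  have := p3 ((D.ph0 i hi).trans_le h2.1)
  rw [Complex.exp_add, Complex.exp_add, p2 hlt] at this
  have hr := D.th_rng hi
  rcases exp_angle (D.Q_rng hj hy.2.1) ⟨hr.1.le, hr.2.le⟩ (mul_left_cancel₀ (Complex.exp_ne_zero _) this) with h | h | h
  · exact h
  · exact absurd h.2 hr.2.ne
  · exact absurd h.2 hr.1.ne'

lemma slit_disj {i i'} (hi : i < D.m) (hi' : i' < D.m) {x : ℂ × ℂ × ℂ} (hx : x ∈ D.Sl i) (hx' : x ∈ D.Sl i') (h1 : x.1 ≠ 0) :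
    i = i' := by
  obtain ⟨k', φ', w', h2, e'⟩ := hx
  have := (D.slit_par hi' hx' h1 hi.le ⟨D.phpos hi h2, D.thR hi.le, trivial⟩ e').1
  by_contra hne
  rcases lt_or_gt_of_ne hne with h | h
  · exact (D.th_mono (show i+1 < i'+1 by omega) (by omega)).ne this
  · exact (D.th_mono (show i'+1 < i+1 by omega) (by omega)).ne' this

lemma slit_open [Finite K] {i} (hi : i < D.m) (q : D.X) (hq : (q : ℂ × ℂ × ℂ) ∉ D.Sl i) :
    ∀ᶠ x : D.X in 𝓝 q, (x : ℂ × ℂ × ℂ) ∉ D.Sl i := by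
  filter_upwards [D.LC2 q (fun j φ θ => j = i → ¬ (θ = D.th (i+1) ∧ D.ph i ≤ φ)) (by
    intro j hj k φ θ w hy e
    by_cases hji : j = i
    · subst hji
      have h1 : ¬ (θ = D.th (j+1) ∧ D.ph j ≤ φ) := by
        rintro ⟨rfl, h⟩
        exact hq ⟨k, φ, w, ⟨h, hy.1.2⟩, e⟩
      have hop : IsOpen {p : ℝ × ℝ | ¬ (p.2 = D.th (j+1) ∧ D.ph j ≤ p.1)} := by
        have : IsClosed {p : ℝ × ℝ | p.2 = D.th (j+1) ∧ D.ph j ≤ p.1} :=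
          (isClosed_eq continuous_snd continuous_const).inter (isClosed_le continuous_const continuous_fst)
        exact this.isOpen_compl
      filter_upwards [hop.mem_nhds (x := (φ, θ)) h1] with p hp _ using hp
    · exact Eventually.of_forall fun p h => absurd h hji)] with x hx
  rintro ⟨k, φ, w, h, e⟩
  exact hx i hi.le k φ _ w ⟨D.phpos hi h, D.thR hi.le, trivial⟩ e rfl ⟨rfl, h.1⟩

open Classical in
def Ty (x : D.X) : ℕ := if (x : ℂ × ℂ × ℂ).1 = 0 then 1 else
  if h : ∃ i < D.m, (x : ℂ × ℂ × ℂ) ∈ D.Sl i then h.choose + 2 else 0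

lemma Ty_one {x : D.X} : D.Ty x = 1 ↔ (x : ℂ × ℂ × ℂ).1 = 0 := by
  unfold Ty; split_ifs <;> simp_all

lemma Ty_zero {x : D.X} : D.Ty x = 0 ↔ (x : ℂ × ℂ × ℂ).1 ≠ 0 ∧ ∀ i < D.m, (x : ℂ × ℂ × ℂ) ∉ D.Sl i := by
  unfold Ty; split_ifs <;> simp_all

lemma Ty_slit {x : D.X} {i} (hi : i < D.m) : D.Ty x = i + 2 ↔ (x : ℂ × ℂ × ℂ).1 ≠ 0 ∧ (x : ℂ × ℂ × ℂ) ∈ D.Sl i := by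
  unfold Ty
  split_ifs with h1 h2
  · simp [h1]
  · have := h2.choose_spec
    constructor
    · intro h
      have h3 : h2.choose = i := by omega
      exact ⟨h1, h3 ▸ this.2⟩
    · rintro ⟨h3, h4⟩
      rw [D.slit_disj this.1 hi this.2 h4 h1]
  · push Not at h2
    simp [h2 i hi]

lemma Ty_cases (x : D.X) : D.Ty x = 0 ∨ D.Ty x = 1 ∨ ∃ i < D.m, D.Ty x = i + 2 := by
  by_cases h1 : (x : ℂ × ℂ × ℂ).1 = 0
  · exact Or.inr (Or.inl (D.Ty_one.mpr h1))
  by_cases h2 : ∃ i < D.m, (x : ℂ × ℂ × ℂ) ∈ D.Sl i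
  · obtain ⟨i, hi, h⟩ := h2
    exact Or.inr (Or.inr ⟨i, hi, (D.Ty_slit hi).mpr ⟨h1, h⟩⟩)
  · push Not at h2
    exact Or.inl (D.Ty_zero.mpr ⟨h1, h2⟩)

lemma near_zero [Finite K] {q : D.X} (h : D.Ty q = 0) : ∀ᶠ x in 𝓝 q, D.Ty x = 0 := by
  obtain ⟨h1, h2⟩ := D.Ty_zero.mp h
  have hc : Continuous (fun x : D.X => (x : ℂ × ℂ × ℂ).1) := by fun_prop
  have : ∀ᶠ x : D.X in 𝓝 q, ∀ i ∈ Iio D.m, (x : ℂ × ℂ × ℂ) ∉ D.Sl i := by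
    rw [eventually_all_finite (finite_Iio _)]
    exact fun i hi => D.slit_open hi q (h2 i hi)
  filter_upwards [this, hc.continuousAt.eventually_ne h1] with x h3 h4
  exact D.Ty_zero.mpr ⟨h4, h3⟩

lemma near_slit [Finite K] {q : D.X} {i} (hi : i < D.m) (h : D.Ty q = i + 2) :
    ∀ᶠ x in 𝓝 q, D.Ty x = 0 ∨ D.Ty x = i + 2 := by
  obtain ⟨h1, h2⟩ := (D.Ty_slit hi).mp h
  have hc : Continuous (fun x : D.X => (x : ℂ × ℂ × ℂ).1) := by fun_prop
  have : ∀ᶠ x : D.X in 𝓝 q, ∀ i' ∈ Iio D.m, i' ≠ i → (x : ℂ × ℂ × ℂ) ∉ D.Sl i' := by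
    rw [eventually_all_finite (finite_Iio _)]
    intro i' hi'
    by_cases e : i' = i
    · exact Eventually.of_forall fun x h => absurd e h
    · exact (D.slit_open hi' q fun h => e (D.slit_disj hi' hi h h2 h1)).mono fun x h _ => h
  filter_upwards [this, hc.continuousAt.eventually_ne h1] with x h3 h4
  by_cases h5 : (x : ℂ × ℂ × ℂ) ∈ D.Sl i
  · exact Or.inr ((D.Ty_slit hi).mpr ⟨h4, h5⟩)
  · refine Or.inl (D.Ty_zero.mpr ⟨h4, fun i' hi' => ?_⟩)
    by_cases e : i' = i
    · exact e ▸ h5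
    · exact h3 i' hi' e

lemma near_one [Finite K] {q : D.X} (h : D.Ty q = 1) :
    ∀ᶠ x : D.X in 𝓝 q, ∀ i < D.m, ∀ j ≤ D.m, ∀ k φ θ w, (φ, θ, w) ∈ D.QC j → D.F j k (φ, θ, w) = x → D.ph i < φ := by
  have h1 := D.Ty_one.mp h
  have : ∀ᶠ x : D.X in 𝓝 q, ∀ i ∈ Iio D.m, ∀ j ≤ D.m, ∀ k φ θ w, (φ, θ, w) ∈ D.QC j → D.F j k (φ, θ, w) = x → D.ph i < φ := by
    rw [eventually_all_finite (finite_Iio _)]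
    intro i hi
    refine D.LC2 q (fun j φ θ => D.ph i < φ) ?_
    intro j hj k φ θ w hy e
    have : φ = π/2 := (D.fst_zero j k hy).mp (by rw [e, h1])
    subst this
    exact (continuous_fst.tendsto _).eventually (lt_mem_nhds (D.ph1 i hi))
  exact this

end SData
end

section
open Filter Topology Set
open Complex (exp I)
open scoped Real

namespace SData
variable {K : Type} (D : SData K)

lemma mem_Sl {i} (hi : i < D.m) {j k φ w} (hj : j ≤ D.m) (hy : (φ, D.th (i+1), w) ∈ D.QC j) (h : D.ph i ≤ φ) :
    D.F j k (φ, D.th (i+1), w) ∈ D.Sl i := by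
  have hθ := hy.2.1
  simp only at hθ
  have hφ : φ ∈ Icc (D.ph i) (π/2) := ⟨h, hy.1.2⟩
  rcases lt_trichotomy j i with h1 | h1 | h1
  · have := (D.sector_cmp hi.le h1 hθ (D.thR hi.le)).2
    exact absurd this (D.th_mono (show j+1 < i+1 by omega) (by omega)).ne'
  · subst h1; exact ⟨k, φ, w, hφ, rfl⟩
  · obtain ⟨rfl, -⟩ := D.sector_cmp hj h1 (D.thR hi.le) hθ
    refine ⟨(D.σ i).symm k, φ, w, hφ, ?_⟩
    simp only [F]
    rw [D.hb2 i hi _ φ hφ, Equiv.apply_symm_apply]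

lemma nonTip_of {x : ℂ × ℂ × ℂ} (hx : ∀ i < D.m, x ∉ D.Sl i) : D.NonTip x := by
  rintro j hj k ⟨φ, θ, w⟩ hy e i hi h1 h2
  simp only at h1 h2
  subst h2
  exact hx i hi (e ▸ D.mem_Sl hi hj hy h1.ge)

variable {A : Type*} [AddCommGroup A] (P : ℕ → K → A) (t : ℝ →+ A)

def ss : ℕ → K → A
  | 0, _ => 0
  | (i+1), k => ss i ((D.σ i).symm k) + P i k - P i ((D.σ i).symm k)

def gam : ℕ → ℕ → K → ℝ → A
  | 0, _, _, _ => 0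
  | 1, j, k, θ => D.ss P j k - t (θ / (2*π))
  | (i+2), _, k, _ => P i k

def lf (T : ℕ) (x : D.X) : ℂ := if T = 1 then (x : ℂ × ℂ × ℂ).2.1 else (x : ℂ × ℂ × ℂ).1

def ga (T : ℕ) (x : D.X) : A := D.gam P t T (D.pj x) (D.pk x) (D.py x).2.1

def bc (q x : D.X) : A :=
  D.ga P t (D.Ty q) x - D.ga P t (D.Ty q) q + t ((D.lf (D.Ty q) x / D.lf (D.Ty q) q).arg / (2*π))

/-- locally, the label is constant near a type 0 point -/
lemma type0_k [Finite K] {q : D.X} (h : D.Ty q = 0) {j j' k k' y y'} (hj : j ≤ D.m) (hj' : j' ≤ D.m)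
    (hy : y ∈ D.QC j) (hy' : y' ∈ D.QC j') (e : D.F j k y = q) (e' : D.F j' k' y' = q) : k = k' := by
  obtain ⟨h1, h2⟩ := D.Ty_zero.mp h
  refine D.glue q (D.nonTip_of h2) (fun j k y => k) ?_ ?_ ?_ ?_ ?_ ?_ hj hj' hy hy' e e'
  · intros; rfl
  · intro i hi k φ w hφ e
    exact absurd ⟨k, φ, w, hφ, e⟩ (h2 i hi)
  · intros; rfl
  · intros; rfl
  · intros; rfl
  · intros; rfl

lemma type1_s [Finite K] (hE : ∀ k, D.ss P D.m k = t 1) {q : D.X} (h0 : D.Ty q ≠ 1)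
    (hq : ∀ i < D.m, ∀ j ≤ D.m, ∀ k φ θ w, (φ, θ, w) ∈ D.QC j → D.F j k (φ, θ, w) = q → D.ph i < φ)
    (hpos : ∀ j ≤ D.m, ∀ k θ w, θ ∈ Icc (D.th j) (D.th (j+1)) → D.F j k (0, θ, w) ≠ q)
    {j j' k k' y y'} (hj : j ≤ D.m) (hj' : j' ≤ D.m)
    (hy : y ∈ D.QC j) (hy' : y' ∈ D.QC j') (e : D.F j k y = q) (e' : D.F j' k' y' = q) :
    D.gam P t 1 j k y.2.1 - D.gam P t (D.Ty q) j k y.2.1 =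
     D.gam P t 1 j' k' y'.2.1 - D.gam P t (D.Ty q) j' k' y'.2.1 := by
  have ha : (q : ℂ × ℂ × ℂ).1 ≠ 0 := fun h => h0 (D.Ty_one.mpr h)
  refine D.glue q ?_ (fun j k y => D.gam P t 1 j k y.2.1 - D.gam P t (D.Ty q) j k y.2.1) ?_ ?_ ?_ ?_ ?_ ?_ hj hj' hy hy' e e'
  · rintro j hj k ⟨φ, θ, w⟩ hy e i hi h1 h2
    exact absurd (hq i hi j hj k φ θ w hy e) h1.not_gt
  · intro i hi k φ w hφ e
    exact absurd (hq i hi i hi.le k φ _ w ⟨⟨hφ.1, hφ.2.trans (D.ph1 i hi).le⟩, D.thR hi.le, trivial⟩ e) hφ.2.not_gt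
  · intro i hi k φ w hφ e
    have : D.Ty q = i + 2 := (D.Ty_slit hi).mpr ⟨ha, ⟨k, φ, w, hφ, e⟩⟩
    simp only [this, gam, ss, Equiv.symm_apply_apply]
    abel
  · intro k φ w hφ e
    have hT : D.Ty q = 0 := by
      refine D.Ty_zero.mpr ⟨ha, fun i hi h => ?_⟩
      have := (D.slit_par hi h ha (Nat.zero_le _) (k := k) (φ := φ) (θ := -π) (w := w) ⟨⟨hφ.1, hφ.2.le⟩, by rw [← D.th0]; exact D.thL (Nat.zero_le _), trivial⟩ e).1
      exact (D.th_rng hi).1.ne this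
    have hp := Real.pi_ne_zero
    have e1 : (π / (2*π) : ℝ) = 1/2 := by field_simp
    have e2 : (-π / (2*π) : ℝ) = 1/2 - 1 := by field_simp; norm_num
    simp only [hT, gam, hE, ss, e1, e2, map_sub]
    abel
  · intro j hj j' hj' k w θ hθ θ' hθ' e
    exact absurd e (hpos j hj k θ w hθ)
  · intro j hj k w w' θ hθ θ' hθ' _ e
    refine absurd ?_ ha
    rw [← e]; exact (D.fst_zero j k ⟨⟨pi2, le_rfl⟩, hθ, trivial⟩).mpr rfl
  · intros; rfl

lemma F_ratio (j k) (y y0 : PP) (h : Real.cos y0.1 ≠ 0) :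
    (D.F j k y).2.1 * (D.F j k y0).1 * (Real.cos y.1 * Real.sin y0.1 : ℝ) =
    (D.F j k y).1 * (D.F j k y0).2.1 * exp ((y.2.1 - y0.2.1 : ℝ) * I) * (Real.sin y.1 * Real.cos y0.1 : ℝ) := by
  simp only [F]
  have : exp ((y.2.1 - y0.2.1 : ℝ) * I) * exp (y0.2.1 * I) = exp (y.2.1 * I) := by
    rw [← Complex.exp_add]; push_cast; ring_nf
  rw [← this]; push_cast; ring

lemma bc_coc [Finite K] (hE : ∀ k, D.ss P D.m k = t 1) : Coc (D.bc P t) := by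
  have hl : ∀ T, Continuous (D.lf T) := by
    intro T; unfold lf; split_ifs <;> fun_prop
  have hl0 : ∀ q, D.lf (D.Ty q) q ≠ 0 := by
    intro q
    unfold lf; split_ifs with h
    · have h1 := D.Ty_one.mp h
      obtain ⟨j, hj, k, y, hy, e⟩ := q.2
      rw [← e] at h1 ⊢
      intro h2
      have := D.snd_zero j k hy h2
      rw [(D.fst_zero j k hy).mp h1] at this
      exact absurd this (by positivity)
    · exact fun h1 => h (D.Ty_one.mpr h1)
  refine coc_build D.Ty (D.ga P t) D.lf hl hl0 t ?_
  intro q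
  rcases D.Ty_cases q with h | h | ⟨i, hi, h⟩
  · filter_upwards [D.near_zero h] with q' h'
    exact Eventually.of_forall fun x => by rw [h, h']
  · -- type E
    have hne : D.lf 1 q ≠ 0 := h ▸ hl0 q
    filter_upwards [D.near_one h, (hl 1).continuousAt.eventually_ne hne] with q' h1 h2
    by_cases h' : D.Ty q' = 1
    · exact Eventually.of_forall fun x => by rw [h, h']
    have ha : (q' : ℂ × ℂ × ℂ).1 ≠ 0 := fun h => h' (D.Ty_one.mpr h)
    have hb : (q' : ℂ × ℂ × ℂ).2.1 ≠ 0 := by simpa [lf] using h2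
    have hpos : ∀ j ≤ D.m, ∀ k θ w, θ ∈ Icc (D.th j) (D.th (j+1)) → D.F j k (0, θ, w) ≠ q' := by
      intro j hj k θ w hθ e
      apply hb; rw [← e]; simp [F]
    have hc1 : Continuous (fun x : D.X => (x : ℂ × ℂ × ℂ).1) := by fun_prop
    have hc2 : Continuous (fun x : D.X => (x : ℂ × ℂ × ℂ).2.1) := by fun_prop
    have r1 := ev_re_pos hc1 ha
    have r2 := ev_re_pos hc2 hb
    filter_upwards [r1, r2, D.LCp q' (fun j k y0 y => |y.2.1 - y0.2.1| < π/2 ∧ 0 < Real.cos y.1 ∧ 0 < Real.sin y.1) (by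
      rintro j hj k y hy e
      have c1 : ∀ᶠ y' : PP in 𝓝 y, |y'.2.1 - y.2.1| < π/2 := by
        have : ContinuousAt (fun y' : PP => |y'.2.1 - y.2.1|) y := by fun_prop
        refine this.eventually (gt_mem_nhds ?_)
        simp only [sub_self, abs_zero]; positivity
      have n1 := D.norm1 j k hy
      have n2 := D.norm2 j k hy
      rw [e] at n1 n2
      have c2 : 0 < Real.cos y.1 := by
        refine pos_of_mul_pos_right ?_ (Real.exp_pos y.2.2.re).le
        rw [← n1]; positivity
      have c3 : 0 < Real.sin y.1 := by
        refine pos_of_mul_pos_right ?_ (Real.exp_pos y.2.2.re).le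
        rw [← n2]; positivity
      have k2 : ContinuousAt (fun y' : PP => Real.cos y'.1) y := by fun_prop
      have k3 : ContinuousAt (fun y' : PP => Real.sin y'.1) y := by fun_prop
      exact c1.and ((k2.eventually (lt_mem_nhds c2)).and (k3.eventually (lt_mem_nhds c3))))] with x r1 r2 hx
    obtain ⟨y0, hy0, e0, d1, d2, d3⟩ := hx
    have n1 := D.norm1 _ (D.pk x) hy0
    have n2 := D.norm2 _ (D.pk x) hy0
    rw [e0] at n1 n2
    have c2 : 0 < Real.cos y0.1 := by
      refine pos_of_mul_pos_right ?_ (Real.exp_pos y0.2.2.re).le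
      rw [← n1]; positivity
    have c3 : 0 < Real.sin y0.1 := by
      refine pos_of_mul_pos_right ?_ (Real.exp_pos y0.2.2.re).le
      rw [← n2]; positivity
    have S := D.type1_s P t hE h' h1 hpos (D.pj_le x) (D.pj_le q') hy0 (D.py_mem q') e0 (D.py_eq q')
    have FR := D.F_ratio (D.pj x) (D.pk x) (D.py x) y0 c2.ne'
    rw [e0, D.py_eq x] at FR
    set θ := (D.py x).2.1
    set a := (x : ℂ × ℂ × ℂ).1
    set b := (x : ℂ × ℂ × ℂ).2.1
    set a' := (q' : ℂ × ℂ × ℂ).1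
    set b' := (q' : ℂ × ℂ × ℂ).2.1
    have key : (b/b').arg = (a/a').arg + (θ - y0.2.1) := by
      have p1 : 0 < Real.cos (D.py x).1 * Real.sin y0.1 := by positivity
      have p2 : 0 < Real.sin (D.py x).1 * Real.cos y0.1 := by positivity
      have q1 : ((Real.cos (D.py x).1 * Real.sin y0.1 : ℝ) : ℂ) ≠ 0 := by exact_mod_cast p1.ne'
      have e1 : (b/b') = ((Real.sin (D.py x).1 * Real.cos y0.1) / (Real.cos (D.py x).1 * Real.sin y0.1) : ℝ) *
          ((a/a') * exp ((θ - y0.2.1 : ℝ) * I)) := by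
        rw [Complex.ofReal_div]
        field_simp
        linear_combination FR
      have d1' := abs_lt.mp d1
      have hexp : 0 < (exp ((θ - y0.2.1 : ℝ) * I)).re := by
        rw [Complex.exp_ofReal_mul_I_re]
        exact Real.cos_pos_of_mem_Ioo ⟨by linarith [d1'.1], d1'.2⟩
      rw [e1, Complex.arg_real_mul _ (by positivity), arg_mul_of_re r1 hexp]
      congr 1
      rw [Complex.exp_mul_I, Complex.arg_cos_add_sin_mul_I ⟨by linarith [d1'.1, Real.pi_pos], by linarith [d1'.2, Real.pi_pos]⟩]
    have hg1 : D.gam P t 1 (D.pj x) (D.pk x) θ = D.gam P t 1 (D.pj x) (D.pk x) y0.2.1 - t ((θ - y0.2.1)/(2*π)) := by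
      simp only [gam, sub_div, map_sub]; abel
    have hg2 : D.gam P t (D.Ty q') (D.pj x) (D.pk x) θ = D.gam P t (D.Ty q') (D.pj x) (D.pk x) y0.2.1 := by
      rcases D.Ty_cases q' with g | g | ⟨i, hi, g⟩
      · rw [g]; rfl
      · exact absurd g h'
      · rw [g]; rfl
    rw [h]
    simp only [ga, lf, if_neg h', if_true]
    show D.gam P t 1 (D.pj x) (D.pk x) θ - _ + t ((b/b').arg/(2*π)) = D.gam P t (D.Ty q') (D.pj x) (D.pk x) θ - _ + t ((a/a').arg/(2*π))
    rw [hg1, hg2, key, add_div, map_add]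
    rw [sub_eq_sub_iff_add_eq_add] at S
    rw [← sub_eq_zero] at S ⊢
    rw [← S]
    abel
  · filter_upwards [D.near_slit hi h] with q' h'
    rcases h' with h' | h'
    · filter_upwards [D.LCp q' (fun _ _ _ _ => True) (by intros; simp)] with x hx
      obtain ⟨y0, hy0, e0, -⟩ := hx
      have := D.type0_k h' (D.pj_le x) (D.pj_le q') hy0 (D.py_mem q') e0 (D.py_eq q')
      rw [h, h']
      simp only [ga, gam, this, lf]
      simp
    · exact Eventually.of_forall fun x => by rw [h, h']

end SData
end

section
open Filter Topology Set
open Complex (exp I)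
open scoped Real

namespace SData
variable {K : Type} (D : SData K)

section comb
variable {A B : Type*} [AddCommGroup A] [AddCommGroup B]

lemma ss_map (f : A →+ B) (P : ℕ → K → A) (j k) : f (D.ss P j k) = D.ss (fun i k => f (P i k)) j k := by
  induction j generalizing k with
  | zero => simp [ss]
  | succ i ih => simp [ss, ih]

lemma ss_add (P Q : ℕ → K → A) (j k) : D.ss (P + Q) j k = D.ss P j k + D.ss Q j k := by
  induction j generalizing k with
  | zero => simp [ss]
  | succ i ih => simp only [ss, ih, Pi.add_apply]; abel

def ssH : (ℕ → K → A) →+ (K → A) :=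
  AddMonoidHom.mk' (fun P k => D.ss P D.m k) (fun P Q => funext fun k => D.ss_add P Q _ _)

lemma ss_sum [Fintype K] (P : ℕ → K → A) (j) : ∑ k, D.ss P j k = 0 := by
  induction j with
  | zero => simp [ss]
  | succ i ih =>
    simp only [ss, Finset.sum_sub_distrib, Finset.sum_add_distrib]
    rw [Equiv.sum_comp (D.σ i).symm (fun k => D.ss P i k), ih, Equiv.sum_comp (D.σ i).symm (fun k => P i k)]
    abel

def rho : ℕ → Equiv.Perm K
  | 0 => 1
  | (i+1) => D.σ i * rho i

lemma rho_m : D.rho D.m = 1 := by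
  have h1 : ∀ j ≤ D.m, ∀ k, D.η j (D.rho j k) = D.η 0 k := by
    intro j
    induction j with
    | zero => intro _ k; rfl
    | succ i ih =>
      intro hi k
      rw [← ih (by omega) k]
      have a := D.hb2 i hi (D.rho i k) (π/2) ⟨(D.ph1 i hi).le, le_rfl⟩
      rw [D.hd i (by omega) _ _ (D.thR (by omega)), D.hd (i+1) hi _ _ (D.thL hi)] at a
      exact (mul_left_cancel₀ (Complex.exp_ne_zero _) a).symm
  have h0 : -π ∈ Icc (D.th 0) (D.th (0+1)) := D.th0 ▸ D.thL (Nat.zero_le _)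
  have hm : π ∈ Icc (D.th D.m) (D.th (D.m+1)) := D.thm ▸ D.thR le_rfl
  have h2 : ∀ k, D.η 0 k = D.η D.m k := by
    intro k
    have a := D.hc k (π/2) ⟨pi2, le_rfl⟩
    rw [D.hd 0 (Nat.zero_le _) _ _ h0, D.hd D.m le_rfl _ _ hm] at a
    have : exp ((-π : ℝ) * I) = exp (π * I) := by
      rw [Complex.exp_pi_mul_I]; push_cast; rw [neg_mul, Complex.exp_neg, Complex.exp_pi_mul_I]; norm_num
    rw [this] at a
    exact mul_left_cancel₀ (Complex.exp_ne_zero _) a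
  ext k
  have h3 := h1 D.m le_rfl k
  rw [← h2] at h3
  have := D.he 0 (Nat.zero_le _) (π/2) ⟨pi2, le_rfl⟩ (-π) h0 (fun i hi _ => (D.th_rng hi).1.ne)
    (a₁ := D.rho D.m k) (a₂ := k) (by simp only; rw [D.hd 0 (Nat.zero_le _) _ _ h0, D.hd 0 (Nat.zero_le _) _ _ h0, h3])
  simpa using this

lemma ss_eq (P : ℕ → K → A) (j k) :
    D.ss P j (D.rho j k) = ∑ i ∈ Finset.range j, (P i (D.rho (i+1) k) - P i (D.rho i k)) := by
  induction j with
  | zero => simp [ss]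
  | succ i ih =>
    rw [Finset.sum_range_succ, ← ih]
    simp only [ss, rho, Equiv.Perm.mul_apply, Equiv.symm_apply_apply]
    abel

def Trans : Prop := ∀ S : Set K, (∀ i < D.m, ∀ k ∈ S, D.σ i k ∈ S) → S.Nonempty → S = univ

lemma comb [Fintype K] [Nonempty K] (hT : D.Trans) (n : K → ℤ) (hn : ∑ k, n k = 0) :
    ∃ P : ℕ → K → ℤ, ∀ k, D.ss P D.m k = n k := by
  classical
  let G : AddSubgroup (K → ℤ) := (D.ssH (A := ℤ)).range
  have base : ∀ i < D.m, ∀ κ, Pi.single ((D.rho (i+1)).symm κ) (1:ℤ) - Pi.single ((D.rho i).symm κ) 1 ∈ G := by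
    intro i hi κ
    refine ⟨fun i' k => if i' = i ∧ k = κ then 1 else 0, ?_⟩
    ext k
    show D.ss _ D.m k = _
    have h := D.ss_eq (fun i' k => if i' = i ∧ k = κ then (1:ℤ) else 0) D.m k
    rw [D.rho_m, Equiv.Perm.one_apply] at h
    rw [h, Finset.sum_eq_single i]
    · simp [Pi.single_apply, Equiv.eq_symm_apply]
    · intro b _ hb; simp [hb]
    · simp [hi]
  have r : ∀ i ≤ D.m, ∀ κ, Pi.single ((D.rho i).symm κ) (1:ℤ) - Pi.single κ 1 ∈ G := by
    intro i
    induction i with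
    | zero =>
      intro _ κ
      have : (D.rho 0).symm κ = κ := rfl
      rw [this, sub_self]; exact G.zero_mem
    | succ i ih =>
      intro hi κ
      have := G.add_mem (base i hi κ) (ih (by omega) κ)
      simpa using this
  obtain ⟨k1⟩ := ‹Nonempty K›
  have all : {k | Pi.single k (1:ℤ) - Pi.single k1 1 ∈ G} = univ := by
    refine hT _ ?_ ⟨k1, by simp [G.zero_mem]⟩
    intro i hi k hk
    have a1 := r (i+1) hi (D.σ i k)
    have a2 := r i hi.le k
    have : (D.rho (i+1)).symm (D.σ i k) = (D.rho i).symm k := by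
      rw [Equiv.symm_apply_eq]; simp [rho]
    rw [this] at a1
    have := G.add_mem (G.sub_mem a2 a1) hk
    show _ ∈ G
    convert this using 1
    abel
  have hn2 : n = ∑ k, n k • ((Pi.single k (1:ℤ) : K → ℤ) - Pi.single k1 1) := by
    simp only [smul_sub, Finset.sum_sub_distrib, ← Finset.sum_smul, hn, zero_smul, sub_zero]
    ext k
    simp [Finset.sum_apply, Pi.single_apply]
  have hm : n ∈ G := by
    rw [hn2]
    refine G.sum_mem fun k _ => G.zsmul_mem ?_ _
    have : k ∈ {k | Pi.single k (1:ℤ) - Pi.single k1 1 ∈ G} := all ▸ mem_univ k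
    exact this
  obtain ⟨P, hP⟩ := hm
  exact ⟨P, fun k => congrFun hP k⟩
end comb

variable {A : Type*} [AddCommGroup A]

def Ext (c : D.X → D.X → A) (h : ℕ → K → PP → A) : Prop :=
  ∀ j ≤ D.m, ∀ k, ∀ y ∈ D.QC j, ∀ᶠ y' in 𝓝 y, y' ∈ D.QC j → ∀ q x : D.X, D.F j k y = q → D.F j k y' = x →
    c q x = h j k y' - h j k y

lemma ex_ext {c : D.X → D.X → A} (hc : Coc c) : ∃ h, D.Ext c h ∧ ∀ j ≤ D.m, ∀ k, h j k (0, D.th j, 0) = 0 := by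
  have key : ∀ j k, ∃ h : PP → A, j ≤ D.m → (∀ y ∈ D.QC j, ∀ᶠ y' in 𝓝 y, y' ∈ D.QC j → ∀ q x : D.X, D.F j k y = q →
      D.F j k y' = x → c q x = h y' - h y) ∧ h (0, D.th j, 0) = 0 := by
    intro j k
    by_cases hj : j ≤ D.m
    swap
    · exact ⟨0, fun h => absurd h hj⟩
    have hθ : D.th j ≤ D.th (j+1) := (D.thlt j hj).le
    let cl : PP → PP := fun y => (projIcc 0 (π/2) pi2 y.1, projIcc _ _ hθ y.2.1, y.2.2)
    have hcl : Continuous cl := by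
      have := continuous_projIcc (h := pi2)
      have := continuous_projIcc (h := hθ)
      fun_prop
    have hm : ∀ y, cl y ∈ D.QC j := fun y => ⟨Subtype.coe_prop _, Subtype.coe_prop _, trivial⟩
    have hid : ∀ y ∈ D.QC j, cl y = y := by
      rintro ⟨φ, θ, w⟩ ⟨h1, h2, -⟩
      simp only [cl, projIcc_of_mem _ h1, projIcc_of_mem _ h2]
    let f : PP → D.X := fun y => ⟨D.F j k (cl y), j, hj, k, cl y, hm y, rfl⟩
    have hf : Continuous f := ((D.F_cont j k).comp hcl).subtype_mk _
    obtain ⟨h, hh⟩ := coc_tvs (hc.comp hf)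
    refine ⟨fun y => h y - h (0, D.th j, 0), fun _ => ⟨?_, sub_self _⟩⟩
    intro y hy
    filter_upwards [hh y] with y' e hy' q x hq hx
    have e1 : f y = q := Subtype.ext (by simp only [f, hid y hy, hq])
    have e2 : f y' = x := Subtype.ext (by simp only [f, hid y' hy', hx])
    rw [e1, e2] at e
    rw [e]; abel
  choose h hh using key
  exact ⟨h, fun j hj k => (hh j k hj).1, fun j hj k => (hh j k hj).2⟩

variable {D} in
lemma Ext.diff {c : D.X → D.X → A} {h} (he : D.Ext c h) {Z : Type*} [TopologicalSpace Z] {S : Set Z}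
    (hS : IsPreconnected S) {j j' k k'} (hj : j ≤ D.m) (hj' : j' ≤ D.m) (u v : Z → PP) (hu : Continuous u) (hv : Continuous v)
    (mu : ∀ z ∈ S, u z ∈ D.QC j) (mv : ∀ z ∈ S, v z ∈ D.QC j') (e : ∀ z ∈ S, D.F j k (u z) = D.F j' k' (v z))
    {x y : Z} (hx : x ∈ S) (hy : y ∈ S) : h j k (u x) - h j' k' (v x) = h j k (u y) - h j' k' (v y) := by
  refine const_of_loc hS (g := fun z => h j k (u z) - h j' k' (v z)) ?_ hx hy
  intro z hz
  have h1 := (hu.tendsto z).eventually (he j hj k (u z) (mu z hz))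
  have h2 := (hv.tendsto z).eventually (he j' hj' k' (v z) (mv z hz))
  filter_upwards [self_mem_nhdsWithin, mem_nhdsWithin_of_mem_nhds h1, mem_nhdsWithin_of_mem_nhds h2] with z' hz' a b
  have a := a (mu z' hz') ⟨_, j, hj, k, _, mu z hz, rfl⟩ ⟨_, j, hj, k, _, mu z' hz', rfl⟩ rfl rfl
  have b := b (mv z' hz') ⟨_, j, hj, k, _, mu z hz, rfl⟩ ⟨_, j, hj, k, _, mu z' hz', rfl⟩ (e z hz).symm (e z' hz').symm
  rw [a] at b
  rw [sub_eq_sub_iff_add_eq_add] at b ⊢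
  rw [b, add_comm]

end SData
end

section
open Filter Topology Set
open Complex (exp I)
open scoped Real

namespace SData
variable {K : Type} {D : SData K} {A : Type*} [AddCommGroup A]

structure Ex (D : SData K) (c : D.X → D.X → A) (h : ℕ → K → PP → A) (P : ℕ → K → A) (τ : A) : Prop where
  ext : D.Ext c h
  zero : ∀ j ≤ D.m, ∀ j' ≤ D.m, ∀ k w, ∀ θ ∈ Icc (D.th j) (D.th (j+1)), ∀ θ' ∈ Icc (D.th j') (D.th (j'+1)),
      h j k (0, θ, w) = h j' k (0, θ', w)
  low : ∀ i < D.m, ∀ k φ w, φ ∈ Icc 0 (D.ph i) → h i k (φ, D.th (i+1), w) = h (i+1) k (φ, D.th (i+1), w)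
  up : ∀ i < D.m, ∀ k φ w, φ ∈ Icc (D.ph i) (π/2) →
    h i k (φ, D.th (i+1), w) + P i k = h (i+1) (D.σ i k) (φ, D.th (i+1), w) + P i (D.σ i k)
  wrap : ∀ k φ w, φ ∈ Icc 0 (π/2) → h 0 k (φ, -π, w) = h D.m k (φ, π, w)
  top : ∀ j ≤ D.m, ∀ k w w', ∀ θ ∈ Icc (D.th j) (D.th (j+1)), ∀ θ' ∈ Icc (D.th j) (D.th (j+1)),
      w + θ * I = w' + θ' * I → h j k (π/2, θ, w) = h j k (π/2, θ', w')
  per : ∀ j ≤ D.m, ∀ k φ θ w, (φ, θ, w) ∈ D.QC j → h j k (φ, θ, w + 2 * π * I) = h j k (φ, θ, w) + τ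
  hP : ∀ i < D.m, ∀ k, h (i+1) k (D.ph i, D.th (i+1), 0) = - P i k

lemma prec (a b : ℝ) : IsPreconnected (Icc a b ×ˢ (univ : Set ℂ)) := isPreconnected_Icc.prod isPreconnected_univ

lemma m0 : -π ∈ Icc (D.th 0) (D.th (0+1)) := D.th0 ▸ D.thL (Nat.zero_le _)
lemma mm : π ∈ Icc (D.th D.m) (D.th (D.m+1)) := D.thm ▸ D.thR le_rfl

lemma F_per (j k φ θ w) : D.F j k (φ, θ, w + 2 * π * I) = D.F j k (φ, θ, w) := by
  simp only [F, Complex.exp_periodic w]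

lemma ex_Ex [Nonempty K] (hT : D.Trans) {c : D.X → D.X → A} (hc : Coc c) : ∃ h P τ, Ex D c h P τ := by
  obtain ⟨h, he, hn⟩ := D.ex_ext hc
  have z0 : (0:ℝ) ∈ Icc 0 (π/2) := ⟨le_rfl, pi2⟩
  have z1 : ∀ j ≤ D.m, ∀ k w, ∀ θ ∈ Icc (D.th j) (D.th (j+1)), h j k (0, θ, w) = h j k (0, D.th j, w) := by
    intro j hj k w θ hθ
    have := he.diff (k := k) (k' := k) (S := Icc (D.th j) (D.th (j+1))) isPreconnected_Icc hj hj (fun r : ℝ => (0, r, w))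
      (fun _ => (0, D.th j, w)) (by fun_prop) (by fun_prop) (fun r hr => ⟨z0, hr, trivial⟩) (fun r hr => ⟨z0, D.thL hj, trivial⟩)
      (fun r hr => by simp [F, D.ha j hj k r hr, D.ha j hj k _ (D.thL hj)]) hθ (D.thL hj)
    simpa [sub_eq_zero] using this
  have z2 : ∀ j ≤ D.m, ∀ j' ≤ D.m, ∀ k w, h j k (0, D.th j, w) = h j' k (0, D.th j', w) := by
    intro j hj j' hj' k w
    have := he.diff (k := k) (k' := k) (S := univ) isPreconnected_univ hj hj' (fun w : ℂ => (0, D.th j, w))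
      (fun w => (0, D.th j', w)) (by fun_prop) (by fun_prop) (fun r hr => ⟨z0, D.thL hj, trivial⟩) (fun r hr => ⟨z0, D.thL hj', trivial⟩)
      (fun r hr => by simp [F, D.ha j hj k _ (D.thL hj), D.ha j' hj' k _ (D.thL hj')]) (mem_univ w) (mem_univ 0)
    rw [hn j hj, hn j' hj', sub_self, sub_eq_zero] at this
    exact this
  have zero : ∀ j ≤ D.m, ∀ j' ≤ D.m, ∀ k w, ∀ θ ∈ Icc (D.th j) (D.th (j+1)), ∀ θ' ∈ Icc (D.th j') (D.th (j'+1)),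
      h j k (0, θ, w) = h j' k (0, θ', w) := by
    intro j hj j' hj' k w θ hθ θ' hθ'
    rw [z1 j hj k w θ hθ, z1 j' hj' k w θ' hθ', z2 j hj j' hj']
  have low : ∀ i < D.m, ∀ k φ w, φ ∈ Icc 0 (D.ph i) → h i k (φ, D.th (i+1), w) = h (i+1) k (φ, D.th (i+1), w) := by
    intro i hi k φ w hφ
    have := he.diff (k := k) (k' := k) (prec 0 (D.ph i)) hi.le hi (fun z : ℝ × ℂ => (z.1, D.th (i+1), z.2))
      (fun z : ℝ × ℂ => (z.1, D.th (i+1), z.2)) (by fun_prop) (by fun_prop)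
      (fun z hz => ⟨⟨hz.1.1, hz.1.2.trans (D.ph1 i hi).le⟩, D.thR hi.le, trivial⟩)
      (fun z hz => ⟨⟨hz.1.1, hz.1.2.trans (D.ph1 i hi).le⟩, D.thL hi, trivial⟩)
      (fun z hz => by simp [F, D.hb1 i hi k z.1 hz.1]) (x := (φ, w)) (y := (0, w)) ⟨hφ, trivial⟩ ⟨⟨le_rfl, (D.ph0 i hi).le⟩, trivial⟩
    rw [zero i hi.le (i+1) hi k w _ (D.thR hi.le) _ (D.thL hi), sub_self, sub_eq_zero] at this
    exact this
  have top : ∀ j ≤ D.m, ∀ k w w', ∀ θ ∈ Icc (D.th j) (D.th (j+1)), ∀ θ' ∈ Icc (D.th j) (D.th (j+1)),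
      w + θ * I = w' + θ' * I → h j k (π/2, θ, w) = h j k (π/2, θ', w') := by
    intro j hj k w w' θ hθ θ' hθ' e
    have := he.diff (k := k) (k' := k) (S := Icc (D.th j) (D.th (j+1))) isPreconnected_Icc hj hj (fun r : ℝ => (π/2, r, w + θ * I - r * I))
      (fun _ => (π/2, θ, w)) (by fun_prop) (by fun_prop) (fun r hr => ⟨⟨pi2, le_rfl⟩, hr, trivial⟩) (fun r hr => ⟨⟨pi2, le_rfl⟩, hθ, trivial⟩)
      (fun r hr => by
        have e2 : exp (w + θ * I - r * I) * exp (r * I) = exp w * exp (θ * I) := by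
          rw [← Complex.exp_add, ← Complex.exp_add]; ring_nf
        simp [F, D.hd j hj k r hr, D.hd j hj k _ hθ]
        rw [← mul_assoc, ← mul_assoc, e2]; simp) hθ' hθ
    have e3 : w + θ * I - θ' * I = w' := by rw [e]; ring
    simp only [add_sub_cancel_right, sub_self, e3] at this
    exact (sub_eq_zero.mp this).symm
  have per0 : ∀ j ≤ D.m, ∀ k φ θ w, (φ, θ, w) ∈ D.QC j → h j k (φ, θ, w + 2 * π * I) - h j k (φ, θ, w) =
      h 0 k (0, D.th 0, 2 * π * I) := by
    intro j hj k φ θ w hy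
    have hpc : IsPreconnected (D.QC j) := isPreconnected_Icc.prod (isPreconnected_Icc.prod isPreconnected_univ)
    have := he.diff (k := k) (k' := k) hpc hj hj (fun y : PP => (y.1, y.2.1, y.2.2 + 2 * π * I)) (fun y => y)
      (by fun_prop) (by fun_prop) (fun y hy => ⟨hy.1, hy.2.1, trivial⟩) (fun y hy => hy) (fun y hy => F_per _ _ _ _ _)
      (x := (φ, θ, w)) (y := (0, D.th j, 0)) hy ⟨z0, D.thL hj, trivial⟩
    simp only [hn j hj, zero_add, sub_zero] at this
    rw [this, z2 j hj 0 (Nat.zero_le _)]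
  have up0 : ∀ i < D.m, ∀ k φ w, φ ∈ Icc (D.ph i) (π/2) →
      h i k (φ, D.th (i+1), w) - h (i+1) (D.σ i k) (φ, D.th (i+1), w) =
      h i k (D.ph i, D.th (i+1), 0) - h (i+1) (D.σ i k) (D.ph i, D.th (i+1), 0) := by
    intro i hi k φ w hφ
    exact he.diff (k := k) (k' := D.σ i k) (prec (D.ph i) (π/2)) hi.le hi (fun z : ℝ × ℂ => (z.1, D.th (i+1), z.2))
      (fun z : ℝ × ℂ => (z.1, D.th (i+1), z.2)) (by fun_prop) (by fun_prop)
      (fun z hz => ⟨D.phpos hi hz.1, D.thR hi.le, trivial⟩)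
      (fun z hz => ⟨D.phpos hi hz.1, D.thL hi, trivial⟩)
      (fun z hz => by simp [F, D.hb2 i hi k z.1 hz.1]) (x := (φ, w)) (y := (D.ph i, 0)) ⟨hφ, trivial⟩ ⟨⟨le_rfl, (D.ph1 i hi).le⟩, trivial⟩
  have tau : ∃ τ, ∀ k, h 0 k (0, D.th 0, 2 * π * I) = τ := by
    obtain ⟨k1⟩ := ‹Nonempty K›
    refine ⟨h 0 k1 (0, D.th 0, 2 * π * I), fun k => ?_⟩
    have : {k | h 0 k (0, D.th 0, 2 * π * I) = h 0 k1 (0, D.th 0, 2 * π * I)} = univ := by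
      refine hT _ ?_ ⟨k1, rfl⟩
      intro i hi k hk
      have hpp : D.ph i ∈ Icc (D.ph i) (π/2) := ⟨le_rfl, (D.ph1 i hi).le⟩
      have a := up0 i hi k (D.ph i) (0 + 2 * π * I) hpp
      have b := per0 i hi.le k (D.ph i) (D.th (i+1)) 0 ⟨D.phpos hi hpp, D.thR hi.le, trivial⟩
      have b' := per0 (i+1) hi (D.σ i k) (D.ph i) (D.th (i+1)) 0 ⟨D.phpos hi hpp, D.thL hi, trivial⟩
      show _ = _
      rw [← show _ = _ from hk, ← b, ← b']
      rw [sub_eq_sub_iff_sub_eq_sub] at a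
      exact a.symm
    have : k ∈ {k | h 0 k (0, D.th 0, 2 * π * I) = h 0 k1 (0, D.th 0, 2 * π * I)} := this ▸ mem_univ k
    exact this
  obtain ⟨τ, hτ⟩ := tau
  refine ⟨h, fun i k => - h (i+1) k (D.ph i, D.th (i+1), 0), τ, he, zero, low, ?_, ?_, top, ?_, ?_⟩
  · intro i hi k φ w hφ
    have := up0 i hi k φ w hφ
    rw [low i hi k (D.ph i) 0 ⟨(D.ph0 i hi).le, le_rfl⟩] at this
    rw [← sub_eq_add_neg, ← sub_eq_add_neg]
    exact sub_eq_sub_iff_sub_eq_sub.mp this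
  · intro k φ w hφ
    have := he.diff (k := k) (k' := k) (prec 0 (π/2)) (Nat.zero_le _) le_rfl (fun z : ℝ × ℂ => (z.1, -π, z.2))
      (fun z : ℝ × ℂ => (z.1, π, z.2)) (by fun_prop) (by fun_prop)
      (fun z hz => ⟨hz.1, m0, trivial⟩)
      (fun z hz => ⟨hz.1, mm, trivial⟩)
      (fun z hz => by
        have : exp ((-π : ℝ) * I) = exp (π * I) := by
          rw [Complex.exp_pi_mul_I]; push_cast; rw [neg_mul, Complex.exp_neg, Complex.exp_pi_mul_I]; norm_num
        simp only [F, this, D.hc k z.1 hz.1]) (x := (φ, w)) (y := (0, w)) ⟨hφ, trivial⟩ ⟨z0, trivial⟩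
    rw [zero 0 (Nat.zero_le _) D.m le_rfl k w _ m0 _ mm, sub_self, sub_eq_zero] at this
    exact this
  · intro j hj k φ θ w hy
    rw [← hτ k, ← per0 j hj k φ θ w hy]; abel
  · intro i hi k; simp

variable {c : D.X → D.X → A} {h : ℕ → K → PP → A} {P : ℕ → K → A} {τ : A}

lemma Ex.perZ (E : Ex D c h P τ) {j} (hj : j ≤ D.m) {k φ θ w} (n : ℤ) (hy : (φ, θ, w) ∈ D.QC j) :
    h j k (φ, θ, w + n * (2 * π * I)) = h j k (φ, θ, w) + n • τ := by
  have hy' : ∀ w', (φ, θ, w') ∈ D.QC j := fun w' => ⟨hy.1, hy.2.1, trivial⟩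
  induction n with
  | zero => simp
  | succ n ih =>
    rw [add_smul, one_smul, ← add_assoc, ← ih, ← E.per j hj k φ θ _ (hy' _)]
    push_cast; ring_nf
  | pred n ih =>
    rw [sub_smul, one_smul, ← add_sub_assoc, ← ih, eq_sub_iff_add_eq, ← E.per j hj k φ θ _ (hy' _)]
    push_cast; ring_nf

lemma Ex.hE (E : Ex D c h P τ) (k : K) : D.ss P D.m k = τ := by
  have h1 : ∀ j ≤ D.m, ∀ k, h j (D.rho j k) (π/2, D.th j, -D.th j * I) = h 0 k (π/2, D.th 0, -D.th 0 * I) - D.ss P j (D.rho j k) := by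
    intro j
    induction j with
    | zero => intro _ k; simp [rho, ss]
    | succ i ih =>
      intro hi k
      have hi' : i < D.m := hi
      have a := E.up i hi (D.rho i k) (π/2) (-D.th (i+1) * I) ⟨(D.ph1 i hi).le, le_rfl⟩
      rw [E.top i hi'.le (D.rho i k) _ (-D.th i * I) (D.th (i+1)) (D.thR hi'.le) (D.th i) (D.thL hi'.le) (by ring), ih hi'.le] at a
      simp only [rho, Equiv.Perm.mul_apply, ss, Equiv.symm_apply_apply]
      rw [← sub_eq_iff_eq_add] at a
      rw [← a]; abel
  have h2 := h1 D.m le_rfl k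
  rw [D.rho_m, Equiv.Perm.one_apply] at h2
  have h3 := E.wrap k (π/2) (π * I) ⟨pi2, le_rfl⟩
  have h4 : h D.m k (π/2, π, π * I) = h D.m k (π/2, π, -π * I) + τ := by
    rw [← E.per D.m le_rfl k (π/2) π (-π * I) ⟨⟨pi2, le_rfl⟩, mm, trivial⟩]; ring_nf
  have h5 : h D.m k (π/2, D.th D.m, -D.th D.m * I) = h D.m k (π/2, π, -π * I) :=
    E.top _ le_rfl k _ _ _ (D.thL le_rfl) _ mm (by ring)
  have h6 : h 0 k (π/2, D.th 0, -D.th 0 * I) = h 0 k (π/2, -π, π * I) := by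
    rw [D.th0]; push_cast; ring_nf
  rw [h5, h6, h3, h4] at h2
  have : h D.m k (π/2, π, -π * I) + D.ss P D.m k = h D.m k (π/2, π, -π * I) + τ := by
    nth_rw 1 [h2]; abel
  exact add_left_cancel this

lemma Ex.dtau [Fintype K] (E : Ex D c h P τ) : Fintype.card K • τ = 0 := by
  have := D.ss_sum P D.m
  simp only [E.hE, Finset.sum_const, Finset.card_univ] at this
  exact this

end SData
end

section
open Filter Topology Set
open Complex (exp I)
open scoped Real

namespace SData
variable {K : Type} {D : SData K} 

lemma divBy_card [Fintype K] [Nonempty K] (hT : D.Trans) : DivBy D.X (Fintype.card K) := by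
  intro c hc
  obtain ⟨h, P, τ, E⟩ := ex_Ex hT hc
  set d := Fintype.card K
  have lift : ∀ i k, ∃ r : ℝ, (r : AddCircle (1:ℝ)) = d • P i k := fun i k => QuotientAddGroup.mk_surjective _
  choose R hR using lift
  let mkH : ℝ →+ AddCircle (1:ℝ) := QuotientAddGroup.mk' _
  have hmk : ∀ r, mkH r = (r : AddCircle (1:ℝ)) := fun r => rfl
  have s1 : ∀ k, ((D.ss R D.m k : ℝ) : AddCircle (1:ℝ)) = 0 := by
    intro k
    rw [← hmk, D.ss_map mkH]
    have : (fun i k => mkH (R i k)) = fun i k => (nsmulAddMonoidHom d) (P i k) := by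
      funext i k; rw [hmk, hR]; rfl
    rw [this, ← D.ss_map, E.hE]
    exact E.dtau
  have s2 : ∀ k, ∃ n : ℤ, (n:ℝ) = D.ss R D.m k := by
    intro k
    obtain ⟨n, hn⟩ := (AddCircle.coe_eq_zero_iff (1:ℝ)).mp (s1 k)
    exact ⟨n, by rw [← hn]; simp⟩
  choose n hn using s2
  have s3 : ∑ k, n k = 0 := by
    have := D.ss_sum R D.m
    simp only [← hn] at this
    exact_mod_cast this
  obtain ⟨P0, hP0⟩ := D.comb hT n s3
  let P' : ℕ → K → ℝ := R + fun i k => -(P0 i k : ℝ)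
  have hP' : ∀ i k, ((P' i k : ℝ) : AddCircle (1:ℝ)) = d • P i k := by
    intro i k
    rw [← hR]
    simp only [P', Pi.add_apply, AddCircle.coe_add, AddCircle.coe_neg]
    have : ((P0 i k : ℝ) : AddCircle (1:ℝ)) = 0 := (AddCircle.coe_eq_zero_iff (1:ℝ)).mpr ⟨P0 i k, by simp⟩
    rw [this]; simp
  have hE' : ∀ k, D.ss P' D.m k = (0 : ℝ →+ ℝ) 1 := by
    intro k
    have := D.ss_map (-(Int.castAddHom ℝ)) P0 D.m k
    simp only [AddMonoidHom.neg_apply, Int.coe_castAddHom] at this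
    rw [D.ss_add, ← this, hP0, hn]; simp
  refine ⟨D.bc P' 0, D.bc_coc P' 0 hE', fun x => d • h (D.pj x) (D.pk x) (D.py x), ?_⟩
  intro q
  let V : ℕ → K → PP → AddCircle (1:ℝ) := fun j k y => d • h j k y + ((D.gam P' 0 (D.Ty q) j k y.2.1 : ℝ) : AddCircle (1:ℝ))
  have hper : ∀ j ≤ D.m, ∀ k φ θ w w', (φ, θ, w) ∈ D.QC j → exp w = exp w' → V j k (φ, θ, w) = V j k (φ, θ, w') := by
    intro j hj k φ θ w w' hy e
    obtain ⟨n, hn⟩ := Complex.exp_eq_exp_iff_exists_int.mp e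
    simp only [V]
    rw [hn, E.perZ (w := w') hj n ⟨hy.1, hy.2.1, trivial⟩, smul_add, smul_comm, show d • τ = 0 from E.dtau]
    simp
  have claim : ∀ j ≤ D.m, ∀ j' ≤ D.m, ∀ k k' y y', y ∈ D.QC j → y' ∈ D.QC j' → D.F j k y = q → D.F j' k' y' = q →
      V j k y = V j' k' y' := by
    intro j hj j' hj' k k' y y' hy hy' e e'
    rcases D.Ty_cases q with hq | hq | ⟨i, hi, hq⟩
    · have hV : V = fun j k y => d • h j k y := by funext j k y; simp [V, hq, gam]
      obtain ⟨h1, h2⟩ := D.Ty_zero.mp hq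
      refine D.glue q (D.nonTip_of h2) V ?_ ?_ ?_ ?_ ?_ ?_ hj hj' hy hy' e e'
      · intro i hi k φ w hφ e; simp only [hV]; rw [E.low i hi k φ w hφ]
      · intro i hi k φ w hφ e
        exact absurd ⟨k, φ, w, hφ, e⟩ (h2 i hi)
      · intro k φ w hφ e; simp only [hV]; rw [E.wrap k φ w ⟨hφ.1, hφ.2.le⟩]
      · intro j hj j' hj' k w θ hθ θ' hθ' e; simp only [hV]; rw [E.zero j hj j' hj' k w θ hθ θ' hθ']
      · intro j hj k w w' θ hθ θ' hθ' e1 e; simp only [hV]; rw [E.top j hj k w w' θ hθ θ' hθ' e1]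
      · intro j hj k φ θ w w' hy e1 e; exact hper j hj k φ θ w w' hy e1
    · have hV : V = fun j k y => d • h j k y + ((D.ss P' j k : ℝ) : AddCircle (1:ℝ)) := by funext j k y; simp [V, hq, gam]
      have h1 := D.Ty_one.mp hq
      have hφ' : ∀ j ≤ D.m, ∀ k φ θ w, (φ, θ, w) ∈ D.QC j → D.F j k (φ, θ, w) = q → φ = π/2 := by
        intro j hj k φ θ w hy e
        exact (D.fst_zero j k hy).mp (by rw [e, h1])
      refine D.glue q ?_ V ?_ ?_ ?_ ?_ ?_ ?_ hj hj' hy hy' e e'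
      · rintro j hj k ⟨φ, θ, w⟩ hy e i hi h2
        have := hφ' j hj k φ θ w hy e
        exact absurd (h2.symm.trans this) (D.ph1 i hi).ne
      · intro i hi k φ w hφ e
        have := hφ' i hi.le k φ _ w ⟨⟨hφ.1, hφ.2.trans (D.ph1 i hi).le⟩, D.thR hi.le, trivial⟩ e
        exact absurd (this ▸ hφ.2) (D.ph1 i hi).not_ge
      · intro i hi k φ w hφ e
        simp only [hV, ss, Equiv.symm_apply_apply, AddCircle.coe_add, AddCircle.coe_sub, hP']
        have := E.up i hi k φ w hφ
        rw [eq_sub_iff_add_eq.mpr this, smul_sub, smul_add]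
        abel
      · intro k φ w hφ e
        have := hφ' 0 (Nat.zero_le _) k φ _ w ⟨⟨hφ.1, hφ.2.le⟩, m0, trivial⟩ e
        exact absurd this hφ.2.ne
      · intro j hj j' hj' k w θ hθ θ' hθ' e
        have := hφ' j hj k 0 _ w ⟨⟨le_rfl, pi2⟩, hθ, trivial⟩ e
        exact absurd this.symm (by positivity)
      · intro j hj k w w' θ hθ θ' hθ' e1 e; simp only [hV]; rw [E.top j hj k w w' θ hθ θ' hθ' e1]
      · intro j hj k φ θ w w' hy e1 e; exact hper j hj k φ θ w w' hy e1
    · have hV : V = fun j k y => d • h j k y + d • P i k := by funext j k y; simp [V, hq, gam, hP']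
      obtain ⟨h1, h2⟩ := (D.Ty_slit hi).mp hq
      by_cases hnt : D.NonTip q
      · refine D.glue q hnt V ?_ ?_ ?_ ?_ ?_ ?_ hj hj' hy hy' e e'
        · intro i hi k φ w hφ e; simp only [hV]; rw [E.low i hi k φ w hφ]
        · intro i' hi' k φ w hφ e
          have := D.slit_disj hi' hi ⟨k, φ, w, hφ, e⟩ h2 h1
          subst this
          simp only [hV]
          rw [← smul_add, ← smul_add, E.up i' hi k φ w hφ]
        · intro k φ w hφ e; simp only [hV]; rw [E.wrap k φ w ⟨hφ.1, hφ.2.le⟩]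
        · intro j hj j' hj' k w θ hθ θ' hθ' e; simp only [hV]; rw [E.zero j hj j' hj' k w θ hθ θ' hθ']
        · intro j hj k w w' θ hθ θ' hθ' e1 e; simp only [hV]; rw [E.top j hj k w w' θ hθ θ' hθ' e1]
        · intro j hj k φ θ w w' hy e1 e; exact hper j hj k φ θ w w' hy e1
      · unfold NonTip at hnt
        push Not at hnt
        obtain ⟨j2, hj2, k2, ⟨φ2, θ2, w2⟩, hy2, e2, i2, hi2, hφ2, hθ2⟩ := hnt
        simp only at hφ2 hθ2
        subst hφ2; subst hθ2
        have : i2 = i := D.slit_disj hi2 hi (e2 ▸ D.mem_Sl hi2 hj2 hy2 le_rfl) h2 h1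
        subst this
        have hyr : ∀ w, (D.ph i2, D.th (i2+1), w) ∈ D.QC (i2+1) := fun w => ⟨hy2.1, D.thL hi, trivial⟩
        have red : ∀ j ≤ D.m, ∀ k y, y ∈ D.QC j → D.F j k y = q →
            ∃ w, D.F (i2+1) k (D.ph i2, D.th (i2+1), w) = q ∧ V j k y = V (i2+1) k (D.ph i2, D.th (i2+1), w) := by
          rintro j hj k ⟨φ, θ, w⟩ hy e
          obtain ⟨rfl, -⟩ := D.slit_par hi h2 h1 hj hy e
          obtain ⟨p1, -, -⟩ := D.par_eq hy hy2 (e.trans e2.symm)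
          simp only at p1
          subst p1
          refine ⟨w, ?_⟩
          rcases lt_trichotomy j i2 with h3 | h3 | h3
          · have := (D.sector_cmp hi.le h3 hy.2.1 (D.thR hi.le)).2
            exact absurd this (D.th_mono (show j+1 < i2+1 by omega) (by omega)).ne'
          · subst h3
            have hl : D.ph j ∈ Icc 0 (D.ph j) := ⟨hy2.1.1, le_rfl⟩
            constructor
            · rw [← e]; simp only [F]; rw [D.hb1 j hi k _ hl]
            · simp only [hV]; rw [E.low j hi k _ w hl]
          · obtain ⟨rfl, -⟩ := D.sector_cmp hj h3 (D.thR hi.le) hy.2.1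
            exact ⟨e, rfl⟩
        obtain ⟨w, a1, a2⟩ := red j hj k y hy e
        obtain ⟨w', b1, b2⟩ := red j' hj' k' y' hy' e'
        obtain ⟨-, p2, -⟩ := D.par_eq (hyr w) (hyr w') (a1.trans b1.symm)
        have p3 := p2 (D.ph1 i2 hi)
        simp only at p3
        rw [a2, b2, hper (i2+1) hi k _ _ w w' (hyr w) p3]
        have xi : D.ξ (i2+1) k (D.ph i2) (D.th (i2+1)) = D.ξ (i2+1) k' (D.ph i2) (D.th (i2+1)) := by
          have := congrArg (fun p => p.2.2) (a1.trans b1.symm)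
          simp only [F] at this
          rw [p3] at this
          exact mul_left_cancel₀ (Complex.exp_ne_zero _) this
        have := E.ext.diff (k := k) (k' := k') (S := univ) isPreconnected_univ hi hi
          (fun w : ℂ => (D.ph i2, D.th (i2+1), w)) (fun w : ℂ => (D.ph i2, D.th (i2+1), w)) (by fun_prop) (by fun_prop)
          (fun z _ => hyr z) (fun z _ => hyr z) (fun z _ => by simp only [F, xi]) (mem_univ w') (mem_univ 0)
        rw [E.hP i2 hi, E.hP i2 hi, sub_eq_iff_eq_add] at this
        simp only [hV]
        rw [← smul_add, ← smul_add, this]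
        congr 1; abel
  filter_upwards [D.LCp q (fun j k y0 y => y ∈ D.QC j → ∀ x : D.X, D.F j k y = x → c q x = h j k y - h j k y0) (by
    intro j hj k y hy e
    filter_upwards [E.ext j hj k y hy] with y' h1 h2 x h3
    exact h1 h2 q x e h3)] with x hx
  obtain ⟨y0, hy0, e0, hx⟩ := hx
  have c1 := hx (D.py_mem x) x (D.py_eq x)
  have c2 := claim _ (D.pj_le x) _ (D.pj_le q) _ _ _ _ hy0 (D.py_mem q) e0 (D.py_eq q)
  have gind : ∀ j k θ θ', D.gam P' 0 (D.Ty q) j k θ = D.gam P' 0 (D.Ty q) j k θ' := by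
    intro j k θ θ'
    rcases D.Ty_cases q with g | g | ⟨i, hi, g⟩ <;> simp [g, gam]
  simp only [V] at c2
  simp only [bc, ga, AddMonoidHom.zero_apply, add_zero, c1, AddCircle.coe_sub]
  rw [gind _ _ _ y0.2.1, smul_sub]
  rw [eq_sub_iff_add_eq.mpr c2]
  abel

lemma card_dvd_of_divBy [Fintype K] [Nonempty K] (hT : D.Trans) {m : ℕ} (hm : DivBy D.X m) : Fintype.card K ∣ m := by
  classical
  obtain ⟨k1⟩ := id ‹Nonempty K›
  set d := Fintype.card K with hd
  have hd0 : (d:ℝ) ≠ 0 := by exact_mod_cast Fintype.card_ne_zero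
  obtain ⟨P0, hP0⟩ := D.comb hT (fun k => (if k = k1 then (d:ℤ) else 0) - 1) (by
    rw [Finset.sum_sub_distrib]; simp [hd])
  let mkH : ℝ →+ AddCircle (1:ℝ) := QuotientAddGroup.mk' _
  have hmk : ∀ r, mkH r = (r : AddCircle (1:ℝ)) := fun r => rfl
  let dv : ℝ →+ ℝ := AddMonoidHom.mulRight ((d:ℝ)⁻¹)
  let t : ℝ →+ AddCircle (1:ℝ) := mkH.comp dv
  let f : ℤ →+ AddCircle (1:ℝ) := -(t.comp (Int.castAddHom ℝ))
  have hE : ∀ k, D.ss (fun i k => f (P0 i k)) D.m k = t 1 := by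
    intro k
    rw [← D.ss_map f, hP0]
    split_ifs
    · simp only [f, t, dv, AddMonoidHom.neg_apply, AddMonoidHom.comp_apply, hmk, Int.coe_castAddHom, AddMonoidHom.coe_mulRight]
      push_cast
      rw [sub_mul, mul_inv_cancel₀ hd0, AddCircle.coe_sub, AddCircle.coe_period]; simp
    · simp [f]
  obtain ⟨c', hc', H, hH⟩ := hm _ (D.bc_coc _ t hE)
  obtain ⟨h, P, τ, E⟩ := ex_Ex hT hc'
  have hτ : τ = 0 := by
    have := E.dtau
    rw [nsmul_eq_mul] at this
    exact (mul_eq_zero.mp this).resolve_left hd0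
  have hy : ∀ w, ((0, D.th 0, w) : PP) ∈ D.QC 0 := fun w => ⟨⟨le_rfl, pi2⟩, D.thL (Nat.zero_le _), trivial⟩
  let g : ℝ → D.X := fun r => ⟨D.F 0 k1 (0, D.th 0, r * I), 0, Nat.zero_le _, k1, _, hy _, rfl⟩
  have hg : Continuous g := ((D.F_cont 0 k1).comp (by fun_prop)).subtype_mk _
  have hT0 : ∀ r, D.Ty (g r) = 0 := by
    intro r
    have ha : (g r : ℂ × ℂ × ℂ).1 ≠ 0 := by simp [g, F]
    refine D.Ty_zero.mpr ⟨ha, fun i hi h => ?_⟩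
    have := (D.slit_par hi h ha (Nat.zero_le _) (hy (r * I)) rfl).2
    exact (D.ph0 i hi).not_ge this
  have const := const_of_loc (S := (univ : Set ℝ)) isPreconnected_univ
    (g := fun r => m • t (r / (2*π)) - ((h 0 k1 (0, D.th 0, r * I) : ℝ) : AddCircle (1:ℝ)) - H (g r)) (by
    intro r _
    rw [nhdsWithin_univ]
    have cc : Continuous (fun r : ℝ => ((0, D.th 0, r * I) : PP)) := by fun_prop
    have e1 := (hg.tendsto r).eventually (hH (g r))
    have e2 := (cc.tendsto r).eventually (E.ext 0 (Nat.zero_le _) k1 _ (hy (r * I)))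
    filter_upwards [e1, e2, Metric.ball_mem_nhds r Real.pi_pos] with r' a1 a2 a3
    have a2 := a2 (hy _) (g r) (g r') rfl rfl
    rw [a2] at a1
    rw [Metric.mem_ball, Real.dist_eq, abs_lt] at a3
    have : (D.lf 0 (g r') / D.lf 0 (g r)).arg = r' - r := by
      have : D.lf 0 (g r') / D.lf 0 (g r) = exp ((r' - r : ℝ) * I) := by
        simp only [lf, g, F]
        simp only [Nat.zero_ne_one, if_false, Real.cos_zero, Complex.ofReal_one, mul_one]
        rw [← Complex.exp_sub]; push_cast; ring_nf
      rw [this, Complex.exp_mul_I, Complex.arg_cos_add_sin_mul_I ⟨a3.1, a3.2.le⟩]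
    simp only [bc, hT0, ga, gam, sub_self, zero_add, this, sub_div, map_sub, AddCircle.coe_sub, smul_sub] at a1
    rw [← sub_eq_zero] at a1 ⊢
    rw [← a1]; abel) (mem_univ (2*π)) (mem_univ 0)
  have g0 : g (2*π) = g 0 := by
    apply Subtype.ext
    simp only [g]
    have := F_per (D := D) 0 k1 0 (D.th 0) 0
    push_cast
    rw [zero_mul, ← this, zero_add]
  have p0 := E.per 0 (Nat.zero_le _) k1 0 (D.th 0) 0 (hy 0)
  rw [hτ, add_zero, zero_add] at p0
  rw [g0] at const
  simp only [Complex.ofReal_mul, Complex.ofReal_ofNat, p0, Complex.ofReal_zero, zero_mul, zero_div, map_zero, smul_zero] at const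
  rw [div_self (by positivity), sub_left_inj, sub_left_inj] at const
  have fin : ((m • (d:ℝ)⁻¹ : ℝ) : AddCircle (1:ℝ)) = 0 := by
    rw [← const, AddCircle.coe_nsmul]; simp [t, dv, hmk]
  obtain ⟨n, hn⟩ := (AddCircle.coe_eq_zero_iff (1:ℝ)).mp fin
  have : (m:ℝ) = d * n := by
    simp at hn; rw [hn]; field_simp
  have h2 : (m:ℤ) = d * n := by exact_mod_cast this
  exact Int.natCast_dvd_natCast.mp ⟨n, h2⟩

end SData
end

section
open Filter Topology Set

structure RFam {B : Type*} [TopologicalSpace B] (p : B → Polynomial ℂ) (d : ℕ) : Prop where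
  mon : ∀ b, (p b).Monic
  deg : ∀ b, (p b).natDegree = d
  cont : Continuous fun x : B × ℂ => (p x.1).eval x.2

theorem multiset_prod_ge (s : Multiset ℂ) (r : ℂ) (ε : ℝ) (hε : 0 ≤ ε) (h : ∀ z ∈ s, ε ≤ ‖r - z‖) :
    ε ^ s.card ≤ ‖(s.map fun z => r - z).prod‖ := by
  induction s using Multiset.induction_on with
  | empty => simp
  | cons a s ih =>
    simp only [Multiset.card_cons, Multiset.map_cons, Multiset.prod_cons, norm_mul, pow_succ']
    have h1 := h a (by simp)
    have h2 := ih fun z hz => h z (by simp [hz])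
    gcongr

theorem eval_ge (q : Polynomial ℂ) (hq : q.Monic) (r : ℂ) (ε : ℝ) (hε : 0 ≤ ε)
    (h : ∀ z, q.IsRoot z → ε ≤ ‖r - z‖) : ε ^ q.natDegree ≤ ‖q.eval r‖ := by
  have hs := IsAlgClosed.splits q
  have h1 := hs.eval_eq_prod_roots_of_monic hq (x := r)
  have h2 : q.natDegree = q.roots.card := hs.natDegree_eq_card_roots
  rw [h1, h2]
  exact multiset_prod_ge _ _ _ hε fun z hz => h z (Polynomial.isRoot_of_mem_roots hz)

namespace RFam
variable {B : Type*} [TopologicalSpace B] {p : B → Polynomial ℂ} {d : ℕ}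

theorem comp (h : RFam p d) {A : Type*} [TopologicalSpace A] (f : A → B) (hf : Continuous f) :
    RFam (fun a => p (f a)) d :=
  ⟨fun a => h.mon _, fun a => h.deg _,
    h.cont.comp ((hf.comp continuous_fst).prodMk continuous_snd)⟩

theorem near (h : RFam p d) (b0 : B) (r : ℂ) (hr : (p b0).IsRoot r) (ε : ℝ) (hε : 0 < ε) :
    ∀ᶠ b in 𝓝 b0, ∃ z, (p b).IsRoot z ∧ ‖z - r‖ < ε := by
  have h1 : Continuous fun b => ‖(p b).eval r‖ :=
    (h.cont.comp (continuous_id.prodMk continuous_const)).norm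
  have h2 : ∀ᶠ b in 𝓝 b0, ‖(p b).eval r‖ < ε ^ d := by
    refine h1.continuousAt.eventually_lt_const ?_
    show ‖(p b0).eval r‖ < ε ^ d
    rw [show (p b0).eval r = 0 from hr]; simpa using pow_pos hε d
  filter_upwards [h2] with b hb
  by_contra hc
  push Not at hc
  have := eval_ge (p b) (h.mon b) r ε hε.le (fun z hz => by rw [norm_sub_rev]; exact hc z hz)
  rw [h.deg] at this; linarith

theorem card_sep (q : Polynomial ℂ) (hq : q.Separable) (h0 : q ≠ 0) :
    q.roots.toFinset.card = q.natDegree := by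
  rw [Multiset.toFinset_card_of_nodup (Polynomial.nodup_roots hq)]
  exact ((IsAlgClosed.splits q).natDegree_eq_card_roots).symm

theorem loc (h : RFam p d) (b0 : B) (hs : (p b0).Separable) : ∃ ε > 0,
    (∀ r r', (p b0).IsRoot r → (p b0).IsRoot r' → r ≠ r' → 2 * ε ≤ ‖r - r'‖) ∧
    ∀ᶠ b in 𝓝 b0, (∀ r, (p b0).IsRoot r → ∃ z, (p b).IsRoot z ∧ ‖z - r‖ < ε) ∧
      (∀ z, (p b).IsRoot z → ∃ r, (p b0).IsRoot r ∧ ‖z - r‖ < ε) ∧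
      (∀ r z z', (p b0).IsRoot r → (p b).IsRoot z → (p b).IsRoot z' → ‖z - r‖ < ε → ‖z' - r‖ < ε
        → z = z') := by
  classical
  have hmem : ∀ b r, r ∈ (p b).roots.toFinset ↔ (p b).IsRoot r := by
    intro b r; simp [(h.mon b).ne_zero]
  obtain ⟨ε, hε, hsep⟩ : ∃ ε > (0:ℝ), ∀ r r', (p b0).IsRoot r → (p b0).IsRoot r' → r ≠ r' →
      2 * ε ≤ ‖r - r'‖ := by
    set S := (p b0).roots.toFinset.offDiag
    have : ∀ T : Finset (ℂ × ℂ), (∀ x ∈ T, x.1 ≠ x.2) → ∃ ε > (0:ℝ), ∀ x ∈ T, 2 * ε ≤ ‖x.1 - x.2‖ := by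
      intro T
      induction T using Finset.induction_on with
      | empty => intro _; exact ⟨1, one_pos, by simp⟩
      | insert a T ha ih =>
        intro hT
        obtain ⟨ε, hε, hh⟩ := ih fun x hx => hT x (by simp [hx])
        have : 0 < ‖a.1 - a.2‖ := norm_pos_iff.2 (sub_ne_zero.2 (hT a (by simp)))
        refine ⟨min ε (‖a.1 - a.2‖ / 2), by positivity, fun x hx => ?_⟩
        rcases Finset.mem_insert.1 hx with rfl | hx
        · have := min_le_right ε (‖x.1 - x.2‖ / 2); linarith
        · have := min_le_left ε (‖a.1 - a.2‖ / 2); linarith [hh x hx]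
    obtain ⟨ε, hε, hh⟩ := this S (fun x hx => (Finset.mem_offDiag.1 hx).2.2)
    refine ⟨ε, hε, fun r r' hr hr' hne => hh (r, r') (Finset.mem_offDiag.2 ⟨?_, ?_, hne⟩)⟩
    · exact (hmem _ _).2 hr
    · exact (hmem _ _).2 hr'
  refine ⟨ε, hε, hsep, ?_⟩
  have h1 : ∀ᶠ b in 𝓝 b0, ∀ r ∈ (p b0).roots.toFinset, ∃ z, (p b).IsRoot z ∧ ‖z - r‖ < ε :=
    (Filter.eventually_all_finset _).2 fun r hr => h.near b0 r ((hmem _ _).1 hr) ε hε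
  filter_upwards [h1] with b hb
  choose! z hz1 hz2 using hb
  have hinj : ∀ r ∈ (p b0).roots.toFinset, ∀ r' ∈ (p b0).roots.toFinset, ∀ w, ‖w - r‖ < ε →
      ‖w - r'‖ < ε → r = r' := by
    intro r hr r' hr' w hw hw'
    by_contra hne
    have h1 := hsep r r' ((hmem _ _).1 hr) ((hmem _ _).1 hr') hne
    have : ‖r - r'‖ ≤ ‖w - r‖ + ‖w - r'‖ := by
      rw [norm_sub_rev w r]; exact norm_sub_le_norm_sub_add_norm_sub r w r'
    linarith
  have himg : (p b0).roots.toFinset.image z = (p b).roots.toFinset := by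
    apply Finset.eq_of_subset_of_card_le
    · intro w hw
      obtain ⟨r, hr, rfl⟩ := Finset.mem_image.1 hw
      exact (hmem _ _).2 (hz1 r hr)
    · rw [Finset.card_image_of_injOn, card_sep _ hs (h.mon b0).ne_zero, h.deg]
      · refine (Multiset.toFinset_card_le _).trans ?_
        rw [← h.deg b]; exact Polynomial.card_roots' _
      · intro r hr r' hr' he
        have he : z r = z r' := he
        exact hinj r hr r' hr' (z r) (hz2 r hr) (he ▸ hz2 r' hr')
  have hall : ∀ w, (p b).IsRoot w → ∃ r ∈ (p b0).roots.toFinset, z r = w := by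
    intro w hw
    have := (hmem _ _).2 hw
    rw [← himg] at this
    exact Finset.mem_image.1 this
  refine ⟨fun r hr => ⟨z r, hz1 r ((hmem _ _).2 hr), hz2 r ((hmem _ _).2 hr)⟩, fun w hw => ?_, ?_⟩
  · obtain ⟨r, hr, rfl⟩ := hall w hw
    exact ⟨r, (hmem _ _).1 hr, hz2 r hr⟩
  · intro r w w' hr hw hw' h1 h2
    obtain ⟨s, hs, rfl⟩ := hall w hw
    obtain ⟨s', hs', rfl⟩ := hall w' hw'
    rw [hinj s hs r ((hmem _ _).2 hr) _ (hz2 s hs) h1,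
      hinj s' hs' r ((hmem _ _).2 hr) _ (hz2 s' hs') h2]

theorem unique (h : RFam p d) {S : Set B} (hs : ∀ b ∈ S, (p b).Separable) (hS : IsPreconnected S)
    {s s' : B → ℂ} (c : ContinuousOn s S) (c' : ContinuousOn s' S) (r : ∀ b ∈ S, (p b).IsRoot (s b))
    (r' : ∀ b ∈ S, (p b).IsRoot (s' b)) {b0 : B} (hb0 : b0 ∈ S) (h0 : s b0 = s' b0) :
    ∀ b ∈ S, s b = s' b := by
  haveI : PreconnectedSpace S := Subtype.preconnectedSpace hS
  have cs : Continuous fun b : S => s b := continuousOn_iff_continuous_restrict.1 c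
  have cs' : Continuous fun b : S => s' b := continuousOn_iff_continuous_restrict.1 c'
  have hcl : IsClopen {b : S | s b = s' b} := by
    refine ⟨isClosed_eq cs cs', ?_⟩
    rw [isOpen_iff_mem_nhds]
    intro b hb
    have hb : s b = s' b := hb
    obtain ⟨ε, hε, h1, h2⟩ := h.loc b.1 (hs b.1 b.2)
    have h2 := continuous_subtype_val.continuousAt.eventually h2
    have h3 : ∀ᶠ x : S in 𝓝 b, ‖s x - s b‖ < ε := by
      exact (cs.sub (continuous_const (y := s b))).norm.continuousAt.eventually_lt_const (by simpa using hε)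
    have h4 : ∀ᶠ x : S in 𝓝 b, ‖s' x - s b‖ < ε := by
      exact (cs'.sub (continuous_const (y := s b))).norm.continuousAt.eventually_lt_const (by simpa [hb] using hε)
    filter_upwards [h2, h3, h4] with x hx h3 h4
    exact hx.2.2 _ _ _ (r b b.2) (r x x.2) (r' x x.2) h3 h4
  have := hcl.eq_univ ⟨⟨b0, hb0⟩, h0⟩
  intro b hb
  have : (⟨b, hb⟩ : S) ∈ {b : S | s b = s' b} := this ▸ mem_univ _
  exact this

theorem covering (h : RFam p d) (hs : ∀ b, (p b).Separable) :
    IsCoveringMap (fun e : {x : B × ℂ // (p x.1).IsRoot x.2} => e.1.1) := by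
  classical
  intro b0
  obtain ⟨ε, hε, h1, h2⟩ := h.loc b0 (hs b0)
  obtain ⟨U, hU, hUo, hbU⟩ := mem_nhds_iff.1 h2
  have hcf : Continuous (fun e : {x : B × ℂ // (p x.1).IsRoot x.2} => e.1.1) := by fun_prop
  let J : Type := {r : ℂ // (p b0).IsRoot r}
  letI : TopologicalSpace J := ⊥
  haveI : DiscreteTopology J := ⟨rfl⟩
  refine IsEvenlyCovered.to_isEvenlyCovered_preimage (I := J) ?_
  refine ⟨inferInstance, U, hbU, hUo, hUo.preimage hcf, ?_⟩
  have huniq : ∀ (w : ℂ) (r r' : J), ‖w - r.1‖ < ε → ‖w - r'.1‖ < ε → r = r' := by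
    intro w r r' hw hw'
    by_contra hne
    have h1 := h1 r r' r.2 r'.2 (fun h => hne (Subtype.ext h))
    have : ‖r.1 - r'.1‖ ≤ ‖w - r.1‖ + ‖w - r'.1‖ := by
      rw [norm_sub_rev w r]; exact norm_sub_le_norm_sub_add_norm_sub r.1 w r'.1
    linarith
  have hA : ∀ e : ((fun e : {x : B × ℂ // (p x.1).IsRoot x.2} => e.1.1) ⁻¹' U), ∃ r : J,
      ‖e.1.1.2 - r.1‖ < ε := fun e => by
    obtain ⟨r, hr, h⟩ := (hU e.2).2.1 e.1.1.2 e.1.2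
    exact ⟨⟨r, hr⟩, h⟩
  choose F hF using hA
  have hB : ∀ x : U × J, ∃ z, (p x.1).IsRoot z ∧ ‖z - x.2.1‖ < ε := fun x =>
    (hU x.1.2).1 x.2.1 x.2.2
  choose G hG1 hG2 using hB
  refine ⟨{ toFun := fun e => (⟨e.1.1.1, e.2⟩, F e)
            invFun := fun x => ⟨⟨(x.1.1, G x), hG1 x⟩, x.1.2⟩
            left_inv := ?_
            right_inv := ?_
            continuous_toFun := ?_
            continuous_invFun := ?_ }, fun x => rfl⟩
  · rintro ⟨⟨⟨b, z⟩, hz⟩, hb⟩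
    apply Subtype.ext; apply Subtype.ext
    apply Prod.ext
    · rfl
    · exact (hU hb).2.2 _ _ _ (F ⟨⟨⟨b, z⟩, hz⟩, hb⟩).2 (hG1 _) hz (hG2 _) (hF ⟨⟨⟨b, z⟩, hz⟩, hb⟩)
  · rintro ⟨⟨b, hb⟩, r⟩
    apply Prod.ext
    · rfl
    · exact huniq _ _ _ (hF _) (hG2 (⟨b, hb⟩, r))
  · refine Continuous.prodMk (by fun_prop) ?_
    rw [continuous_iff_continuousAt]
    intro e
    have : ∀ᶠ e' in 𝓝 e, F e' = F e := by
      have hc : ContinuousAt (fun e' : ((fun e : {x : B × ℂ // (p x.1).IsRoot x.2} => e.1.1) ⁻¹' U) =>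
        ‖e'.1.1.2 - ((F e : J) : ℂ)‖) e := by
          refine (Continuous.norm (Continuous.sub ?_ continuous_const)).continuousAt
          exact continuous_snd.comp (continuous_subtype_val.comp continuous_subtype_val)
      filter_upwards [hc.eventually_lt_const (hF e)] with e' he'
      exact huniq _ _ _ (hF e') he'
    exact (continuousAt_const (y := F e)).congr (this.mono fun x hx => hx.symm)
  · have hG : Continuous G := by
      rw [continuous_iff_continuousAt]
      rintro ⟨b, r⟩
      rw [Metric.continuousAt_iff']
      intro δ hδ
      set z1 := G (b, r)
      have hz1 : ‖z1 - r.1‖ < ε := hG2 (b, r)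
      have hn := h.near b.1 z1 (hG1 (b, r)) (min δ (ε - ‖z1 - r.1‖)) (lt_min hδ (by linarith))
      have hcx : ContinuousAt (fun x : U × J => x.1.1) (b, r) := by fun_prop
      have hn := hcx.eventually hn
      have hr : ∀ᶠ x : U × J in 𝓝 (b, r), x.2 = r := by
        have : ContinuousAt (fun x : U × J => x.2) (b, r) := by fun_prop
        exact this.eventually (p := fun y => y = r) (by rw [nhds_discrete]; simp)
      filter_upwards [hn, hr] with x hx hxr
      obtain ⟨z, hz, hzz⟩ := hx
      have : z = G x := by
        refine (hU x.1.2).2.2 r.1 _ _ r.2 hz (hG1 x) ?_ (hxr ▸ hG2 x)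
        have := hzz.trans_le (min_le_right _ _)
        have h3 := norm_sub_le_norm_sub_add_norm_sub z z1 r.1
        linarith
      rw [dist_eq_norm, ← this]
      exact hzz.trans_le (min_le_left _ _)
    exact Continuous.subtype_mk (Continuous.subtype_mk (by fun_prop) _) _

theorem sections (h : RFam p d) (hs : ∀ b, (p b).Separable) (b0 : B)
    (H : C(unitInterval × B, B)) (H0 : ∀ b, H (0, b) = b0) (H1 : ∀ b, H (1, b) = b)
    (H2 : ∀ t, H (t, b0) = b0)
    (z : ℂ) (hz : (p b0).IsRoot z) :
    ∃ s : B → ℂ, Continuous s ∧ (∀ b, (p b).IsRoot (s b)) ∧ s b0 = z := by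
  have cov := h.covering hs
  let e0 : {x : B × ℂ // (p x.1).IsRoot x.2} := ⟨(b0, z), hz⟩
  let L := cov.liftHomotopy H (ContinuousMap.const B e0) (fun b => H0 b)
  have hL : ∀ x, (L x).1.1 = H x := fun x => congr_fun (cov.liftHomotopy_lifts H (ContinuousMap.const B e0) (fun b => H0 b)) x
  have hr : ∀ b, (p b).IsRoot (L (1, b)).1.2 := fun b => by
    have := (L (1, b)).2
    rwa [hL, H1] at this
  refine ⟨fun b => (L (1, b)).1.2, by fun_prop, hr, ?_⟩
  have hc : Continuous fun t : unitInterval => (L (t, b0)).1.2 := by fun_prop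
  have hL0 : L (0, b0) = e0 := cov.liftHomotopy_zero H (ContinuousMap.const B e0) (fun b => H0 b) b0
  have hf : RFam (fun _ : unitInterval => p b0) d := h.comp _ continuous_const
  have := hf.unique (fun _ _ => hs b0) isPreconnected_univ hc.continuousOn
    (continuous_const (y := z)).continuousOn (fun t _ => by
      have := (L (t, b0)).2
      rwa [hL, H2] at this) (fun t _ => hz) (mem_univ 0) (by rw [hL0]) 1 (mem_univ 1)
  exact this
end RFam
end

section
open Filter Topology Set
open scoped Real

theorem RFam.near_roots {B : Type*} [TopologicalSpace B] {p : B → Polynomial ℂ} {d : ℕ}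
    (h : RFam p d) (C : ℝ) (hC : ∀ b z, (p b).IsRoot z → ‖z‖ ≤ C) (b0 : B) (ε : ℝ) (hε : 0 < ε) :
    ∀ᶠ b in 𝓝 b0, ∀ z, (p b).IsRoot z → ∃ r, (p b0).IsRoot r ∧ ‖z - r‖ < ε := by
  let K : Set ℂ := Metric.closedBall 0 C ∩ {z | ∀ r, (p b0).IsRoot r → ε ≤ ‖z - r‖}
  have hK : IsCompact K := by
    refine (isCompact_closedBall 0 C).inter_right ?_
    have : {z : ℂ | ∀ r, (p b0).IsRoot r → ε ≤ ‖z - r‖} =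
      ⋂ r, ⋂ (_ : (p b0).IsRoot r), {z : ℂ | ε ≤ ‖z - r‖} := by ext; simp
    rw [this]
    exact isClosed_iInter fun r => isClosed_iInter fun _ =>
      isClosed_le continuous_const (by fun_prop)
  have h1 : ∀ᶠ b in 𝓝 b0, ∀ z ∈ K, (p b).eval z ≠ 0 := by
    apply hK.eventually_forall_of_forall_eventually
    intro z hz
    have : (p b0).eval z ≠ 0 := by
      intro h0
      have := hz.2 z h0
      simp at this; linarith
    exact (h.cont.continuousAt (x := (b0, z))).eventually_ne this
  filter_upwards [h1] with b hb z hz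
  by_contra hc
  push Not at hc
  exact hb z ⟨by simpa using hC b z hz, hc⟩ hz

theorem RFam.tip {B : Type*} [TopologicalSpace B] {p : B → Polynomial ℂ} {d : ℕ}
    (h : RFam p d) (C : ℝ) (hC : ∀ b z, (p b).IsRoot z → ‖z‖ ≤ C) (b0 : B) (S : Set B)
    (hcl : b0 ∈ closure S) (hN : ∀ N ∈ 𝓝 b0, ∃ N' ∈ 𝓝 b0, N' ⊆ N ∧ IsPreconnected (N' ∩ S))
    (s : B → ℂ) (hs : ContinuousOn s S) (hr : ∀ b ∈ S, (p b).IsRoot (s b)) :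
    ∃ r, (p b0).IsRoot r ∧ Tendsto s (𝓝[S] b0) (𝓝 r) := by
  classical
  have hmem : ∀ r, r ∈ (p b0).roots.toFinset ↔ (p b0).IsRoot r := by
    intro r; simp [(h.mon b0).ne_zero]
  -- single disc
  have key : ∀ ε > 0, ∃ r, (p b0).IsRoot r ∧ ∃ N ∈ 𝓝 b0, ∀ b ∈ N ∩ S, ‖s b - r‖ < ε := by
    intro ε hε
    obtain ⟨ε', hε', hle, hsep⟩ : ∃ ε' > (0:ℝ), ε' ≤ ε ∧ ∀ r r', (p b0).IsRoot r → (p b0).IsRoot r' → r ≠ r' →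
      2 * ε' ≤ ‖r - r'‖ := by
      have : ∀ T : Finset (ℂ × ℂ), (∀ x ∈ T, x.1 ≠ x.2) → ∃ ε' > (0:ℝ), ε' ≤ ε ∧ ∀ x ∈ T, 2 * ε' ≤ ‖x.1 - x.2‖ := by
        intro T
        induction T using Finset.induction_on with
        | empty => intro _; exact ⟨ε, hε, le_rfl, by simp⟩
        | insert a T ha ih =>
          intro hT
          obtain ⟨ε', hε', hle, hh⟩ := ih fun x hx => hT x (by simp [hx])
          have : 0 < ‖a.1 - a.2‖ := norm_pos_iff.2 (sub_ne_zero.2 (hT a (by simp)))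
          refine ⟨min ε' (‖a.1 - a.2‖ / 2), by positivity, (min_le_left _ _).trans hle, fun x hx => ?_⟩
          rcases Finset.mem_insert.1 hx with rfl | hx
          · have := min_le_right ε' (‖x.1 - x.2‖ / 2); linarith
          · have := min_le_left ε' (‖a.1 - a.2‖ / 2); linarith [hh x hx]
      obtain ⟨ε', hε', hle, hh⟩ := this (p b0).roots.toFinset.offDiag (fun x hx => (Finset.mem_offDiag.1 hx).2.2)
      refine ⟨ε', hε', hle, fun r r' hr hr' hne => hh (r, r') (Finset.mem_offDiag.2 ⟨?_, ?_, hne⟩)⟩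
      · exact (hmem _).2 hr
      · exact (hmem _).2 hr'
    obtain ⟨N, hN1, hN2, hN3⟩ := hN _ (h.near_roots C hC b0 ε' hε')
    obtain ⟨b1, hb1⟩ := mem_closure_iff_nhds.1 hcl N hN1
    obtain ⟨r, hr1, hr2⟩ := hN2 hb1.1 _ (hr b1 hb1.2)
    refine ⟨r, hr1, N, hN1, fun b hb => lt_of_lt_of_le ?_ hle⟩
    have hpre := hN3.image s (hs.mono inter_subset_right)
    have := hpre.subset_left_of_subset_union (u := Metric.ball r ε')
      (v := ⋃ r' ∈ {r' | (p b0).IsRoot r' ∧ r' ≠ r}, Metric.ball r' ε') Metric.isOpen_ball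
      (isOpen_biUnion fun _ _ => Metric.isOpen_ball) ?_ ?_ ?_
    · have := this (mem_image_of_mem s hb)
      rwa [Metric.mem_ball, dist_eq_norm] at this
    · rw [disjoint_left]
      intro w hw hw'
      simp only [mem_iUnion] at hw'
      obtain ⟨r', hr', hw'⟩ := hw'
      have h1 := hsep r' r hr'.1 hr1 hr'.2
      rw [Metric.mem_ball] at hw hw'
      have := dist_triangle_left r' r w
      rw [← dist_eq_norm] at h1
      linarith
    · rintro _ ⟨b, hb, rfl⟩
      obtain ⟨r', h1, h2⟩ := hN2 hb.1 _ (hr b hb.2)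
      by_cases he : r' = r
      · left; rw [Metric.mem_ball, dist_eq_norm, ← he]; exact h2
      · right; simp only [mem_iUnion]
        exact ⟨r', ⟨h1, he⟩, by rw [Metric.mem_ball, dist_eq_norm]; exact h2⟩
    · exact ⟨s b1, mem_image_of_mem _ hb1, by rw [Metric.mem_ball, dist_eq_norm]; exact hr2⟩
  haveI : (𝓝[S] b0).NeBot := mem_closure_iff_nhdsWithin_neBot.1 hcl
  have hcau : Cauchy (map s (𝓝[S] b0)) := by
    rw [Metric.cauchy_iff]
    refine ⟨inferInstance, fun ε hε => ?_⟩
    obtain ⟨r, -, N, hN, hb⟩ := key (ε / 2) (by linarith)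
    refine ⟨s '' (N ∩ S), image_mem_map (by rw [inter_comm]; exact inter_mem_nhdsWithin S hN), ?_⟩
    rintro _ ⟨x, hx, rfl⟩ _ ⟨y, hy, rfl⟩
    have h1 := hb x hx
    have h2 := hb y hy
    rw [← dist_eq_norm] at h1 h2
    have := dist_triangle_right (s x) (s y) r
    linarith
  obtain ⟨r, hr'⟩ := CompleteSpace.complete hcau
  refine ⟨r, ?_, hr'⟩
  have h1 : Tendsto (fun b => (p b).eval (s b)) (𝓝[S] b0) (𝓝 ((p b0).eval r)) := by
    have h2 : Tendsto (fun b => (b, s b)) (𝓝[S] b0) (𝓝 (b0, r)) :=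
      Tendsto.prodMk_nhds (tendsto_id.mono_left nhdsWithin_le_nhds) hr'
    exact (h.cont.tendsto (b0, r)).comp h2
  have h2 : Tendsto (fun b => (p b).eval (s b)) (𝓝[S] b0) (𝓝 0) := by
    refine tendsto_const_nhds.congr' ?_
    filter_upwards [self_mem_nhdsWithin] with b hb
    exact (hr b hb).symm
  exact tendsto_nhds_unique h1 h2

def Rc (α β : ℝ) : Set (ℝ × ℝ) := Icc 0 (π / 2) ×ˢ Icc α β

theorem Rc_star {α β : ℝ} {Q T : Set (ℝ × ℝ)} (hQ : Q ⊆ Rc α β) (hc : Convex ℝ Q) {c : ℝ × ℝ}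
    (hcQ : c ∈ Q) (h1 : α < c.2) (h2 : c.2 < β) (hT : ∀ x ∈ T, x.2 = α ∨ x.2 = β) :
    StarConvex ℝ c (Q \ T) := by
  intro y hy a b ha hb hab
  refine ⟨hc hcQ hy.1 ha hb hab, fun hx => ?_⟩
  rcases ha.eq_or_lt with rfl | ha
  · have : b = 1 := by linarith
    subst this
    apply hy.2; simpa using hx
  · have hy2 := (hQ hy.1).2
    have e : (a • c + b • y).2 = a * c.2 + b * y.2 := rfl
    have hb' : b = 1 - a := by linarith
    have h3 : a * α + b * α < a * c.2 + b * y.2 := by nlinarith [mul_le_mul_of_nonneg_left hy2.1 hb]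
    have h4 : a * c.2 + b * y.2 < a * β + b * β := by nlinarith [mul_le_mul_of_nonneg_left hy2.2 hb]
    rw [← add_mul, hab] at h3 h4
    rcases hT _ hx with h | h <;> rw [e] at h <;> linarith

theorem Rc_convex (α β : ℝ) : Convex ℝ (Rc α β) := (convex_Icc _ _).prod (convex_Icc _ _)

theorem Rc_preconn {α β : ℝ} (hab : α < β) {T : Set (ℝ × ℝ)} (hT : ∀ x ∈ T, x.2 = α ∨ x.2 = β) :
    IsPreconnected (Rc α β \ T) := by
  have := Rc_star (Subset.refl _) (Rc_convex α β) (c := (0, (α + β) / 2))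
    ⟨⟨le_rfl, by positivity⟩, by simp; constructor <;> linarith⟩ (by simp; linarith) (by simp; linarith) hT
  refine (this.isPathConnected ⟨⟨⟨le_rfl, by positivity⟩, ?_⟩, ?_⟩).isConnected.isPreconnected
  · simp; constructor <;> linarith
  · intro h; rcases hT _ h with h | h <;> simp at h <;> linarith

theorem Rc_local {α β : ℝ} (hab : α < β) {T : Set (ℝ × ℝ)} (hT : ∀ x ∈ T, x.2 = α ∨ x.2 = β)
    {b0 : ℝ × ℝ} (hb : b0 ∈ Rc α β) {δ : ℝ} (hδ : 0 < δ) :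
    ∃ c ∈ Metric.ball b0 δ ∩ Rc α β, α < c.2 ∧ c.2 < β := by
  obtain ⟨h1, h2⟩ := hb
  set m := (α + β) / 2
  set t := min (1/2) (δ / (2 * (1 + |m - b0.2|)))
  have hd : 0 < 1 + |m - b0.2| := by positivity
  have ht0 : 0 < t := by positivity
  have ht1 : t ≤ 1/2 := min_le_left _ _
  have ht2 : t * (2 * (1 + |m - b0.2|)) ≤ δ := by
    have := min_le_right (1/2 : ℝ) (δ / (2 * (1 + |m - b0.2|)))
    calc t * (2 * (1 + |m - b0.2|)) ≤ δ / (2 * (1 + |m - b0.2|)) * (2 * (1 + |m - b0.2|)) := by gcongr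
      _ = δ := by field_simp
  have e : b0.2 + t * (m - b0.2) = (1 - t) * b0.2 + t * m := by ring
  have hm1 : α < m := by simp only [m]; linarith
  have hm2 : m < β := by simp only [m]; linarith
  have h3 : α < b0.2 + t * (m - b0.2) := by nlinarith [h2.1]
  have h4 : b0.2 + t * (m - b0.2) < β := by nlinarith [h2.2]
  refine ⟨(b0.1, b0.2 + t * (m - b0.2)), ⟨?_, h1, h3.le, h4.le⟩, h3, h4⟩
  rw [Metric.mem_ball, Prod.dist_eq]
  simp only [dist_self, Real.dist_eq, add_sub_cancel_left, abs_mul, abs_of_pos ht0]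
  rw [max_lt_iff]
  exact ⟨hδ, by nlinarith [abs_nonneg (m - b0.2)]⟩

theorem RFam.rect {p : ℝ × ℝ → Polynomial ℂ} {d : ℕ} (h : RFam p d) (C : ℝ)
    (hC : ∀ b z, (p b).IsRoot z → ‖z‖ ≤ C) {α β : ℝ} (hab : α < β) {T : Set (ℝ × ℝ)}
    (hT : ∀ x ∈ T, x.2 = α ∨ x.2 = β) (hs : ∀ b ∈ Rc α β \ T, (p b).Separable) (z : ℂ)
    (hz : (p (0, (α + β) / 2)).IsRoot z) :
    ∃ s : ℝ × ℝ → ℂ, Continuous s ∧ (∀ b ∈ Rc α β, (p b).IsRoot (s b)) ∧ s (0, (α + β) / 2) = z := by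
  set c : ℝ × ℝ := (0, (α + β) / 2) with hcdef
  have hcR : c ∈ Rc α β := ⟨⟨le_rfl, by positivity⟩, by simp [c]; constructor <;> linarith⟩
  have hc1 : α < c.2 := by simp [c]; linarith
  have hc2 : c.2 < β := by simp [c]; linarith
  have hcT : c ∉ T := fun h => by rcases hT _ h with h | h <;> linarith
  have hst := Rc_star (Subset.refl _) (Rc_convex α β) hcR hc1 hc2 hT
  let S := Rc α β \ T
  let cS : S := ⟨c, hcR, hcT⟩
  have hmem : ∀ (t : unitInterval) (b : S), c + t.1 • (b.1 - c) ∈ S := fun t b => by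
    have := hst b.2 (a := 1 - t.1) (b := t.1) (by linarith [t.2.2]) t.2.1 (by ring)
    have e : c + t.1 • (b.1 - c) = (1 - t.1) • c + t.1 • b.1 := by module
    rw [e]; exact this
  let H : C(unitInterval × S, S) := ⟨fun x => ⟨c + x.1.1 • (x.2.1 - c), hmem x.1 x.2⟩, by fun_prop⟩
  obtain ⟨s0, hs0, hs1, hs2⟩ := (h.comp (fun b : S => b.1) continuous_subtype_val).sections
    (fun b => hs b.1 b.2) cS H (fun b => Subtype.ext (by simp [H, cS]))
    (fun b => Subtype.ext (by simp [H])) (fun t => Subtype.ext (by simp [H, cS])) z hz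
  classical
  let s1 : ℝ × ℝ → ℂ := fun b => if hb : b ∈ S then s0 ⟨b, hb⟩ else 0
  have e1 : ∀ b (hb : b ∈ S), s1 b = s0 ⟨b, hb⟩ := fun b hb => by simp [s1, hb]
  have c1 : ContinuousOn s1 S := by
    rw [continuousOn_iff_continuous_restrict]
    exact hs0.congr fun b => (e1 b.1 b.2).symm
  have r1 : ∀ b ∈ S, (p b).IsRoot (s1 b) := fun b hb => by rw [e1 b hb]; exact hs1 ⟨b, hb⟩
  have hloc : ∀ b0 ∈ Rc α β, ∀ δ > 0, ∃ c ∈ Metric.ball b0 δ ∩ Rc α β, α < c.2 ∧ c.2 < β :=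
    fun b0 hb δ hδ => Rc_local hab hT hb hδ
  have hnT : ∀ c : ℝ × ℝ, α < c.2 → c.2 < β → c ∉ T := fun c h1 h2 h => by
    rcases hT _ h with h | h <;> linarith
  have hcl : Rc α β ⊆ closure S := by
    intro b0 hb
    rw [Metric.mem_closure_iff]
    intro δ hδ
    obtain ⟨c, hc, h1, h2⟩ := hloc b0 hb δ hδ
    exact ⟨c, ⟨hc.2, hnT c h1 h2⟩, by rw [dist_comm]; exact hc.1⟩
  have htip : ∀ b0 ∈ Rc α β, ∃ r, (p b0).IsRoot r ∧ Tendsto s1 (𝓝[S] b0) (𝓝 r) := by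
    intro b0 hb
    apply h.tip C hC b0 S (hcl hb) ?_ s1 c1 r1
    intro N hN
    obtain ⟨δ, hδ, hball⟩ := Metric.mem_nhds_iff.1 hN
    refine ⟨_, Metric.ball_mem_nhds b0 hδ, hball, ?_⟩
    obtain ⟨c, hc, h1, h2⟩ := hloc b0 hb δ hδ
    have := Rc_star (Q := Metric.ball b0 δ ∩ Rc α β) inter_subset_right
      ((convex_ball b0 δ).inter (Rc_convex α β)) hc h1 h2 hT
    have e : Metric.ball b0 δ ∩ S = (Metric.ball b0 δ ∩ Rc α β) \ T := by
      simp only [S]; rw [inter_diff_assoc]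
    rw [e]
    exact (this.isPathConnected ⟨hc, hnT c h1 h2⟩).isConnected.isPreconnected
  let s2 := extendFrom S s1
  have c2 : ContinuousOn s2 (Rc α β) := continuousOn_extendFrom hcl fun x hx => by
    obtain ⟨r, -, hr⟩ := htip x hx; exact ⟨r, hr⟩
  have r2 : ∀ b ∈ Rc α β, (p b).IsRoot (s2 b) := fun b hb => by
    obtain ⟨r, h1, hr⟩ := htip b hb
    have : s2 b = r := extendFrom_eq (hcl hb) hr
    rw [this]; exact h1
  have hpi : (0:ℝ) ≤ π / 2 := by positivity
  let cl : ℝ × ℝ → ℝ × ℝ := fun b => (max 0 (min b.1 (π/2)), max α (min b.2 β))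
  have hcl1 : ∀ b, cl b ∈ Rc α β := fun b =>
    ⟨⟨le_max_left _ _, max_le hpi (min_le_right _ _)⟩, le_max_left _ _, max_le hab.le (min_le_right _ _)⟩
  have hcl2 : ∀ b ∈ Rc α β, cl b = b := fun b hb => by
    obtain ⟨⟨h1, h2⟩, h3, h4⟩ := hb
    simp only [cl, min_eq_left h2, min_eq_left h4, max_eq_right h1, max_eq_right h3]
  refine ⟨fun b => s2 (cl b), c2.comp_continuous (by fun_prop) hcl1, fun b hb => ?_, ?_⟩
  · show (p b).IsRoot (s2 (cl b))
    rw [hcl2 b hb]; exact r2 b hb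
  · show s2 (cl c) = z
    rw [hcl2 c hcR]
    have : s2 c = s1 c := extendFrom_eq (hcl hcR) (c1 c cS.2)
    rw [this, e1 c cS.2]; exact hs2
end

section
open Filter Topology Set
open Complex (exp I)
open scoped Real

def pt (b : ℝ × ℝ) : ℂ × ℂ := ((Real.cos b.1 : ℝ), ((Real.sin b.1 : ℝ) : ℂ) * exp (b.2 * I))

theorem pt_cont : Continuous pt := by unfold pt; fun_prop

structure RData (d : ℕ) where
  m : ℕ
  th : ℕ → ℝ
  ph : ℕ → ℝ
  th0 : th 0 = -π
  thm : th (m+1) = π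
  thlt : ∀ j ≤ m, th j < th (j+1)
  ph0 : ∀ i < m, 0 < ph i
  ph1 : ∀ i < m, ph i < π/2
  q : ℂ × ℂ → Polynomial ℂ
  fam : RFam q d
  hom : ∀ (l : ℂ) v z, (q (l • v)).eval (l * z) = l ^ d * (q v).eval z
  sep : ∀ v : ℂ × ℂ, v ≠ 0 → (∀ i < m, ∀ l : ℂ,
    v ≠ l • pt (ph i, th (i+1))) → (q v).Separable

namespace RData
variable {d : ℕ} (D : RData d)


def P (b : ℝ × ℝ) : Polynomial ℂ := D.q (pt b)

theorem Pfam : RFam D.P d := D.fam.comp _ pt_cont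

theorem root_smul {l : ℂ} {v z} (h : (D.q v).IsRoot z) : (D.q (l • v)).IsRoot (l * z) := by
  show Polynomial.eval _ _ = 0
  rw [D.hom, show (D.q v).eval z = 0 from h, mul_zero]

theorem q0 : ∀ z, (D.q 0).IsRoot z → z = 0 := by
  intro z hz
  by_contra h0
  have h1 := D.fam.mon 0
  have hall : ∀ l : ℂ, (D.q 0).IsRoot (l * z) := fun l => by
    show Polynomial.eval _ _ = 0
    have := D.hom l 0 z
    rw [smul_zero, show (D.q 0).eval z = 0 from hz, mul_zero] at this
    exact this
  have : D.q 0 = 0 := by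
    apply Polynomial.funext
    intro r
    have := hall (r / z)
    rw [div_mul_cancel₀ _ h0] at this
    simpa using this
  exact h1.ne_zero this

theorem bound : ∃ C, ∀ b z, (D.P b).IsRoot z → ‖z‖ ≤ C := by
  -- near 0 roots are small
  have h0 : ∃ δ > 0, ∀ v : ℂ × ℂ, ‖v‖ < δ → ∀ z, ‖z‖ = 1 → (D.q v).eval z ≠ 0 := by
    have : ∀ᶠ v in 𝓝 (0 : ℂ × ℂ), ∀ z ∈ Metric.sphere (0:ℂ) 1, (D.q v).eval z ≠ 0 := by
      apply (isCompact_sphere (0:ℂ) 1).eventually_forall_of_forall_eventually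
      intro z hz
      refine (D.fam.cont.continuousAt (x := (0, z))).eventually_ne ?_
      intro h
      have := D.q0 z h
      subst this; simp at hz
    obtain ⟨δ, hδ, hb⟩ := Metric.eventually_nhds_iff.1 this
    exact ⟨δ, hδ, fun v hv z hz => hb (by simpa using hv) z (by simpa using hz)⟩
  obtain ⟨δ, hδ, h⟩ := h0
  refine ⟨2 / δ + 1, fun b z hz => ?_⟩
  by_contra hc
  push Not at hc
  have hz0 : 0 < ‖z‖ := by have : 0 < 2 / δ := by positivity
                           linarith
  have hz1 : z ≠ 0 := norm_pos_iff.1 hz0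
  apply h (((‖z‖⁻¹ : ℝ) : ℂ) • pt b) ?_ (((‖z‖⁻¹ : ℝ) : ℂ) * z) ?_
  · rw [D.hom, show (D.q (pt b)).eval z = 0 from hz, mul_zero]
  · rw [norm_smul]
    have : ‖pt b‖ ≤ 1 := by
      rw [Prod.norm_def]
      refine max_le ?_ ?_
      · simp only [pt, Complex.norm_real]; exact Real.abs_cos_le_one _
      · simp only [pt, norm_mul, Complex.norm_real, Complex.norm_exp_ofReal_mul_I, mul_one]
        exact Real.abs_sin_le_one _
    have h2 : 2 / δ < ‖z‖ := by linarith
    rw [div_lt_iff₀ hδ] at h2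
    rw [Complex.norm_real, norm_inv, norm_norm]
    calc ‖z‖⁻¹ * ‖pt b‖ ≤ ‖z‖⁻¹ * 1 := by gcongr
      _ < δ := by rw [mul_one, inv_lt_iff_one_lt_mul₀ hz0]; linarith
  · rw [norm_mul, Complex.norm_real, norm_inv, norm_norm, inv_mul_cancel₀ hz0.ne']

theorem th_mono {i j : ℕ} (h : i < j) (hj : j ≤ D.m + 1) : D.th i < D.th j := by
  induction j, h using Nat.le_induction with
  | base => exact D.thlt i (by omega)
  | succ j hij ih => exact (ih (by omega)).trans (D.thlt j (by omega))

theorem th_mono' {i j : ℕ} (h : i ≤ j) (hj : j ≤ D.m + 1) : D.th i ≤ D.th j := by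
  rcases h.eq_or_lt with rfl | h
  · rfl
  · exact (D.th_mono h hj).le

def bad : Set (ℂ × ℂ) := {v | v = 0 ∨ ∃ i < D.m, ∃ l : ℂ, v = l • pt (D.ph i, D.th (i+1))}

theorem pt_nbad {b : ℝ × ℝ} (h1 : b.1 ∈ Icc 0 (π/2)) (h2 : b.2 ∈ Icc (-π) π)
    (h : ∀ i < D.m, b.1 = D.ph i → b.2 ≠ D.th (i+1)) : pt b ∉ D.bad := by
  have hc0 : 0 ≤ Real.cos b.1 := Real.cos_nonneg_of_neg_pi_div_two_le_of_le (by linarith [h1.1, Real.pi_pos]) h1.2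
  have hs0 : 0 ≤ Real.sin b.1 := Real.sin_nonneg_of_nonneg_of_le_pi h1.1 (by linarith [h1.2, Real.pi_pos])
  have hpyth := Real.cos_sq_add_sin_sq b.1
  rintro (h0 | ⟨i, hi, l, hl⟩)
  · have e1 : ((Real.cos b.1 : ℝ) : ℂ) = 0 := congrArg Prod.fst h0
    have e2 : ((Real.sin b.1 : ℝ) : ℂ) * exp (b.2 * I) = 0 := congrArg Prod.snd h0
    have e2 : ((Real.sin b.1 : ℝ) : ℂ) = 0 := by simpa [Complex.exp_ne_zero] using e2
    rw [Complex.ofReal_eq_zero] at e1 e2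
    rw [e1, e2] at hpyth; norm_num at hpyth
  · have e1 : ((Real.cos b.1 : ℝ) : ℂ) = l * (Real.cos (D.ph i) : ℝ) := congrArg Prod.fst hl
    have e2 : ((Real.sin b.1 : ℝ) : ℂ) * exp (b.2 * I) = l * (((Real.sin (D.ph i) : ℝ) : ℂ) * exp (D.th (i+1) * I)) := congrArg Prod.snd hl
    have hp0 := D.ph0 i hi
    have hp1 := D.ph1 i hi
    have hcp : 0 < Real.cos (D.ph i) := Real.cos_pos_of_mem_Ioo ⟨by linarith [Real.pi_pos], hp1⟩
    have hsp : 0 < Real.sin (D.ph i) := Real.sin_pos_of_pos_of_lt_pi hp0 (by linarith [Real.pi_pos])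
    have n1 : Real.cos b.1 = ‖l‖ * Real.cos (D.ph i) := by
      have := congrArg norm e1
      rwa [norm_mul, Complex.norm_real, Complex.norm_real, Real.norm_of_nonneg hc0, Real.norm_of_nonneg hcp.le] at this
    have n2 : Real.sin b.1 = ‖l‖ * Real.sin (D.ph i) := by
      have := congrArg norm e2
      rwa [norm_mul, norm_mul, norm_mul, Complex.norm_exp_ofReal_mul_I, Complex.norm_exp_ofReal_mul_I, Complex.norm_real, Complex.norm_real, Real.norm_of_nonneg hs0, Real.norm_of_nonneg hsp.le, mul_one, mul_one] at this
    have hl1 : ‖l‖ = 1 := by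
      have hpy := Real.cos_sq_add_sin_sq (D.ph i)
      rw [n1, n2] at hpyth
      have : ‖l‖ ^ 2 = 1 := by linear_combination hpyth - ‖l‖^2 * hpy
      nlinarith [norm_nonneg l]
    rw [hl1, one_mul] at n1 n2
    have hphi : b.1 = D.ph i := Real.injOn_cos ⟨h1.1, by linarith [h1.2, Real.pi_pos]⟩ ⟨hp0.le, by linarith [Real.pi_pos]⟩ n1
    have hle : l = 1 := by
      rw [n1] at e1
      have : ((Real.cos (D.ph i) : ℝ) : ℂ) ≠ 0 := by exact_mod_cast hcp.ne'
      exact (mul_right_cancel₀ this (by rw [one_mul]; exact e1)).symm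
    rw [hle, one_mul, n2] at e2
    have hs' : ((Real.sin (D.ph i) : ℝ) : ℂ) ≠ 0 := by exact_mod_cast hsp.ne'
    have e3 := mul_left_cancel₀ hs' e2
    have h4 : -π < D.th (i+1) := by rw [← D.th0]; exact D.th_mono (by omega) (by omega)
    have h5 : D.th (i+1) < π := by rw [← D.thm]; exact D.th_mono (by omega) (by omega)
    apply h i hi hphi
    rcases SData.exp_angle h2 ⟨h4.le, h5.le⟩ e3 with h | h | h
    · exact h
    · linarith [h.1, h.2]
    · linarith [h.1, h.2]

theorem sep' {v} (hv : v ∉ D.bad) : (D.q v).Separable :=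
  D.sep v (fun h => hv (Or.inl h)) fun i hi l h => hv (Or.inr ⟨i, hi, l, h⟩)

theorem Psep {b : ℝ × ℝ} (h1 : b.1 ∈ Icc 0 (π/2)) (h2 : b.2 ∈ Icc (-π) π)
    (h : ∀ i < D.m, b.1 = D.ph i → b.2 ≠ D.th (i+1)) : (D.P b).Separable := D.sep' (D.pt_nbad h1 h2 h)

theorem Psep_rect {j : ℕ} (hj : j ≤ D.m) {b : ℝ × ℝ} (hb : b ∈ Rc (D.th j) (D.th (j+1)))
    (h : ∀ i < D.m, b.1 = D.ph i → b.2 ≠ D.th (i+1)) : (D.P b).Separable := by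
  refine D.Psep hb.1 ⟨?_, ?_⟩ h
  · rw [← D.th0]; exact (D.th_mono' (by omega) (by omega)).trans hb.2.1
  · rw [← D.thm]; exact hb.2.2.trans (D.th_mono' (by omega) (by omega))

theorem tip_edge {j : ℕ} (hj : j ≤ D.m) {i : ℕ} (hi : i < D.m)
    (h : D.th (i+1) ∈ Icc (D.th j) (D.th (j+1))) : D.th (i+1) = D.th j ∨ D.th (i+1) = D.th (j+1) := by
  rcases Nat.lt_or_ge i j with hij | hij
  · left; exact le_antisymm (D.th_mono' (by omega) (by omega)) h.1
  · right; exact le_antisymm h.2 (D.th_mono' (by omega) (by omega))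

def Tj (j : ℕ) : Set (ℝ × ℝ) := {b | b ∈ Rc (D.th j) (D.th (j+1)) ∧ ∃ i < D.m, b.1 = D.ph i ∧ b.2 = D.th (i+1)}

theorem Tj_edge {j : ℕ} (hj : j ≤ D.m) : ∀ x ∈ D.Tj j, x.2 = D.th j ∨ x.2 = D.th (j+1) := by
  rintro x ⟨hx, i, hi, -, h⟩
  rw [h]; exact D.tip_edge hj hi (h ▸ hx.2)

theorem Tj_sep {j : ℕ} (hj : j ≤ D.m) : ∀ b ∈ Rc (D.th j) (D.th (j+1)) \ D.Tj j, (D.P b).Separable :=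
  fun b hb => D.Psep_rect hj hb.1 fun i hi h1 h2 => hb.2 ⟨hb.1, i, hi, h1, h2⟩

theorem ex_enum (q : Polynomial ℂ) (hq : q.Separable) (hm : q.Monic) :
    ∃ z : Fin q.natDegree → ℂ, Function.Injective z ∧ ∀ k, q.IsRoot (z k) := by
  classical
  have := RFam.card_sep q hq hm.ne_zero
  let e := (q.roots.toFinset.equivFinOfCardEq this).symm
  refine ⟨fun k => (e k).1, fun a b h => e.injective (Subtype.ext h), fun k => ?_⟩
  have := (e k).2
  simp only [Multiset.mem_toFinset] at this
  exact Polynomial.isRoot_of_mem_roots this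

theorem enum_surj {q : Polynomial ℂ} (hm : q.Monic) (hd : q.natDegree = d) {z : Fin d → ℂ}
    (hi : Function.Injective z) (hr : ∀ k, q.IsRoot (z k)) {w} (hw : q.IsRoot w) : ∃ k, z k = w := by
  classical
  have hsub : Finset.univ.image z ⊆ q.roots.toFinset := by
    intro x hx
    obtain ⟨k, -, rfl⟩ := Finset.mem_image.1 hx
    rw [Multiset.mem_toFinset, Polynomial.mem_roots hm.ne_zero]; exact hr k
  have he := Finset.eq_of_subset_of_card_le hsub (by
    rw [Finset.card_image_of_injective _ hi, Finset.card_univ, Fintype.card_fin, ← hd]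
    exact (Multiset.toFinset_card_le _).trans (Polynomial.card_roots' _))
  have : w ∈ q.roots.toFinset := by
    rw [Multiset.mem_toFinset, Polynomial.mem_roots hm.ne_zero]; exact hw
  rw [← he] at this
  obtain ⟨k, -, h⟩ := Finset.mem_image.1 this
  exact ⟨k, h⟩

theorem ex_perm {q : Polynomial ℂ} (hm : q.Monic) (hd : q.natDegree = d) {z z' : Fin d → ℂ}
    (hi : Function.Injective z) (hr : ∀ k, q.IsRoot (z k)) (hi' : Function.Injective z')
    (hr' : ∀ k, q.IsRoot (z' k)) : ∃ σ : Equiv.Perm (Fin d), ∀ k, z k = z' (σ k) := by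
  choose f hf using fun k => enum_surj hm hd hi' hr' (hr k)
  have : Function.Injective f := fun a b h => hi (by rw [← hf a, ← hf b, h])
  exact ⟨Equiv.ofBijective f (Finite.injective_iff_bijective.1 this), fun k => (hf k).symm⟩
end RData
end

section
open Filter Topology Set
open Complex (exp I)
open scoped Real
namespace RData
variable {d : ℕ} (D : RData d)

theorem pt_zero (θ : ℝ) : pt (0, θ) = (1, 0) := by simp [pt]
theorem pt_top (θ : ℝ) : pt (π/2, θ) = (exp (θ * I)) • (0, 1) := by simp [pt]
theorem pt_wrap (φ : ℝ) : pt (φ, -π) = pt (φ, π) := by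
  simp only [pt, Prod.mk.injEq, true_and]
  congr 1
  rw [Complex.exp_eq_exp_iff_exists_int]
  exact ⟨-1, by push_cast; ring⟩

theorem c_mem {j : ℕ} (hj : j ≤ D.m) : ((0:ℝ), (D.th j + D.th (j+1))/2) ∈ Rc (D.th j) (D.th (j+1)) \ D.Tj j := by
  have := D.thlt j hj
  refine ⟨⟨⟨le_rfl, by positivity⟩, ?_, ?_⟩, ?_⟩
  · show D.th j ≤ (D.th j + D.th (j+1))/2
    linarith
  · show (D.th j + D.th (j+1))/2 ≤ D.th (j+1)
    linarith
  · rintro ⟨-, i, hi, h, -⟩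
    exact (D.ph0 i hi).ne h

theorem exS : ∃ (s : ℕ → Fin d → ℝ × ℝ → ℂ) (ζ : Fin d → ℂ), Function.Injective ζ ∧
    (∀ k, (D.q (1, 0)).IsRoot (ζ k)) ∧ (∀ j k, Continuous (s j k)) ∧
    (∀ j ≤ D.m, ∀ k, ∀ b ∈ Rc (D.th j) (D.th (j+1)), (D.P b).IsRoot (s j k b)) ∧
    (∀ j ≤ D.m, ∀ k, s j k (0, (D.th j + D.th (j+1))/2) = ζ k) := by
  obtain ⟨C, hC⟩ := D.bound
  have hs : (D.q (1, 0)).Separable := by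
    have := D.Tj_sep (Nat.zero_le _) _ (D.c_mem (Nat.zero_le _))
    rwa [P, pt_zero] at this
  obtain ⟨ζ, hζ, hr⟩ := ex_enum (D.q (1, 0)) hs (D.fam.mon _)
  have hd := D.fam.deg (1, 0)
  let ζ' : Fin d → ℂ := fun k => ζ (Fin.cast hd.symm k)
  have hr' : ∀ k, (D.q (1,0)).IsRoot (ζ' k) := fun k => hr _
  have : ∀ j k, ∃ s : ℝ × ℝ → ℂ, Continuous s ∧ (j ≤ D.m → (∀ b ∈ Rc (D.th j) (D.th (j+1)), (D.P b).IsRoot (s b)) ∧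
      s (0, (D.th j + D.th (j+1))/2) = ζ' k) := by
    intro j k
    by_cases hj : j ≤ D.m
    · obtain ⟨s, h1, h2, h3⟩ := D.Pfam.rect C hC (D.thlt j hj) (D.Tj_edge hj) (D.Tj_sep hj) (ζ' k)
        (by rw [P, pt_zero]; exact hr' k)
      exact ⟨s, h1, fun _ => ⟨h2, h3⟩⟩
    · exact ⟨fun _ => 0, continuous_const, fun h => absurd h hj⟩
  choose s h1 h2 using this
  exact ⟨s, ζ', fun a b h => by simpa using hζ h, hr', h1, fun j hj k => (h2 j k hj).1, fun j hj k => (h2 j k hj).2⟩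

theorem edge_set {S : Set ℝ} (hS : IsPreconnected S) (θ : ℝ) : IsPreconnected (S ×ˢ {θ} : Set (ℝ × ℝ)) :=
  hS.prod isPreconnected_singleton

theorem exSData : ∃ S : SData (Fin d), S.m = D.m ∧ S.th = D.th ∧ S.ph = D.ph ∧
    (∀ j ≤ D.m, ∀ k φ θ, φ ∈ Icc 0 (π/2) → θ ∈ Icc (D.th j) (D.th (j+1)) →
      (D.P (φ, θ)).IsRoot (S.ξ j k φ θ)) ∧ (∀ i, D.m ≤ i → S.σ i = 1) := by
  obtain ⟨s, ζ, hζ, hζr, hcont, hroot, hinit⟩ := D.exS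
  have hR : ∀ j, ∀ φ ∈ Icc 0 (π/2), ∀ θ ∈ Icc (D.th j) (D.th (j+1)), (φ, θ) ∈ Rc (D.th j) (D.th (j+1)) :=
    fun j φ hφ θ hθ => ⟨hφ, hθ⟩
  have hpi : (0:ℝ) ≤ π/2 := by positivity
  have inj : ∀ j ≤ D.m, ∀ b ∈ Rc (D.th j) (D.th (j+1)) \ D.Tj j, Function.Injective (fun k => s j k b) := by
    intro j hj b hb k k' h
    have := D.Pfam.unique (D.Tj_sep hj) (Rc_preconn (D.thlt j hj) (D.Tj_edge hj))
      (hcont j k).continuousOn (hcont j k').continuousOn (fun b hb => hroot j hj k b hb.1)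
      (fun b hb => hroot j hj k' b hb.1) hb h _ (D.c_mem hj)
    rw [hinit j hj, hinit j hj] at this
    exact hζ this
  have hnl : ∀ j ≤ D.m, D.th j ∈ Icc (D.th j) (D.th (j+1)) := fun j hj => ⟨le_rfl, (D.thlt j hj).le⟩
  have hnr : ∀ j ≤ D.m, D.th (j+1) ∈ Icc (D.th j) (D.th (j+1)) := fun j hj => ⟨(D.thlt j hj).le, le_rfl⟩
  have ha : ∀ j ≤ D.m, ∀ k, ∀ θ ∈ Icc (D.th j) (D.th (j+1)), s j k (0, θ) = ζ k := by
    intro j hj k θ hθ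
    have hf : RFam (fun _ : ℝ => D.q (1, 0)) d := D.fam.comp _ continuous_const
    have hsep : (D.q (1, 0)).Separable := by
      have := D.Tj_sep hj _ (D.c_mem hj)
      rwa [P, pt_zero] at this
    refine hf.unique (S := Icc (D.th j) (D.th (j+1))) (fun _ _ => hsep) isPreconnected_Icc
      (s := fun θ => s j k (0, θ)) (s' := fun _ => ζ k)
      (((hcont j k).comp (by fun_prop)).continuousOn) continuousOn_const ?_ (fun _ _ => hζr k)
      (D.c_mem hj).1.2 (hinit j hj k) θ hθ
    intro b hb
    have := hroot j hj k (0, b) (hR j 0 ⟨le_rfl, hpi⟩ b hb)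
    rwa [P, pt_zero] at this
  have edge : ∀ i < D.m, ∀ k k', ∀ S : Set ℝ, IsPreconnected S → S ⊆ Icc 0 (π/2) → D.ph i ∉ S → ∀ φ0 ∈ S,
      s i k (φ0, D.th (i+1)) = s (i+1) k' (φ0, D.th (i+1)) →
      ∀ φ ∈ closure S, s i k (φ, D.th (i+1)) = s (i+1) k' (φ, D.th (i+1)) := by
    intro i hi k k' S hS hsub hph φ0 hφ0 h0
    have hu : ∀ φ ∈ S, s i k (φ, D.th (i+1)) = s (i+1) k' (φ, D.th (i+1)) := by
      intro φ hφ
      refine D.Pfam.unique (S := S ×ˢ {D.th (i+1)}) ?_ (edge_set hS _) (hcont i k).continuousOn (hcont (i+1) k').continuousOn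
        ?_ ?_ (b0 := (φ0, D.th (i+1))) ⟨hφ0, rfl⟩ h0 (φ, D.th (i+1)) ⟨hφ, rfl⟩
      · rintro ⟨a, b⟩ ⟨ha, hb⟩
        have hb : b = D.th (i+1) := hb
        subst hb
        refine D.Psep_rect (by omega : i ≤ D.m) (hR i a (hsub ha) _ (hnr i (by omega))) ?_
        intro i' hi' h1 h2
        have h1 : a = D.ph i' := h1
        have h2 : D.th (i+1) = D.th (i'+1) := h2
        have : i = i' := by
          rcases lt_trichotomy i i' with h | h | h
          · have := D.th_mono (show i+1 < i'+1 by omega) (by omega); linarith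
          · exact h
          · have := D.th_mono (show i'+1 < i+1 by omega) (by omega); linarith
        subst this
        exact hph (h1 ▸ ha)
      · rintro ⟨a, b⟩ ⟨ha, hb⟩
        have hb : b = D.th (i+1) := hb
        subst hb
        exact hroot i (by omega) k _ (hR i a (hsub ha) _ (hnr i (by omega)))
      · rintro ⟨a, b⟩ ⟨ha, hb⟩
        have hb : b = D.th (i+1) := hb
        subst hb
        exact hroot (i+1) (by omega) k' _ (hR (i+1) a (hsub ha) _ (hnl (i+1) (by omega)))
    intro φ hφ
    have hcl : IsClosed {φ | s i k (φ, D.th (i+1)) = s (i+1) k' (φ, D.th (i+1))} :=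
      isClosed_eq ((hcont i k).comp (by fun_prop)) ((hcont (i+1) k').comp (by fun_prop))
    exact closure_minimal hu hcl hφ
  have nottip : ∀ j, ∀ θ, (∀ φ, (φ = 0 ∨ φ = π/2) → (φ, θ) ∉ D.Tj j) := by
    rintro j θ φ hφ ⟨-, i, hi, h, -⟩
    have h : φ = D.ph i := h
    have := D.ph0 i hi; have := D.ph1 i hi
    rcases hφ with h' | h' <;> linarith
  have hperm : ∀ i, ∃ σ : Equiv.Perm (Fin d), (i < D.m → ∀ k, s i k (π/2, D.th (i+1)) = s (i+1) (σ k) (π/2, D.th (i+1))) ∧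
      (D.m ≤ i → σ = 1) := by
    intro i
    by_cases hi : i < D.m
    · have h1 := hR i (π/2) ⟨hpi, le_rfl⟩ _ (hnr i (by omega))
      have h2 := hR (i+1) (π/2) ⟨hpi, le_rfl⟩ _ (hnl (i+1) (by omega))
      obtain ⟨σ, hσ⟩ := ex_perm (D.Pfam.mon (π/2, D.th (i+1))) (D.Pfam.deg _)
        (inj i (by omega) _ ⟨h1, nottip _ _ _ (Or.inr rfl)⟩) (fun k => hroot i (by omega) k _ h1)
        (inj (i+1) (by omega) _ ⟨h2, nottip _ _ _ (Or.inr rfl)⟩) (fun k => hroot (i+1) (by omega) k _ h2)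
      exact ⟨σ, fun _ => hσ, fun h => by omega⟩
    · exact ⟨1, fun h => absurd h hi, fun _ => rfl⟩
  choose σ hσ hσ1 using hperm
  refine ⟨{ m := D.m, th := D.th, ph := D.ph, σ := σ, ξ := fun j k φ θ => s j k (φ, θ), ζ := ζ,
            η := fun j k => exp (-(D.th j * I)) * s j k (π/2, D.th j),
            th0 := D.th0, thm := D.thm, thlt := D.thlt, ph0 := D.ph0, ph1 := D.ph1,
            cont := hcont, ha := ha, hb1 := ?_, hb2 := ?_, hc := ?_, hd := ?_, he := ?_}, rfl, rfl, rfl, ?_, hσ1⟩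
  · intro i hi k φ hφ
    have h0 := D.ph0 i hi
    have h1 := D.ph1 i hi
    refine edge i hi k k (Ico 0 (D.ph i)) isPreconnected_Ico (fun x hx => ⟨hx.1, by linarith [hx.2]⟩)
      (by simp) 0 ⟨le_rfl, h0⟩ ?_ φ (by rwa [closure_Ico h0.ne])
    rw [ha i (by omega) k _ (hnr i (by omega)), ha (i+1) (by omega) k _ (hnl (i+1) (by omega))]
  · intro i hi k φ hφ
    have h0 := D.ph0 i hi
    have h1 := D.ph1 i hi
    exact edge i hi k (σ i k) (Ioc (D.ph i) (π/2)) isPreconnected_Ioc (fun x hx => ⟨by linarith [hx.1], hx.2⟩)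
      (by simp) (π/2) ⟨h1, le_rfl⟩ (hσ i hi k) φ (by rwa [closure_Ioc h1.ne])
  · intro k φ hφ
    have hf : RFam (fun φ : ℝ => D.P (φ, π)) d := D.Pfam.comp _ (by fun_prop)
    have hl := hnl 0 (Nat.zero_le _)
    have hr := hnr D.m le_rfl
    rw [D.th0] at hl
    rw [D.thm] at hr
    refine hf.unique (S := Icc 0 (π/2)) ?_ isPreconnected_Icc (s := fun φ => s 0 k (φ, -π)) (s' := fun φ => s D.m k (φ, π))
      ((hcont 0 k).comp (by fun_prop)).continuousOn ((hcont D.m k).comp (by fun_prop)).continuousOn ?_ ?_ (b0 := 0) ⟨le_rfl, hpi⟩ ?_ φ hφ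
    · intro b hb
      refine D.Psep hb ⟨by linarith [Real.pi_pos], le_rfl⟩ fun i hi _ h => ?_
      have : D.th (i+1) < D.th (D.m+1) := D.th_mono (by omega) (by omega)
      rw [D.thm] at this
      have h : π = D.th (i+1) := h
      linarith
    · intro b hb
      have := hroot 0 (Nat.zero_le _) k (b, -π) (hR 0 b hb _ (by rwa [D.th0]))
      rwa [P, pt_wrap] at this
    · intro b hb
      exact hroot D.m le_rfl k (b, π) (hR D.m b hb _ (by rwa [D.thm]))
    · show s 0 k (0, -π) = s D.m k (0, π)
      rw [ha 0 (Nat.zero_le _) k _ (by rwa [D.th0]), ha D.m le_rfl k _ (by rwa [D.thm])]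
  · intro j hj k θ hθ
    have hf : RFam (fun _ : ℝ => D.q (0, 1)) d := D.fam.comp _ continuous_const
    have hrt : ∀ θ ∈ Icc (D.th j) (D.th (j+1)), (D.q (0,1)).IsRoot (exp (-(θ * I)) * s j k (π/2, θ)) := by
      intro θ hθ
      have := hroot j hj k (π/2, θ) (hR j (π/2) ⟨hpi, le_rfl⟩ θ hθ)
      rw [P, pt_top] at this
      have := D.root_smul (l := exp (-(θ * I))) this
      rwa [smul_smul, ← Complex.exp_add, neg_add_cancel, Complex.exp_zero, one_smul] at this
    have hsep : (D.q (0, 1)).Separable := by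
      refine D.sep _ (by simp) fun i hi l h => ?_
      have h1 : (0:ℂ) = l * (Real.cos (D.ph i) : ℝ) := congrArg Prod.fst h
      have h2 : (1:ℂ) = l * (((Real.sin (D.ph i) : ℝ) : ℂ) * exp (D.th (i+1) * I)) := congrArg Prod.snd h
      have hcp : 0 < Real.cos (D.ph i) := Real.cos_pos_of_mem_Ioo ⟨by linarith [Real.pi_pos, D.ph0 i hi], D.ph1 i hi⟩
      have hc' : ((Real.cos (D.ph i) : ℝ) : ℂ) ≠ 0 := by exact_mod_cast hcp.ne'
      rcases mul_eq_zero.1 h1.symm with h | h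
      · rw [h] at h2; simp at h2
      · exact hc' h
    have := hf.unique (S := Icc (D.th j) (D.th (j+1))) (fun _ _ => hsep) isPreconnected_Icc
      (s := fun θ : ℝ => exp (-(θ * I)) * s j k (π/2, θ)) (s' := fun _ => exp (-(D.th j * I)) * s j k (π/2, D.th j))
      (by
        have := (hcont j k).comp (f := fun θ : ℝ => (π/2, θ)) (by fun_prop)
        simp only [Function.comp_def] at this
        fun_prop) continuousOn_const hrt (fun _ _ => hrt _ (hnl j hj)) (hnl j hj) rfl θ hθ
    show s j k (π/2, θ) = exp (θ * I) * (exp (-(D.th j * I)) * s j k (π/2, D.th j))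
    have this : exp (-(θ * I)) * s j k (π/2, θ) = _ := this
    rw [← this, ← mul_assoc, ← Complex.exp_add, add_neg_cancel, Complex.exp_zero, one_mul]
  · intro j hj φ hφ θ hθ h
    exact inj j hj (φ, θ) ⟨hR j φ hφ θ hθ, fun ⟨_, i, hi, h1, h2⟩ => h i hi h1 h2⟩
  · intro j hj k φ θ hφ hθ
    exact hroot j hj k (φ, θ) (hR j φ hφ θ hθ)
end RData
end

section
open Filter Topology Set
open Complex (exp I)
open scoped Real

namespace SData
variable {K : Type} (D : SData K)

def sub (p : K → Prop) (hp : ∀ i k, p (D.σ i k) ↔ p k) : SData {k // p k} where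
  m := D.m
  th := D.th
  ph := D.ph
  σ := fun i => (D.σ i).subtypePerm (hp i)
  ξ := fun j k => D.ξ j k.1
  ζ := fun k => D.ζ k.1
  η := fun j k => D.η j k.1
  th0 := D.th0
  thm := D.thm
  thlt := D.thlt
  ph0 := D.ph0
  ph1 := D.ph1
  cont := fun j k => D.cont j k.1
  ha := fun j hj k => D.ha j hj k.1
  hb1 := fun i hi k => D.hb1 i hi k.1
  hb2 := fun i hi k φ hφ => D.hb2 i hi k.1 φ hφ
  hc := fun k => D.hc k.1
  hd := fun j hj k => D.hd j hj k.1
  he := fun j hj φ hφ θ hθ h k k' e => Subtype.ext (D.he j hj φ hφ θ hθ h e)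

abbrev Om := MulAction.orbitRel.Quotient (Subgroup.closure (range D.σ)) K

def cls (k : K) : D.Om := Quotient.mk'' k

theorem cls_eq {k k' : K} : D.cls k = D.cls k' ↔ k ∈ MulAction.orbit (Subgroup.closure (range D.σ)) k' := by
  unfold cls
  rw [Quotient.eq'']
  rfl

theorem cls_σ (i : ℕ) (k : K) : D.cls (D.σ i k) = D.cls k := by
  rw [cls_eq]
  exact ⟨⟨D.σ i, Subgroup.subset_closure ⟨i, rfl⟩⟩, rfl⟩

def comp (ω : D.Om) : SData {k // D.cls k = ω} :=
  D.sub (fun k => D.cls k = ω) fun i k => by rw [D.cls_σ]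

open scoped Pointwise in
theorem comp_trans [Finite K] (hσ : ∀ i, D.m ≤ i → D.σ i = 1) (ω : D.Om) : (D.comp ω).Trans := by
  intro S hS ⟨k0, hk0⟩
  let S' : Set K := Subtype.val '' S
  have h1 : ∀ i, ∀ k ∈ S', D.σ i k ∈ S' := by
    rintro i _ ⟨k, hk, rfl⟩
    by_cases hi : i < D.m
    · exact ⟨_, hS i hi k hk, rfl⟩
    · rw [hσ i (by omega)]; exact ⟨k, hk, rfl⟩
  have h2 : Subgroup.closure (range D.σ) ≤ MulAction.stabilizer (Equiv.Perm K) S' := by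
    rw [Subgroup.closure_le]
    rintro _ ⟨i, rfl⟩
    rw [SetLike.mem_coe, MulAction.mem_stabilizer_iff]
    have hsub : (D.σ i) • S' ⊆ S' := by
      rintro _ ⟨k, hk, rfl⟩
      exact h1 i k hk
    apply Set.eq_of_subset_of_ncard_le hsub ?_ (Set.toFinite _)
    exact (Set.ncard_image_of_injective S' (D.σ i).injective).ge
  apply eq_univ_of_forall
  intro k
  have : k.1 ∈ MulAction.orbit (Subgroup.closure (range D.σ)) k0.1 := by
    rw [← cls_eq, k.2, k0.2]
  obtain ⟨g, hg⟩ := this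
  have h3 := MulAction.mem_stabilizer_iff.1 (h2 g.2)
  have h4 : k.1 ∈ S' := by
    rw [← hg, ← h3]
    exact Set.smul_mem_smul_set ⟨k0, hk0, rfl⟩
  obtain ⟨k', hk', e⟩ := h4
  rwa [← Subtype.ext e]

theorem mem_comp {ω : D.Om} {x} : x ∈ (D.comp ω).X ↔ ∃ j ≤ D.m, ∃ k, D.cls k = ω ∧ ∃ y ∈ D.QC j, D.F j k y = x := by
  constructor
  · rintro ⟨j, hj, k, y, hy, e⟩
    exact ⟨j, hj, k.1, k.2, y, hy, e⟩
  · rintro ⟨j, hj, k, hk, y, hy, e⟩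
    exact ⟨j, hj, ⟨k, hk⟩, y, hy, e⟩

theorem cls_unique {x} (hx : D.NonTip x) {j j' k k'} {y y' : PP} (hj : j ≤ D.m) (hj' : j' ≤ D.m)
    (hy : y ∈ D.QC j) (hy' : y' ∈ D.QC j') (e : D.F j k y = x) (e' : D.F j' k' y' = x) :
    D.cls k = D.cls k' := by
  refine D.glue x hx (fun _ k _ => D.cls k) ?_ ?_ ?_ ?_ ?_ ?_ hj hj' hy hy' e e'
  · intros; rfl
  · intro i hi k φ w h1 h2
    exact (D.cls_σ i k).symm
  all_goals intros; rfl

/-- cone over compact closed -/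
theorem cone_closed {C : Set (ℂ × ℂ × ℂ)} (hC : IsCompact C) (h0 : (0 : ℂ × ℂ × ℂ) ∉ C) :
    IsClosed {x | ∃ l : ℂ, ∃ c ∈ C, x = l • c} := by
  rcases C.eq_empty_or_nonempty with rfl | hne
  · simp
  obtain ⟨c0, hc0, hmin⟩ := hC.exists_isMinOn hne continuous_norm.continuousOn
  have hpos : 0 < ‖c0‖ := norm_pos_iff.2 fun h => h0 (h ▸ hc0)
  rw [← isSeqClosed_iff_isClosed]
  intro u x hu hx
  choose l c hc e using hu
  obtain ⟨R, hR⟩ := (Metric.isBounded_range_of_tendsto u hx).exists_norm_le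
  have hl : ∀ n, l n ∈ Metric.closedBall (0:ℂ) (R / ‖c0‖) := fun n => by
    have h1 := hR (u n) ⟨n, rfl⟩
    rw [e n, norm_smul] at h1
    have h2 : ‖c0‖ ≤ ‖c n‖ := hmin (hc n)
    rw [mem_closedBall_zero_iff, le_div_iff₀ hpos]
    exact (mul_le_mul_of_nonneg_left h2 (norm_nonneg _)).trans h1
  have hK := ((isCompact_closedBall (0:ℂ) (R / ‖c0‖)).prod hC).image (f := fun p : ℂ × (ℂ × ℂ × ℂ) => p.1 • p.2) (by fun_prop)
  have := hK.isClosed.mem_of_tendsto hx (Eventually.of_forall fun n => ⟨(l n, c n), ⟨hl n, hc n⟩, (e n).symm⟩)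
  obtain ⟨⟨a, b⟩, ⟨-, hb⟩, e⟩ := this
  exact ⟨a, b, hb, e.symm⟩

theorem F_smul (j k) (φ θ : ℝ) (w : ℂ) : D.F j k (φ, θ, w) = exp w • D.F j k (φ, θ, 0) := by
  simp [F]

theorem F_ne (j k) {y : PP} (hy : y ∈ D.QC j) : D.F j k y ≠ 0 := by
  intro h
  have := D.normsq j k hy
  rw [h] at this
  have h2 := Real.exp_pos (2 * y.2.2.re)
  rw [← this] at h2
  simp at h2

theorem X_closed [Finite K] : IsClosed (insert 0 D.X) := by
  have e : insert 0 D.X = insert 0 (⋃ j : Fin (D.m + 1), ⋃ k : K, {x | ∃ l : ℂ, ∃ c ∈ (fun b : ℝ × ℝ => D.F j k (b.1, b.2, 0)) ''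
      (Icc 0 (π/2) ×ˢ Icc (D.th j) (D.th (j+1))), x = l • c}) := by
    ext x
    simp only [mem_insert_iff, mem_iUnion]
    by_cases hx : x = 0
    · simp [hx]
    simp only [hx, false_or]
    constructor
    · rintro ⟨j, hj, k, ⟨φ, θ, w⟩, hy, rfl⟩
      exact ⟨⟨j, by omega⟩, k, exp w, _, ⟨(φ, θ), ⟨hy.1, hy.2.1⟩, rfl⟩, D.F_smul _ _ _ _ _⟩
    · rintro ⟨j, k, l, _, ⟨⟨φ, θ⟩, hy, rfl⟩, rfl⟩
      have hl : l ≠ 0 := by rintro rfl; simp at hx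
      refine ⟨j, by omega, k, (φ, θ, Complex.log l), ⟨hy.1, hy.2, trivial⟩, ?_⟩
      rw [F_smul, Complex.exp_log hl]
  rw [e]
  refine (Set.finite_singleton 0).isClosed.union (isClosed_iUnion_of_finite fun j => isClosed_iUnion_of_finite fun k => cone_closed ?_ ?_)
  · exact (isCompact_Icc.prod isCompact_Icc).image ((D.F_cont j k).comp (by fun_prop))
  · rintro ⟨⟨φ, θ⟩, hy, h⟩
    exact D.F_ne j k (y := (φ, θ, 0)) ⟨hy.1, hy.2, trivial⟩ h

theorem X_ne {x} (hx : x ∈ D.X) : x ≠ 0 := by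
  obtain ⟨j, hj, k, y, hy, rfl⟩ := hx
  exact D.F_ne j k hy

/-- non-tip part -/
def NT (j : ℕ) : Set PP := {y ∈ D.QC j | ∀ i < D.m, y.1 = D.ph i → y.2.1 ≠ D.th (i+1)}

def R : Set (ℂ × ℂ × ℂ) := {x | ∃ j ≤ D.m, ∃ k, ∃ y ∈ D.NT j, D.F j k y = x}

end SData
end

section
open Filter Topology Set
open Complex (exp I)
open scoped Real

def pr (x : ℂ × ℂ × ℂ) : ℂ × ℂ := (x.1, x.2.1)

theorem pr_cont : Continuous pr := by unfold pr; fun_prop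

theorem pr_F {K : Type} (S : SData K) (j k) (y : PP) : pr (S.F j k y) = exp y.2.2 • pt (y.1, y.2.1) := rfl

namespace RData
variable {d : ℕ} (D : RData d)

def V : Set (ℂ × ℂ × ℂ) := {x | (D.q (pr x)).IsRoot x.2.2}

def S : SData (Fin d) := D.exSData.choose
theorem Sm : D.S.m = D.m := D.exSData.choose_spec.1
theorem Sth : D.S.th = D.th := D.exSData.choose_spec.2.1
theorem Sph : D.S.ph = D.ph := D.exSData.choose_spec.2.2.1
theorem Sroot : ∀ j ≤ D.m, ∀ k φ θ, φ ∈ Icc 0 (π/2) → θ ∈ Icc (D.th j) (D.th (j+1)) →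
      (D.P (φ, θ)).IsRoot (D.S.ξ j k φ θ) := D.exSData.choose_spec.2.2.2.1
theorem Ssig : ∀ i, D.S.m ≤ i → D.S.σ i = 1 := by
  rw [Sm]; exact D.exSData.choose_spec.2.2.2.2

def XX (ω : D.S.Om) : Set (ℂ × ℂ × ℂ) := (D.S.comp ω).X

theorem bad_smul {l : ℂ} (hl : l ≠ 0) {v} : l • v ∈ D.bad ↔ v ∈ D.bad := by
  have key : ∀ (l : ℂ) v, v ∈ D.bad → l • v ∈ D.bad := by
    rintro l v (rfl | ⟨i, hi, c, rfl⟩)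
    · left; simp
    · exact Or.inr ⟨i, hi, l * c, by rw [smul_smul]⟩
  refine ⟨fun h => ?_, key l v⟩
  have := key l⁻¹ _ h
  rwa [inv_smul_smul₀ hl] at this

theorem bad_eq : D.bad = {0} ∪ ⋃ i : Fin D.m, ((Submodule.span ℂ {pt (D.ph i, D.th (i+1))} : Submodule ℂ (ℂ × ℂ)) : Set (ℂ × ℂ)) := by
  ext v
  simp only [bad, mem_union, mem_iUnion, mem_singleton_iff, SetLike.mem_coe, Submodule.mem_span_singleton]
  constructor
  · rintro (h | ⟨i, hi, l, h⟩)
    · exact Or.inl h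
    · exact Or.inr ⟨⟨i, hi⟩, l, h.symm⟩
  · rintro (h | ⟨i, l, h⟩)
    · exact Or.inl h
    · exact Or.inr ⟨i, i.2, l, h.symm⟩

theorem bad_closed : IsClosed D.bad := by
  rw [bad_eq]
  exact isClosed_singleton.union (isClosed_iUnion_of_finite fun i => Submodule.closed_of_finiteDimensional _)

theorem V_closed : IsClosed D.V :=
  isClosed_eq (D.fam.cont.comp (f := fun x : ℂ × ℂ × ℂ => (pr x, x.2.2)) (by unfold pr; fun_prop)) continuous_const

theorem X_sub_V {ω} : D.XX ω ⊆ D.V := by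
  rintro _ ⟨j, hj, k, ⟨φ, θ, w⟩, hy, rfl⟩
  have hj : j ≤ D.m := by rw [← D.Sm]; exact hj
  have h2 : θ ∈ Icc (D.S.th j) (D.S.th (j+1)) := hy.2.1
  rw [D.Sth] at h2
  exact D.root_smul (l := exp w) (D.Sroot j hj k.1 φ θ hy.1 h2)

theorem nontip {x} (h : pr x ∉ D.bad) : D.S.NonTip x := by
  rintro j hj k ⟨φ, θ, w⟩ hy rfl i hi e1 e2
  rw [D.Sm] at hi
  rw [D.Sph] at e1
  rw [D.Sth] at e2
  refine h (Or.inr ⟨i, hi, exp w, ?_⟩)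
  rw [pr_F, ← e1, ← e2]

theorem disj {x} (h : pr x ∉ D.bad) {ω ω'} (h1 : x ∈ D.XX ω) (h2 : x ∈ D.XX ω') : ω = ω' := by
  obtain ⟨j, hj, k, rfl, y, hy, e⟩ := D.S.mem_comp.1 h1
  obtain ⟨j', hj', k', rfl, y', hy', e'⟩ := D.S.mem_comp.1 h2
  exact D.S.cls_unique (D.nontip h) hj hj' hy hy' e e'

theorem sector {θ : ℝ} (h : θ ∈ Icc (-π) π) : ∃ j ≤ D.m, θ ∈ Icc (D.th j) (D.th (j+1)) := by
  classical
  have hex : ∃ n, θ ≤ D.th (n+1) := ⟨D.m, by rw [D.thm]; exact h.2⟩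
  refine ⟨Nat.find hex, Nat.find_min' hex (by rw [D.thm]; exact h.2), ?_, Nat.find_spec hex⟩
  rcases hn : Nat.find hex with _ | n
  · rw [D.th0]; exact h.1
  · exact (not_le.1 (Nat.find_min hex (m := n) (by omega))).le

theorem polar {v : ℂ × ℂ} (hv : v ≠ 0) : ∃ j ≤ D.m, ∃ b ∈ Rc (D.th j) (D.th (j+1)), ∃ w, v = exp w • pt b := by
  obtain ⟨a, y⟩ := v
  set c : ℂ := (‖a‖ : ℝ) + (‖y‖ : ℝ) * I with hc
  have cre : c.re = ‖a‖ := by simp [hc]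
  have cim : c.im = ‖y‖ := by simp [hc]
  have hρ : c ≠ 0 := by
    intro h
    rw [h] at cre cim
    apply hv
    exact Prod.ext (norm_eq_zero.1 cre.symm) (norm_eq_zero.1 cim.symm)
  obtain ⟨u, hu, ha⟩ : ∃ u : ℂ, ‖u‖ = 1 ∧ a = ‖a‖ * u := by
    by_cases h : a = 0
    · exact ⟨1, by simp, by simp [h]⟩
    · have : (‖a‖ : ℂ) ≠ 0 := by simpa using h
      exact ⟨a / ‖a‖, by simp [h], by field_simp⟩
  have hu0 : u ≠ 0 := by intro h; simp [h] at hu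
  have hy : y = ‖y‖ * u * exp ((y/u).arg * I) := by
    have := Complex.norm_mul_exp_arg_mul_I (y / u)
    rw [norm_div, hu, div_one] at this
    rw [mul_right_comm, this]; field_simp
  obtain ⟨j, hj, hθ⟩ := D.sector (θ := (y/u).arg) ⟨(Complex.neg_pi_lt_arg _).le, Complex.arg_le_pi _⟩
  have hn : ((‖c‖ : ℝ) : ℂ) ≠ 0 := by simpa using hρ
  refine ⟨j, hj, (c.arg, (y/u).arg), ⟨⟨?_, ?_⟩, hθ⟩, Complex.log (‖c‖ * u), ?_⟩
  · rw [Complex.arg_nonneg_iff, cim]; exact norm_nonneg _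
  · exact (abs_le.1 (Complex.abs_arg_le_pi_div_two_iff.2 (by rw [cre]; exact norm_nonneg _))).2
  · rw [Complex.exp_log (mul_ne_zero hn hu0)]
    have h1 : ((‖c‖ : ℝ) : ℂ) * (Real.cos c.arg : ℝ) = (‖a‖:ℝ) := by
      rw [← Complex.ofReal_mul, Complex.norm_mul_cos_arg, cre]
    have h2 : ((‖c‖ : ℝ) : ℂ) * (Real.sin c.arg : ℝ) = (‖y‖:ℝ) := by
      rw [← Complex.ofReal_mul, Complex.norm_mul_sin_arg, cim]
    ext1
    · show a = ‖c‖ * u * (Real.cos c.arg : ℝ)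
      rw [mul_right_comm, h1]; exact ha
    · show y = ‖c‖ * u * ((Real.sin c.arg : ℝ) * exp ((y/u).arg * I))
      rw [← mul_assoc, mul_right_comm _ u, h2]; exact hy

theorem ex_label {j : ℕ} (hj : j ≤ D.m) {b : ℝ × ℝ} (hb : b ∈ Rc (D.th j) (D.th (j+1))) {z}
    (hz : (D.P b).IsRoot z) : ∃ k, D.S.ξ j k b.1 b.2 = z := by
  by_contra! hne
  have h1 : ∀ᶠ z' in 𝓝 z, ∀ k, z' ≠ D.S.ξ j k b.1 b.2 :=
    eventually_all.2 fun k => (isOpen_ne.eventually_mem (hne k).symm)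
  obtain ⟨ε, hε, h1⟩ : ∃ ε > 0, ∀ k, ε ≤ ‖D.S.ξ j k b.1 b.2 - z‖ := by
    obtain ⟨ε, hε, h⟩ := Metric.eventually_nhds_iff.1 h1
    exact ⟨ε, hε, fun k => by by_contra! h'; exact h (by rwa [dist_eq_norm]) k rfl⟩
  have h2 := D.Pfam.near b z hz (ε/2) (by positivity)
  have h3 : ∀ᶠ b' in 𝓝 b, ∀ k, ‖D.S.ξ j k b'.1 b'.2 - D.S.ξ j k b.1 b.2‖ < ε/2 :=
    eventually_all.2 fun k => by
      have := Metric.tendsto_nhds.1 ((D.S.cont j k).continuousAt (x := b)) (ε/2) (by positivity)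
      simpa [dist_eq_norm] using this
  obtain ⟨δ, hδ, h⟩ := Metric.eventually_nhds_iff.1 (h2.and h3)
  obtain ⟨c, ⟨hc1, hc2⟩, hc3, hc4⟩ := Rc_local (D.thlt j hj) (D.Tj_edge hj) hb hδ
  obtain ⟨⟨z', hz', hzz⟩, h5⟩ := h hc1
  have hinj : Function.Injective fun k => D.S.ξ j k c.1 c.2 := by
    refine D.S.he j (by rw [D.Sm]; exact hj) c.1 hc2.1 c.2 (by rw [D.Sth]; exact hc2.2) ?_
    intro i hi e1 e2
    rw [D.Sm] at hi
    rw [D.Sph] at e1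
    rw [D.Sth] at e2
    rcases D.Tj_edge hj c ⟨hc2, i, hi, e1, e2⟩ with h | h <;> linarith
  obtain ⟨k, hk⟩ := enum_surj (D.Pfam.mon c) (D.Pfam.deg c) hinj (fun k => D.Sroot j hj k _ _ hc2.1 hc2.2) hz'
  have h6 := h5 k
  rw [hk] at h6
  have h7 := h1 k
  have : ‖D.S.ξ j k b.1 b.2 - z‖ ≤ ‖z' - D.S.ξ j k b.1 b.2‖ + ‖z' - z‖ := by
    rw [← norm_neg (z' - D.S.ξ j k b.1 b.2), neg_sub]
    exact norm_sub_le_norm_sub_add_norm_sub _ _ _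
  linarith

theorem pr_ne {x} (hx : x ∈ D.V) (h0 : x ≠ 0) : pr x ≠ 0 := by
  intro h
  have h2 : (D.q (pr x)).IsRoot x.2.2 := hx
  rw [h] at h2
  have h3 := D.q0 _ h2
  apply h0
  obtain ⟨a, y, z⟩ := x
  simp only [pr, Prod.mk_eq_zero] at h h3 ⊢
  exact ⟨h.1, h.2, h3⟩

theorem cover {x} (hx : x ∈ D.V) (h0 : x ≠ 0) : ∃ ω, x ∈ D.XX ω := by
  obtain ⟨j, hj, b, hb, w, e⟩ := D.polar (D.pr_ne hx h0)
  have hz : (D.P b).IsRoot (exp (-w) * x.2.2) := by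
    have := D.root_smul (l := exp (-w)) (show (D.q (pr x)).IsRoot x.2.2 from hx)
    rwa [e, smul_smul, ← Complex.exp_add, neg_add_cancel, Complex.exp_zero, one_smul] at this
  obtain ⟨k, hk⟩ := D.ex_label hj hb hz
  refine ⟨D.S.cls k, D.S.mem_comp.2 ⟨j, by rw [D.Sm]; exact hj, k, rfl, (b.1, b.2, w), ⟨hb.1, ?_, trivial⟩, ?_⟩⟩
  · rw [D.Sth]; exact hb.2
  · obtain ⟨a, y, z⟩ := x
    have e1 : a = exp w * (Real.cos b.1 : ℝ) := congrArg Prod.fst e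
    have e2 : y = exp w * ((Real.sin b.1 : ℝ) * exp (b.2 * I)) := congrArg Prod.snd e
    simp only [SData.F]
    rw [hk, e1, e2]
    simp only [← mul_assoc, ← Complex.exp_add, add_neg_cancel, Complex.exp_zero, one_mul]

end RData
end

section
open Filter Topology Set
open Complex (exp I)
open scoped Real

theorem dense_preconn {A : Type*} [TopologicalSpace A] {M Y : Set A} (hM : IsPreconnected M) (hY : Y ⊆ M)
    (hd : M ⊆ closure Y) (hl : ∀ q ∈ M, ∃ N, (∀ᶠ x in 𝓝 q, x ∈ M → x ∈ N) ∧ IsPreconnected (N ∩ Y)) :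
    IsPreconnected Y := by
  intro u v hu hv huv ⟨a, ha, hau⟩ ⟨b, hb, hbv⟩
  by_contra hne
  have hdis : ∀ y ∈ Y, y ∈ u → y ∉ v := fun y hy h1 h2 => hne ⟨y, hy, h1, h2⟩
  have key : ∀ w : Set A, IsOpen {q | ∀ᶠ y in 𝓝 q, y ∈ Y → y ∈ w} := fun w => isOpen_setOf_eventually_nhds
  obtain ⟨q, hq, h1, h2⟩ := hM _ _ (key u) (key v) (by
    intro q hq
    obtain ⟨N, hN, hc⟩ := hl q hq
    by_cases h : ∃ y ∈ N ∩ Y, y ∈ u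
    · left
      filter_upwards [hN] with y hy hyY
      by_contra hyu
      have hyv : y ∈ v := (huv hyY).resolve_left hyu
      obtain ⟨y', hy', hyu'⟩ := h
      obtain ⟨z, hz, hz1, hz2⟩ := hc u v hu hv (fun z hz => huv hz.2) ⟨y', hy', hyu'⟩ ⟨y, ⟨hy (hY hyY), hyY⟩, hyv⟩
      exact hdis z hz.2 hz1 hz2
    · right
      filter_upwards [hN] with y hy hyY
      exact (huv hyY).resolve_left fun hh => h ⟨y, ⟨hy (hY hyY), hyY⟩, hh⟩)
    ⟨a, hY ha, by filter_upwards [hu.mem_nhds hau] with y hy _ using hy⟩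
    ⟨b, hY hb, by filter_upwards [hv.mem_nhds hbv] with y hy _ using hy⟩
  obtain ⟨y, ⟨hy1, hy2⟩, hyY⟩ := mem_closure_iff_nhds.1 (hd hq) _ (inter_mem h1 h2)
  exact hdis y hyY (hy1 hyY) (hy2 hyY)

namespace SData
variable {K : Type} (D : SData K)

def TT (j : ℕ) : Set (ℝ × ℝ) := {b | b ∈ Rc (D.th j) (D.th (j+1)) ∧ ∃ i < D.m, b.1 = D.ph i ∧ b.2 = D.th (i+1)}

theorem TT_edge {j : ℕ} (hj : j ≤ D.m) : ∀ x ∈ D.TT j, x.2 = D.th j ∨ x.2 = D.th (j+1) := by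
  rintro x ⟨hx, i, hi, -, e⟩
  by_contra! h
  have h1 : D.th j < D.th (i+1) := by rw [← e]; exact lt_of_le_of_ne hx.2.1 h.1.symm
  have h2 : D.th (i+1) < D.th (j+1) := by rw [← e]; exact lt_of_le_of_ne hx.2.2 h.2
  rcases le_or_gt (i+1) j with h3 | h3
  · linarith [D.th_mono' h3 (by omega)]
  · linarith [D.th_mono' (show j + 1 ≤ i + 1 by omega) (by omega)]

theorem NT_preconn {j : ℕ} (hj : j ≤ D.m) : IsPreconnected (D.NT j) := by
  have h := ((Rc_preconn (D.thlt j hj) (D.TT_edge hj)).prod (isPreconnected_univ (α := ℂ))).image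
    (fun p : (ℝ × ℝ) × ℂ => ((p.1.1, p.1.2, p.2) : PP)) (by fun_prop)
  convert h using 1
  ext ⟨φ, θ, w⟩
  constructor
  · rintro ⟨⟨h1, h2, -⟩, h3⟩
    exact ⟨((φ, θ), w), ⟨⟨⟨h1, h2⟩, fun h => by
      obtain ⟨-, i, hi, e1, e2⟩ := h
      exact h3 i hi e1 e2⟩, trivial⟩, rfl⟩
  · rintro ⟨⟨⟨a, b⟩, c⟩, ⟨⟨h1, h2⟩, -⟩, e⟩
    simp only [Prod.mk.injEq] at e
    obtain ⟨rfl, rfl, rfl⟩ := e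
    exact ⟨⟨h1.1, h1.2, trivial⟩, fun i hi e1 e2 => h2 ⟨h1, i, hi, e1, e2⟩⟩

def Pk (k : K) : Set (ℂ × ℂ × ℂ) := {x | ∃ j ≤ D.m, ∃ y ∈ D.NT j, D.F j k y = x}

theorem Pk_base (k : K) {j : ℕ} (hj : j ≤ D.m) : ∃ y ∈ D.NT j, D.F j k y = ((1 : ℂ), (0 : ℂ), D.ζ k) := by
  have h1 : D.th j ∈ Icc (D.th j) (D.th (j+1)) := ⟨le_rfl, (D.thlt j hj).le⟩
  refine ⟨(0, D.th j, 0), ⟨⟨⟨le_rfl, pi2⟩, h1, trivial⟩, fun i hi e => ?_⟩, ?_⟩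
  · exact absurd e (D.ph0 i hi).ne
  · simp [F, D.ha j hj k _ h1]

theorem Pk_preconn (k : K) : IsPreconnected (D.Pk k) := by
  have : D.Pk k = ⋃₀ ((fun j => D.F j k '' D.NT j) '' {j | j ≤ D.m}) := by
    ext x
    constructor
    · rintro ⟨j, hj, y, hy, e⟩
      exact ⟨_, ⟨j, hj, rfl⟩, y, hy, e⟩
    · rintro ⟨_, ⟨j, hj, rfl⟩, y, hy, e⟩
      exact ⟨j, hj, y, hy, e⟩
  rw [this]
  apply isPreconnected_sUnion ((1 : ℂ), (0 : ℂ), D.ζ k)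
  · rintro _ ⟨j, hj, rfl⟩
    exact D.Pk_base k hj
  · rintro _ ⟨j, hj, rfl⟩
    exact (D.NT_preconn hj).image _ (D.F_cont j k).continuousOn

theorem R_preconn (hT : D.Trans) : IsPreconnected D.R := by
  rcases D.R.eq_empty_or_nonempty with h | ⟨_, j0, hj0, k0, y0, hy0, rfl⟩
  · rw [h]; exact isPreconnected_empty
  set x0 := D.F j0 k0 y0
  have hsub : ∀ k, D.Pk k ⊆ D.R := fun k x ⟨j, hj, y, hy, e⟩ => ⟨j, hj, k, y, hy, e⟩
  have hx0 : x0 ∈ D.Pk k0 := ⟨j0, hj0, y0, hy0, rfl⟩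
  let C := connectedComponentIn D.R x0
  have hS := hT {k | D.Pk k ⊆ C} (by
    intro i hi k (hk : D.Pk k ⊆ C)
    have hi1 : π / 2 ∈ Icc (0:ℝ) (π/2) := ⟨pi2, le_rfl⟩
    have hnt : ∀ i' < D.m, π/2 = D.ph i' → D.th (i+1) ≠ D.th (i'+1) := fun i' hi' e =>
      absurd e (D.ph1 i' hi').ne'
    have a1 : D.F i k (π/2, D.th (i+1), 0) ∈ D.Pk k :=
      ⟨i, hi.le, _, ⟨⟨hi1, ⟨(D.thlt i hi.le).le, le_rfl⟩, trivial⟩, hnt⟩, rfl⟩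
    have a2 : D.F i k (π/2, D.th (i+1), 0) ∈ D.Pk (D.σ i k) := by
      refine ⟨i+1, hi, (π/2, D.th (i+1), 0), ⟨⟨hi1, ⟨le_rfl, (D.thlt (i+1) hi).le⟩, trivial⟩, hnt⟩, ?_⟩
      simp only [F]
      rw [D.hb2 i hi k (π/2) ⟨(D.ph1 i hi).le, le_rfl⟩]
    have := (D.Pk_preconn (D.σ i k)).subset_connectedComponentIn a2 (hsub _)
    rw [← connectedComponentIn_eq (hk a1)] at this
    exact this) ⟨k0, (D.Pk_preconn k0).subset_connectedComponentIn hx0 (hsub _)⟩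
  have : D.R = C := by
    apply subset_antisymm
    · rintro x ⟨j, hj, k, y, hy, e⟩
      have : k ∈ {k | D.Pk k ⊆ C} := by rw [hS]; trivial
      exact this ⟨j, hj, y, hy, e⟩
    · exact connectedComponentIn_subset _ _
  rw [this]
  exact isPreconnected_connectedComponentIn

theorem R_dense : D.X ⊆ closure D.R := by
  rintro _ ⟨j, hj, k, ⟨φ, θ, w⟩, hy, rfl⟩
  rw [mem_closure_iff_nhds]
  intro U hU
  have hc : Tendsto (fun b : ℝ × ℝ => D.F j k (b.1, b.2, w)) (𝓝 (φ, θ)) (𝓝 (D.F j k (φ, θ, w))) :=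
    ((D.F_cont j k).comp (f := fun b : ℝ × ℝ => (b.1, b.2, w)) (by fun_prop)).continuousAt (x := (φ, θ))
  obtain ⟨δ, hδ, h⟩ := Metric.mem_nhds_iff.1 (hc hU)
  obtain ⟨c, ⟨hc1, hc2⟩, hc3, hc4⟩ := Rc_local (D.thlt j hj) (D.TT_edge hj) (b0 := (φ, θ)) ⟨hy.1, hy.2.1⟩ hδ
  refine ⟨_, h hc1, j, hj, k, _, ⟨⟨hc2.1, hc2.2, trivial⟩, fun i hi e1 e2 => ?_⟩, rfl⟩
  rcases D.TT_edge hj c ⟨hc2, i, hi, e1, e2⟩ with h | h <;> linarith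
end SData

def Thin (T : Set (ℂ × ℂ)) : Prop := ∀ v : ℂ × ℂ, ∀ r > 0, IsPreconnected (Metric.ball v r \ T) ∧ (Metric.ball v r \ T).Nonempty

namespace RData
variable {d : ℕ} (D : RData d)

theorem R_eq (ω : D.S.Om) : (D.S.comp ω).R = {x ∈ D.XX ω | pr x ∉ D.bad} := by
  ext x
  constructor
  · rintro ⟨j, hj, k, ⟨φ, θ, w⟩, ⟨hy, hnt⟩, rfl⟩
    refine ⟨⟨j, hj, k, _, hy, rfl⟩, ?_⟩
    rw [pr_F, D.bad_smul (Complex.exp_ne_zero _)]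
    refine D.pt_nbad hy.1 (D.S.Q_rng hj hy.2.1) ?_
    have e1 : (D.S.comp ω).ph = D.ph := D.Sph
    have e2 : (D.S.comp ω).th = D.th := D.Sth
    have e3 : (D.S.comp ω).m = D.m := D.Sm
    rw [← e1, ← e2, ← e3]
    exact hnt
  · rintro ⟨⟨j, hj, k, y, hy, rfl⟩, hb⟩
    exact ⟨j, hj, k, y, ⟨hy, D.nontip hb j hj k.1 y hy rfl⟩, rfl⟩

theorem graph {x0} (hx : x0 ∈ D.V) (hb : pr x0 ∉ D.bad) : ∃ δ > 0, ∃ s : ℂ × ℂ → ℂ,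
    ContinuousOn s (Metric.ball (pr x0) δ) ∧ s (pr x0) = x0.2.2 ∧ Metric.ball (pr x0) δ ⊆ D.badᶜ ∧
    (∀ v ∈ Metric.ball (pr x0) δ, (D.q v).IsRoot (s v)) ∧
    ∀ᶠ x in 𝓝 x0, x ∈ D.V → pr x ∈ Metric.ball (pr x0) δ ∧ x.2.2 = s (pr x) := by
  set v0 := pr x0
  obtain ⟨δ, hδ, hB⟩ := Metric.isOpen_iff.1 D.bad_closed.isOpen_compl v0 hb
  let B := Metric.ball v0 δ
  have hv0 : v0 ∈ B := Metric.mem_ball_self hδ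
  have hst : ∀ (t : unitInterval) (b : B), v0 + (t:ℝ) • (b.1 - v0) ∈ B := fun t b => by
    have := (convex_ball v0 δ).add_smul_sub_mem hv0 b.2 t.2
    exact this
  obtain ⟨s, hs, hsr, hs0⟩ := (D.fam.comp (Subtype.val : B → ℂ × ℂ) continuous_subtype_val).sections
    (fun b => D.sep' (hB b.2)) ⟨v0, hv0⟩
    ⟨fun p => ⟨v0 + (p.1:ℝ) • (p.2.1 - v0), hst p.1 p.2⟩, by
      refine Continuous.subtype_mk ?_ _
      fun_prop⟩
    (fun b => by apply Subtype.ext; simp) (fun b => by apply Subtype.ext; simp)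
    (fun t => by apply Subtype.ext; simp) x0.2.2 hx
  classical
  let s' : ℂ × ℂ → ℂ := fun v => if h : v ∈ B then s ⟨v, h⟩ else 0
  have hs' : ∀ v (h : v ∈ B), s' v = s ⟨v, h⟩ := fun v h => dif_pos h
  have hcs : ContinuousOn s' B := by
    rw [continuousOn_iff_continuous_restrict]
    convert hs using 1
    ext v
    exact hs' v v.2
  refine ⟨δ, hδ, s', hcs, ?_, hB, ?_, ?_⟩
  · rw [hs' _ hv0, hs0]
  · intro v hv
    rw [hs' v hv]; exact hsr ⟨v, hv⟩
  · obtain ⟨ε, hε, -, hev⟩ := D.fam.loc v0 (D.sep' hb)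
    have hcv : ContinuousAt s' v0 := hcs.continuousAt (Metric.isOpen_ball.mem_nhds hv0)
    have h1 : ∀ᶠ v in 𝓝 v0, ‖s' v - x0.2.2‖ < ε := by
      have := Metric.tendsto_nhds.1 hcv ε hε
      rw [hs' _ hv0, hs0] at this
      simpa [dist_eq_norm] using this
    have h2 := pr_cont.continuousAt.eventually ((Metric.isOpen_ball.eventually_mem hv0).and (h1.and hev))
    have h3 : ∀ᶠ x in 𝓝 x0, ‖x.2.2 - x0.2.2‖ < ε := by
      have := Metric.tendsto_nhds.1 ((by fun_prop : Continuous fun x : ℂ × ℂ × ℂ => x.2.2).continuousAt (x := x0)) ε hε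
      simpa [dist_eq_norm] using this
    filter_upwards [h2, h3] with x ⟨a1, a2, a3⟩ a4 hxV
    refine ⟨a1, a3.2.2 x0.2.2 _ _ hx hxV ?_ a4 a2⟩
    rw [hs' _ a1]; exact hsr ⟨_, a1⟩

theorem XX_closed (ω) : IsClosed (insert 0 (D.XX ω)) := (D.S.comp ω).X_closed

theorem one_comp {ω} {C : Set (ℂ × ℂ × ℂ)} (hG : IsPreconnected C) (hV : C ⊆ D.V) (hb : ∀ x ∈ C, pr x ∉ D.bad)
    {x0} (h0 : x0 ∈ C) (hx : x0 ∈ D.XX ω) : C ⊆ D.XX ω := by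
  by_contra hne
  obtain ⟨v, hv, hvn⟩ := not_subset.1 hne
  have hn0 : ∀ v ∈ C, v ≠ 0 := fun v hv h => by
    apply hb v hv
    left
    exact congrArg pr h
  obtain ⟨u, hu, h1, h2⟩ := isPreconnected_closed_iff.1 hG (insert 0 (D.XX ω)) (⋃ ω' : {ω' // ω' ≠ ω}, insert 0 (D.XX ω'))
    (D.XX_closed ω) (isClosed_iUnion_of_finite fun ω' => D.XX_closed _) (by
      intro v hv
      obtain ⟨ω', h⟩ := D.cover (hV hv) (hn0 v hv)
      by_cases hω : ω' = ω
      · left; right; exact hω ▸ h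
      · right; exact mem_iUnion.2 ⟨⟨ω', hω⟩, Or.inr h⟩)
    ⟨x0, h0, Or.inr hx⟩
    ⟨v, hv, by
      obtain ⟨ω', h⟩ := D.cover (hV hv) (hn0 v hv)
      exact mem_iUnion.2 ⟨⟨ω', fun e => hvn (e ▸ h)⟩, Or.inr h⟩⟩
  obtain ⟨ω', h2⟩ := mem_iUnion.1 h2
  have h1 := h1.resolve_left (hn0 u hu)
  have h2 := h2.resolve_left (hn0 u hu)
  exact ω'.2 (D.disj (hb u hu) h2 h1)

theorem gr_sub {ω} {x0} (hx : x0 ∈ D.XX ω) {B : Set (ℂ × ℂ)} (hB : IsPreconnected B) (hb : B ⊆ D.badᶜ)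
    {s : ℂ × ℂ → ℂ} (hs : ContinuousOn s B) (hr : ∀ v ∈ B, (D.q v).IsRoot (s v)) (h0 : pr x0 ∈ B)
    (e0 : s (pr x0) = x0.2.2) : ∀ v ∈ B, (v.1, v.2, s v) ∈ D.XX ω := by
  have hG : IsPreconnected ((fun v : ℂ × ℂ => (v.1, v.2, s v)) '' B) := hB.image _ (by fun_prop)
  have := D.one_comp hG (by rintro _ ⟨v, hv, rfl⟩; exact hr v hv) (by rintro _ ⟨v, hv, rfl⟩; exact hb hv)
    ⟨pr x0, h0, by simp only [e0]; rfl⟩ hx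
  exact fun v hv => this ⟨v, hv, rfl⟩

theorem trans (ω) : (D.S.comp ω).Trans := D.S.comp_trans D.Ssig ω

instance (ω : D.S.Om) : Nonempty {k // D.S.cls k = ω} := by
  induction ω using Quotient.inductionOn' with
  | h k => exact ⟨⟨k, rfl⟩⟩

theorem main_conn (ω : D.S.Om) {T : Set (ℂ × ℂ)} (hT : Thin T) (hbT : D.bad ⊆ T) :
    IsPreconnected {x ∈ D.XX ω | pr x ∉ T} ∧ {x ∈ D.XX ω | pr x ∉ T}.Nonempty ∧ D.XX ω ⊆ closure {x ∈ D.XX ω | pr x ∉ T} := by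
  set Y := {x ∈ D.XX ω | pr x ∉ T} with hYdef
  set M := {x ∈ D.XX ω | pr x ∉ D.bad} with hMdef
  have hM : IsPreconnected M := by rw [hMdef, ← R_eq]; exact SData.R_preconn _ (D.trans ω)
  have hMX : D.XX ω ⊆ closure M := by rw [hMdef, ← R_eq]; exact SData.R_dense _
  have hYM : Y ⊆ M := fun x hx => ⟨hx.1, fun h => hx.2 (hbT h)⟩
  have hd : M ⊆ closure Y := by
    intro x0 hx0
    obtain ⟨δ, hδ, s, hs, e0, hB, hr, -⟩ := D.graph (D.X_sub_V hx0.1) hx0.2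
    have hsub := D.gr_sub hx0.1 (convex_ball _ δ).isPreconnected hB hs hr (Metric.mem_ball_self hδ) e0
    have hc : ContinuousAt (fun v : ℂ × ℂ => (v.1, v.2, s v)) (pr x0) := by
      have := hs.continuousAt (Metric.ball_mem_nhds _ hδ)
      fun_prop
    rw [mem_closure_iff_nhds]
    intro U hU
    have hU' : U ∈ 𝓝 ((fun v : ℂ × ℂ => (v.1, v.2, s v)) (pr x0)) := by
      simp only [e0]; exact hU
    obtain ⟨r, hr', hrU⟩ := Metric.mem_nhds_iff.1 (hc hU')
    obtain ⟨v, hv, hvT⟩ := (hT (pr x0) (min r δ) (by positivity)).2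
    exact ⟨_, hrU (Metric.ball_subset_ball (min_le_left _ _) hv),
      hsub v (Metric.ball_subset_ball (min_le_right _ _) hv), hvT⟩
  refine ⟨dense_preconn hM hYM hd ?_, ?_, ?_⟩
  · intro x0 hx0
    obtain ⟨δ, hδ, s, hs, e0, hB, hr, hev⟩ := D.graph (D.X_sub_V hx0.1) hx0.2
    have hsub := D.gr_sub hx0.1 (convex_ball _ δ).isPreconnected hB hs hr (Metric.mem_ball_self hδ) e0
    refine ⟨{x | pr x ∈ Metric.ball (pr x0) δ ∧ x.2.2 = s (pr x)}, ?_, ?_⟩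
    · filter_upwards [hev] with x hx hxM using hx (D.X_sub_V hxM.1)
    · have : {x | pr x ∈ Metric.ball (pr x0) δ ∧ x.2.2 = s (pr x)} ∩ Y =
          (fun v : ℂ × ℂ => (v.1, v.2, s v)) '' (Metric.ball (pr x0) δ \ T) := by
        ext x
        constructor
        · rintro ⟨⟨h1, h2⟩, h3, h4⟩
          exact ⟨pr x, ⟨h1, h4⟩, by simp only [← h2]; rfl⟩
        · rintro ⟨v, ⟨h1, h2⟩, rfl⟩
          exact ⟨⟨h1, rfl⟩, hsub v h1, h2⟩
      rw [this]
      have := hs.mono (diff_subset (t := T))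
      exact (hT _ δ hδ).1.image _ (by fun_prop)
  · have hne : (D.XX ω).Nonempty := by
      obtain ⟨k⟩ := (inferInstance : Nonempty {k // D.S.cls k = ω})
      obtain ⟨y, hy, e⟩ := (D.S.comp ω).Pk_base k (Nat.zero_le _)
      exact ⟨_, 0, Nat.zero_le _, k, y, hy.1, rfl⟩
    obtain ⟨x, hx⟩ := hne
    have := closure_minimal hd isClosed_closure (hMX hx)
    exact closure_nonempty_iff.1 ⟨x, this⟩
  · exact hMX.trans (closure_minimal hd isClosed_closure)
end RData
end

section
open Filter Topology Set

def coneMap (g : ℂ → ℂ × ℂ) (a : ℂ × ℂ) (p : ℂ × ℝ) : ℂ × ℂ := a + p.2 • (g p.1 - a)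

theorem coneMap_lip {g : ℂ → ℂ × ℂ} {K} (hK : LipschitzWith K g) (a) : LocallyLipschitz (coneMap g a) := by
  have h1 : LocallyLipschitz fun q : ℝ × (ℂ × ℂ) => a + q.1 • (q.2 - a) :=
    ContDiff.locallyLipschitz (𝕂 := ℝ) (by fun_prop)
  have h3 : LocallyLipschitz (Prod.snd : ℂ × ℝ → ℝ) := LipschitzWith.prod_snd.locallyLipschitz
  have h4 : LocallyLipschitz (Prod.fst : ℂ × ℝ → ℂ) := LipschitzWith.prod_fst.locallyLipschitz
  have h5 : LocallyLipschitz (fun p : ℂ × ℝ => g p.1) := hK.locallyLipschitz.comp h4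
  have h2 : LocallyLipschitz fun p : ℂ × ℝ => (p.2, g p.1) := h3.prodMk h5
  have h6 := h1.comp h2
  exact h6

theorem thin_of {ι : Type} [Finite ι] (τ : ι → ℂ → ℂ × ℂ) (hτ : ∀ i, ∃ K, LipschitzWith K (τ i)) :
    Thin (⋃ i, range (τ i)) := by
  set T := ⋃ i, range (τ i) with hTd
  have hf : ∀ a i, LocallyLipschitz (coneMap (τ i) a) := fun a i => coneMap_lip (hτ i).choose_spec a
  let Bd : ℂ × ℂ → Set (ℂ × ℂ) := fun a => ⋃ i, range (coneMap (τ i) a)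
  have hB : ∀ a, dimH (Bd a) ≤ 3 := by
    intro a
    rw [dimH_iUnion]
    refine iSup_le fun i => ?_
    refine (dimH_range_le_of_locally_lipschitzOn fun x => hf a i x).trans ?_
    rw [Real.dimH_univ_eq_finrank]
    simp
  have hTB : ∀ a, T ⊆ Bd a := by
    intro a x hx
    obtain ⟨i, z, rfl⟩ := mem_iUnion.1 hx
    exact mem_iUnion.2 ⟨i, (z, 1), by simp [coneMap]⟩
  have hseg : ∀ a ∉ T, ∀ c ∉ Bd a, Disjoint (segment ℝ a c) T := by
    intro a ha c hc
    rw [Set.disjoint_left]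
    intro x hx hxT
    rw [segment_eq_image'] at hx
    obtain ⟨t, ht, rfl⟩ := hx
    have ht0 : t ≠ 0 := by rintro rfl; simp at hxT; exact ha hxT
    obtain ⟨i, z, e⟩ := mem_iUnion.1 hxT
    refine hc (mem_iUnion.2 ⟨i, (z, t⁻¹), ?_⟩)
    simp only [coneMap, e, add_sub_cancel_left]
    rw [smul_smul, inv_mul_cancel₀ ht0]; simp
  have hex : ∀ a b v : ℂ × ℂ, ∀ r > 0, ∃ c ∈ Metric.ball v r, c ∉ Bd a ∧ c ∉ Bd b := by
    intro a b v r hr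
    have : Dense (Bd a ∪ Bd b)ᶜ := by
      apply dense_compl_of_dimH_lt_finrank
      rw [dimH_union]
      refine (max_le (hB a) (hB b)).trans_lt ?_
      simp; norm_num
    obtain ⟨c, h1, h2⟩ := this.inter_open_nonempty _ Metric.isOpen_ball ⟨v, Metric.mem_ball_self hr⟩
    simp only [mem_compl_iff, mem_union, not_or] at h2
    exact ⟨c, h1, h2⟩
  intro v r hr
  refine ⟨isPreconnected_of_forall_pair ?_, ?_⟩
  · intro a ha b hb
    obtain ⟨c, hc, h1, h2⟩ := hex a b v r hr
    refine ⟨segment ℝ a c ∪ segment ℝ b c, ?_, Or.inl (left_mem_segment ℝ a c), Or.inr (left_mem_segment ℝ b c), ?_⟩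
    · rintro x (hx | hx)
      · exact ⟨(convex_ball v r).segment_subset ha.1 hc hx, Set.disjoint_left.1 (hseg a ha.2 c h1) hx⟩
      · exact ⟨(convex_ball v r).segment_subset hb.1 hc hx, Set.disjoint_left.1 (hseg b hb.2 c h2) hx⟩
    · exact IsPreconnected.union c (right_mem_segment ℝ a c) (right_mem_segment ℝ b c)
        (convex_segment a c).isPreconnected (convex_segment b c).isPreconnected
  · obtain ⟨c, hc, h1, -⟩ := hex v v v r hr
    exact ⟨c, hc, fun h => h1 (hTB v h)⟩
end

section
open Filter Topology Set

namespace RData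
variable {d d' : ℕ} (D : RData d) (D' : RData d')

def fib (ω : D.S.Om) : Type := {k // D.S.cls k = ω}

theorem XX_div (ω) : DivBy (D.XX ω) (Nat.card (D.fib ω)) := by
  classical
  unfold fib
  rw [Nat.card_eq_fintype_card]
  exact (D.S.comp ω).divBy_card (D.trans ω)

theorem XX_dvd (ω) {m} (h : DivBy (D.XX ω) m) : Nat.card (D.fib ω) ∣ m := by
  classical
  unfold fib
  rw [Nat.card_eq_fintype_card]
  exact (D.S.comp ω).card_dvd_of_divBy (D.trans ω) h

theorem ex_thin {Φ Ψ : ℂ × ℂ × ℂ → ℂ × ℂ × ℂ} {K} (hΨ : LipschitzWith K Ψ) 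
    (h1 : MapsTo Φ D.V D'.V) (hi : ∀ x, Ψ (Φ x) = x) (h0' : Ψ 0 = 0) :
    ∃ T, Thin T ∧ D.bad ⊆ T ∧ ∀ x ∈ D.V, pr x ∉ T → pr (Φ x) ∉ D'.bad := by
  let pi : ℕ → ℂ × ℂ := fun i => pt (D'.ph i, D'.th (i+1))
  let J := Σ i : Fin D'.m, {z // z ∈ (D'.q (pi i)).roots.toFinset}
  let τ : Option (Fin D.m ⊕ J) → ℂ → ℂ × ℂ := fun o => match o with
    | none => fun _ => 0
    | some (Sum.inl i) => fun l => l • pt (D.ph i, D.th (i+1))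
    | some (Sum.inr ⟨i, z⟩) => fun l => pr (Ψ (l • ((pi i).1, (pi i).2, z.1)))
  have hlin : ∀ {E : Type} [NormedAddCommGroup E] [NormedSpace ℂ E] (v : E), LipschitzWith ‖v‖₊ fun l : ℂ => l • v := by
    intro E _ _ v
    refine LipschitzWith.of_dist_le_mul fun x y => ?_
    rw [dist_eq_norm, dist_eq_norm, ← sub_smul, norm_smul, mul_comm]; rfl
  refine ⟨_, thin_of τ ?_, ?_, ?_⟩
  · rintro (_ | i | ⟨i, z⟩)
    · exact ⟨0, LipschitzWith.const 0⟩
    · exact ⟨_, hlin _⟩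
    · have hp : LipschitzWith 1 pr := by
        refine LipschitzWith.of_dist_le_mul fun x y => ?_
        simp only [pr, Prod.dist_eq, NNReal.coe_one, one_mul]
        exact max_le_max le_rfl (le_max_left _ _)
      exact ⟨_, hp.comp (hΨ.comp (hlin _))⟩
  · rintro v (rfl | ⟨i, hi, l, rfl⟩)
    · exact mem_iUnion.2 ⟨none, 0, rfl⟩
    · exact mem_iUnion.2 ⟨some (Sum.inl ⟨i, hi⟩), l, rfl⟩
  · intro x hx hxT hb
    have hV : (D'.q (pr (Φ x))).IsRoot (Φ x).2.2 := h1 hx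
    have hx0 : Φ x ≠ 0 := fun h => by
      have := hi x
      rw [h, h0'] at this
      exact hxT (mem_iUnion.2 ⟨none, 0, by rw [← this]; rfl⟩)
    rcases hb with h | ⟨i, hi', l, h⟩
    · exact D'.pr_ne (h1 hx) hx0 h
    · have hl : l ≠ 0 := fun hl => by
        rw [hl, zero_smul] at h
        exact D'.pr_ne (h1 hx) hx0 h
      have hr := D'.root_smul (l := l⁻¹) hV
      rw [h, inv_smul_smul₀ hl] at hr
      have hm : l⁻¹ * (Φ x).2.2 ∈ (D'.q (pi i)).roots.toFinset := by
        rw [Multiset.mem_toFinset, Polynomial.mem_roots (D'.fam.mon _).ne_zero]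
        exact hr
      refine hxT (mem_iUnion.2 ⟨some (Sum.inr ⟨⟨i, hi'⟩, _, hm⟩), l, ?_⟩)
      show pr (Ψ (l • ((pi i).1, (pi i).2, l⁻¹ * (Φ x).2.2))) = pr x
      have e1 : (Φ x).1 = l * (pi i).1 := congrArg Prod.fst h
      have e2 : (Φ x).2.1 = l * (pi i).2 := congrArg Prod.snd h
      suffices hh : l • ((pi i).1, (pi i).2, l⁻¹ * (Φ x).2.2) = Φ x by rw [hh, hi]
      ext1
      · exact e1.symm
      · ext1
        · exact e2.symm
        · exact mul_inv_cancel_left₀ hl _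

theorem match1 {Φ Ψ : ℂ × ℂ × ℂ → ℂ × ℂ × ℂ} {K} (hΦ : LipschitzWith K Φ) (hΨ : LipschitzWith K Ψ)
    (h1 : MapsTo Φ D.V D'.V) (hi : ∀ x, Ψ (Φ x) = x) (h0' : Ψ 0 = 0) (ω) :
    ∃ ω', MapsTo Φ (D.XX ω) (D'.XX ω') := by
  obtain ⟨T, hT, hbT, h⟩ := D.ex_thin D' hΨ h1 hi h0'
  obtain ⟨c1, ⟨x0, hx0⟩, c3⟩ := D.main_conn ω hT hbT
  have hn : ∀ x ∈ D.XX ω, Φ x ≠ 0 := fun x hx e => by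
    have := hi x
    rw [e, h0'] at this
    exact (D.S.comp ω).X_ne hx this.symm
  obtain ⟨ω', hω'⟩ := D'.cover (h1 (D.X_sub_V hx0.1)) (hn _ hx0.1)
  refine ⟨ω', ?_⟩
  have hs := D'.one_comp (c1.image Φ hΦ.continuous.continuousOn)
    (by rintro _ ⟨x, hx, rfl⟩; exact h1 (D.X_sub_V hx.1))
    (by rintro _ ⟨x, hx, rfl⟩; exact h x (D.X_sub_V hx.1) hx.2) ⟨x0, hx0, rfl⟩ hω'
  intro x hx
  have h2 : Φ x ∈ closure (Φ '' _) := mem_closure_image hΦ.continuous.continuousAt (c3 hx)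
  have h3 := closure_minimal (hs.trans (subset_insert 0 _)) (D'.XX_closed ω') h2
  exact h3.resolve_left (hn x hx)

theorem deg_eq {Φ Ψ : ℂ × ℂ × ℂ → ℂ × ℂ × ℂ} {K} (hΦ : LipschitzWith K Φ) (hΨ : LipschitzWith K Ψ)
    (h1 : MapsTo Φ D.V D'.V) (h2 : MapsTo Ψ D'.V D.V) (hi : ∀ x, Ψ (Φ x) = x) (hi' : ∀ x, Φ (Ψ x) = x)
    (h0 : Φ 0 = 0) (h0' : Ψ 0 = 0) : d = d' := by
  choose τ hτ using D.match1 D' hΦ hΨ h1 hi h0'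
  choose τ' hτ' using D'.match1 D hΨ hΦ h2 hi' h0
  have inv1 : ∀ ω, τ' (τ ω) = ω := fun ω => by
    obtain ⟨T, hT, hbT, h⟩ := D.ex_thin D' hΨ h1 hi h0'
    obtain ⟨-, ⟨x0, hx0⟩, -⟩ := D.main_conn ω hT hbT
    have := hτ' _ (hτ _ hx0.1)
    rw [hi] at this
    exact D.disj (fun hb => hx0.2 (hbT hb)) this hx0.1
  have inv2 : ∀ ω, τ (τ' ω) = ω := fun ω => by
    obtain ⟨T, hT, hbT, h⟩ := D'.ex_thin D hΦ h2 hi' h0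
    obtain ⟨-, ⟨x0, hx0⟩, -⟩ := D'.main_conn ω hT hbT
    have := hτ _ (hτ' _ hx0.1)
    rw [hi'] at this
    exact D'.disj (fun hb => hx0.2 (hbT hb)) this hx0.1
  have hcard : ∀ ω, Nat.card (D.fib ω) = Nat.card (D'.fib (τ ω)) := by
    intro ω
    have hm : ∀ x ∈ D'.XX (τ ω), Ψ x ∈ D.XX ω := fun x hx => by have := hτ' _ hx; rwa [inv1] at this
    let e : D.XX ω ≃ₜ D'.XX (τ ω) :=
      { toFun := fun x => ⟨Φ x, hτ ω x.2⟩
        invFun := fun x => ⟨Ψ x, hm x x.2⟩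
        left_inv := fun x => Subtype.ext (hi x)
        right_inv := fun x => Subtype.ext (hi' x)
        continuous_toFun := (hΦ.continuous.comp continuous_subtype_val).subtype_mk _
        continuous_invFun := (hΨ.continuous.comp continuous_subtype_val).subtype_mk fun x => hm x x.2 }
    exact Nat.dvd_antisymm (D.XX_dvd ω ((D'.XX_div _).congr e.symm)) (D'.XX_dvd _ ((D.XX_div ω).congr e))
  let eτ : D.S.Om ≃ D'.S.Om := ⟨τ, τ', inv1, inv2⟩
  haveI : ∀ ω, Finite (D.fib ω) := fun ω => by unfold fib; infer_instance
  haveI : ∀ ω, Finite (D'.fib ω) := fun ω => by unfold fib; infer_instance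
  have ee : ∀ ω, D.fib ω ≃ D'.fib (eτ ω) := fun ω => (Finite.equivFin _).trans ((finCongr (hcard ω)).trans (Finite.equivFin _).symm)
  have E : Fin d ≃ Fin d' := (Equiv.sigmaFiberEquiv D.S.cls).symm.trans
    ((Equiv.sigmaCongr eτ ee).trans (Equiv.sigmaFiberEquiv D'.S.cls))
  simpa using Fintype.card_congr E
end RData
end

section
open Filter Topology Set

lemma blowup_half {V W U : Set E3} {φ : E3 → E3} {K : NNReal}
    (hU : IsOpen U) (h0 : (0:E3) ∈ U) (hφ0 : φ 0 = 0) 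
    (hm : MapsTo φ (V ∩ U) W) (hφ : LipschitzOnWith K φ U)
    (hV : ∀ (t : ℝ), ∀ x ∈ V, t • x ∈ V) (hW : ∀ (t : ℝ), ∀ x ∈ W, t • x ∈ W) (hWc : IsClosed W) :
    ∃ Φ : E3 → E3, (∀ x, Tendsto (fun n : ℕ => (n:ℝ) • φ ((n:ℝ)⁻¹ • x)) (hyperfilter ℕ : Filter ℕ) (𝓝 (Φ x))) ∧
      LipschitzWith K Φ ∧ MapsTo Φ V W := by
  have hin : ∀ x : E3, ∀ᶠ n : ℕ in (hyperfilter ℕ : Filter ℕ), (n:ℝ)⁻¹ • x ∈ U := by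
    intro x
    refine Eventually.filter_mono (Nat.hyperfilter_le_atTop) ?_
    have : Tendsto (fun n : ℕ => (n:ℝ)⁻¹ • x) atTop (𝓝 0) := by
      simpa using (tendsto_inv_atTop_nhds_zero_nat (𝕜 := ℝ)).smul_const x
    exact this.eventually (hU.mem_nhds h0)
  have hpos : ∀ᶠ n : ℕ in (hyperfilter ℕ : Filter ℕ), (0:ℝ) < n := by
    refine Eventually.filter_mono (Nat.hyperfilter_le_atTop) ?_
    filter_upwards [eventually_gt_atTop 0] with n hn
    exact_mod_cast hn
  have hdist : ∀ x y : E3, ∀ᶠ n : ℕ in (hyperfilter ℕ : Filter ℕ),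
      dist ((n:ℝ) • φ ((n:ℝ)⁻¹ • x)) ((n:ℝ) • φ ((n:ℝ)⁻¹ • y)) ≤ K * dist x y := by
    intro x y
    filter_upwards [hin x, hin y, hpos] with n hx hy hn
    have h1 := hφ.dist_le_mul _ hx _ hy
    rw [dist_smul₀] at h1 ⊢
    rw [Real.norm_of_nonneg hn.le]
    rw [Real.norm_of_nonneg (inv_nonneg.mpr hn.le)] at h1
    calc (n:ℝ) * _ ≤ n * (K * ((n:ℝ)⁻¹ * dist x y)) := by gcongr
      _ = _ := by field_simp
  have ex : ∀ x, ∃ y, Tendsto (fun n : ℕ => (n:ℝ) • φ ((n:ℝ)⁻¹ • x)) (hyperfilter ℕ : Filter ℕ) (𝓝 y) := by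
    intro x
    have hb : ∀ᶠ n : ℕ in (hyperfilter ℕ : Filter ℕ), (n:ℝ) • φ ((n:ℝ)⁻¹ • x) ∈ Metric.closedBall (0:E3) (K * dist x 0) := by
      filter_upwards [hdist x 0] with n hn
      simpa [hφ0] using hn
    obtain ⟨y, -, hy⟩ := (isCompact_closedBall (0:E3) (K * dist x 0)).ultrafilter_le_nhds
      ((hyperfilter ℕ).map (fun n : ℕ => (n:ℝ) • φ ((n:ℝ)⁻¹ • x))) (le_principal_iff.mpr hb)
    exact ⟨y, hy⟩
  choose Φ hΦ using ex
  refine ⟨Φ, hΦ, LipschitzWith.of_dist_le_mul fun x y => ?_, fun x hx => ?_⟩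
  · exact le_of_tendsto ((hΦ x).dist (hΦ y)) (hdist x y)
  · refine hWc.mem_of_tendsto (hΦ x) ?_
    filter_upwards [hin x] with n hn
    exact hW _ _ (hm ⟨hV _ _ hx, hn⟩)

lemma blowup {V W : Set E3} (h : BiLipGermHomeo V W)
    (hV : ∀ (t : ℝ), ∀ x ∈ V, t • x ∈ V) (hW : ∀ (t : ℝ), ∀ x ∈ W, t • x ∈ W)
    (hVc : IsClosed V) (hWc : IsClosed W) :
    ∃ (Φ Ψ : E3 → E3) (K : NNReal), LipschitzWith K Φ ∧ LipschitzWith K Ψ ∧ MapsTo Φ V W ∧ MapsTo Ψ W V ∧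
      (∀ x, Ψ (Φ x) = x) ∧ (∀ x, Φ (Ψ x) = x) ∧ Φ 0 = 0 ∧ Ψ 0 = 0 := by
  obtain ⟨U, U', φ, ψ, K, hU, hU', h0, h0', hφ0, hm, hm', hl, hr, hφ, hψ, him⟩ := h
  have hψ0 : ψ 0 = 0 := by simpa [hφ0] using hl h0
  obtain ⟨Φ, a1, a2, a3⟩ := blowup_half (V := V) (W := W) hU h0 hφ0
    (fun x hx => (him.subset (mem_image_of_mem φ hx)).1) hφ hV hW hWc
  obtain ⟨Ψ, b1, b2, b3⟩ := blowup_half (V := W) (W := V) hU' h0' hψ0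
    (fun y hy => by
      obtain ⟨x, hx, rfl⟩ := him.superset hy
      rw [hl hx.2]; exact hx.1) hψ hW hV hVc
  have inv : ∀ (U U' : Set E3) (φ ψ Φ Ψ : E3 → E3), IsOpen U → IsOpen U' → (0:E3) ∈ U → (0:E3) ∈ U' → MapsTo φ U U' → LeftInvOn ψ φ U →
      LipschitzOnWith K ψ U' →
      (∀ x, Tendsto (fun n : ℕ => (n:ℝ) • φ ((n:ℝ)⁻¹ • x)) (hyperfilter ℕ : Filter ℕ) (𝓝 (Φ x))) →
      (∀ x, Tendsto (fun n : ℕ => (n:ℝ) • ψ ((n:ℝ)⁻¹ • x)) (hyperfilter ℕ : Filter ℕ) (𝓝 (Ψ x))) →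
      ∀ x, Ψ (Φ x) = x := by
    intro U U' φ ψ Φ Ψ hU hU' h0 h0' hm hl hψ a1 b1 x
    have hin : ∀ (U : Set E3), IsOpen U → (0:E3) ∈ U → ∀ x : E3, ∀ᶠ n : ℕ in (hyperfilter ℕ : Filter ℕ), (n:ℝ)⁻¹ • x ∈ U := by
      intro U hU h0 x
      refine Eventually.filter_mono (Nat.hyperfilter_le_atTop) ?_
      have : Tendsto (fun n : ℕ => (n:ℝ)⁻¹ • x) atTop (𝓝 0) := by
        simpa using (tendsto_inv_atTop_nhds_zero_nat (𝕜 := ℝ)).smul_const x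
      exact this.eventually (hU.mem_nhds h0)
    have hpos : ∀ᶠ n : ℕ in (hyperfilter ℕ : Filter ℕ), (0:ℝ) < n := by
      refine Eventually.filter_mono (Nat.hyperfilter_le_atTop) ?_
      filter_upwards [eventually_gt_atTop 0] with n hn
      exact_mod_cast hn
    have hd : ∀ᶠ n : ℕ in (hyperfilter ℕ : Filter ℕ),
        dist ((n:ℝ) • ψ ((n:ℝ)⁻¹ • Φ x)) x ≤ K * dist (Φ x) ((n:ℝ) • φ ((n:ℝ)⁻¹ • x)) := by
      filter_upwards [hin U hU h0 x, hin U' hU' h0' (Φ x), hpos] with n hx hy hn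
      have h1 := hψ.dist_le_mul _ hy _ (hm hx)
      have e1 : x = (n:ℝ) • ψ (φ ((n:ℝ)⁻¹ • x)) := by
        rw [hl hx, smul_smul, mul_inv_cancel₀ hn.ne', one_smul]
      have e2 : φ ((n:ℝ)⁻¹ • x) = (n:ℝ)⁻¹ • ((n:ℝ) • φ ((n:ℝ)⁻¹ • x)) := by
        rw [smul_smul, inv_mul_cancel₀ hn.ne', one_smul]
      conv_lhs => arg 2; rw [e1]
      rw [dist_smul₀, Real.norm_of_nonneg hn.le]
      rw [e2, dist_smul₀, Real.norm_of_nonneg (inv_nonneg.mpr hn.le), ← e2] at h1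
      calc (n:ℝ) * _ ≤ n * (K * ((n:ℝ)⁻¹ * dist (Φ x) ((n:ℝ) • φ ((n:ℝ)⁻¹ • x)))) := by gcongr
        _ = _ := by field_simp
    have t1 : Tendsto (fun n : ℕ => (K:ℝ) * dist (Φ x) ((n:ℝ) • φ ((n:ℝ)⁻¹ • x))) (hyperfilter ℕ : Filter ℕ) (𝓝 0) := by
      have := ((tendsto_const_nhds (x := Φ x)).dist (a1 x)).const_mul (K:ℝ)
      simpa using this
    have t2 := (b1 (Φ x)).dist (tendsto_const_nhds (x := x))
    have := le_of_tendsto_of_tendsto t2 t1 hd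
    exact dist_le_zero.mp this
  have i1 := inv U U' φ ψ Φ Ψ hU hU' h0 h0' hm hl hψ a1 b1
  have i2 := inv U' U ψ φ Ψ Φ hU' hU h0' h0 hm' hr hφ b1 a1
  have z : Φ 0 = 0 := by
    have := a1 0
    simp only [smul_zero, hφ0] at this
    exact (tendsto_nhds_unique this tendsto_const_nhds)
  exact ⟨Φ, Ψ, K, a2, b2, a3, b3, i1, i2, z, by simpa [z] using i1 0⟩
end

section
open Filter Topology Set


theorem hom_eval {σ : Type} [Fintype σ] {f : MvPolynomial σ ℂ} {n : ℕ} (hf : f.IsHomogeneous n) (l : ℂ) (x : σ → ℂ) :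
    MvPolynomial.eval (fun i => l * x i) f = l ^ n * MvPolynomial.eval x f := by
  rw [MvPolynomial.eval_eq', MvPolynomial.eval_eq', Finset.mul_sum]
  refine Finset.sum_congr rfl fun d hd => ?_
  have h1 : ∑ i, d i = n := by
    have := hf (MvPolynomial.mem_support_iff.1 hd)
    rw [← this]; simp [Finsupp.weight_apply, Finsupp.sum_fintype]
  simp only [mul_pow, Finset.prod_mul_distrib, Finset.prod_pow_eq_pow_sum, h1]
  ring

theorem ex_disc {R : Type} [CommRing R] [IsDomain R] [IsIntegrallyClosed R] [CharZero R] {P : Polynomial R}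
    (hm : P.Monic) (hs : Squarefree P) : ∃ D : R, D ≠ 0 ∧ ∀ φ : R →+* ℂ, φ D ≠ 0 → (P.map φ).Separable := by
  let K := FractionRing R
  let ι := algebraMap R K
  have hι : Function.Injective ι := IsFractionRing.injective R K
  haveI : CharZero K := charZero_of_injective_algebraMap hι
  have hsep : (P.map ι).Separable := by
    rw [PerfectField.separable_iff_squarefree]
    have hP0 : P.map ι ≠ 0 := (hm.map ι).ne_zero
    rw [squarefree_iff_irreducible_sq_not_dvd_of_ne_zero hP0]
    intro g hg hgg
    have hg1 : g ∣ P.map ι := (dvd_mul_right g g).trans hgg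
    obtain ⟨g', e⟩ := IsIntegrallyClosed.eq_map_mul_C_of_dvd K hm hg1
    have hlc : g.leadingCoeff ≠ 0 := Polynomial.leadingCoeff_ne_zero.2 hg.ne_zero
    have hu : IsUnit (Polynomial.C g.leadingCoeff) := Polynomial.isUnit_C.2 hlc.isUnit
    have hg'm : g'.Monic := by
      have h1 := congrArg Polynomial.leadingCoeff e
      rw [Polynomial.leadingCoeff_mul, Polynomial.leadingCoeff_C, Polynomial.leadingCoeff_map_of_injective hι] at h1
      have h2 : ι g'.leadingCoeff = ι 1 := by
        rw [map_one]; exact mul_right_cancel₀ hlc (by rw [one_mul]; exact h1)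
      exact hι h2
    have h3 : (g' * g').map ι ∣ P.map ι := by
      rw [Polynomial.map_mul]
      refine (mul_dvd_mul ?_ ?_).trans hgg <;> exact ⟨_, e.symm⟩
    rw [Polynomial.map_dvd_map ι hι (hg'm.mul hg'm)] at h3
    have h4 := hs g' h3
    apply hg.not_isUnit
    rw [← e]
    exact (h4.map (Polynomial.mapRingHom ι)).mul hu
  obtain ⟨a, b, hab⟩ := hsep
  obtain ⟨c1, h1⟩ := IsLocalization.integerNormalization_map_to_map (nonZeroDivisors R) a
  obtain ⟨c2, h2⟩ := IsLocalization.integerNormalization_map_to_map (nonZeroDivisors R) b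
  set A := IsLocalization.integerNormalization (nonZeroDivisors R) a
  set B := IsLocalization.integerNormalization (nonZeroDivisors R) b
  have key : Polynomial.C c2.1 * A * P + Polynomial.C c1.1 * B * Polynomial.derivative P = Polynomial.C (c1.1 * c2.1) := by
    apply Polynomial.map_injective ι hι
    simp only [Polynomial.map_add, Polynomial.map_mul, Polynomial.map_C, ← Polynomial.derivative_map, map_mul]
    have h1' : A.map ι = Polynomial.C (ι c1.1) * a := by
      rw [h1, ← Polynomial.smul_eq_C_mul]; exact (algebraMap_smul K c1.1 a).symm
    have h2' : B.map ι = Polynomial.C (ι c2.1) * b := by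
      rw [h2, ← Polynomial.smul_eq_C_mul]; exact (algebraMap_smul K c2.1 b).symm
    rw [h1', h2']
    linear_combination (Polynomial.C (ι c1.1) * Polynomial.C (ι c2.1)) * hab
  refine ⟨c1.1 * c2.1, mul_ne_zero (nonZeroDivisors.ne_zero c1.2) (nonZeroDivisors.ne_zero c2.2), fun φ hφ => ?_⟩
  have := congrArg (Polynomial.map φ) key
  simp only [Polynomial.map_add, Polynomial.map_mul, Polynomial.map_C, ← Polynomial.derivative_map] at this
  set c := φ (c1.1 * c2.1)
  have hc : Polynomial.C c⁻¹ * Polynomial.C c = (1 : Polynomial ℂ) := by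
    rw [← Polynomial.C_mul, inv_mul_cancel₀ hφ, Polynomial.C_1]
  exact ⟨Polynomial.C c⁻¹ * (Polynomial.C (φ c2.1) * A.map φ), Polynomial.C c⁻¹ * (Polynomial.C (φ c1.1) * B.map φ), by
    linear_combination Polynomial.C c⁻¹ * this + hc⟩
end

section
open Filter Topology Set
open MvPolynomial in
def shear (α β : ℂ) : MvPolynomial (Fin 3) ℂ →ₐ[ℂ] MvPolynomial (Fin 3) ℂ :=
  aeval ![X 0, X 1 + C α * X 0, X 2 + C β * X 0]
open MvPolynomial in
def shearE (α β : ℂ) : MvPolynomial (Fin 3) ℂ ≃ₐ[ℂ] MvPolynomial (Fin 3) ℂ :=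
  AlgEquiv.ofAlgHom (shear α β) (shear (-α) (-β)) (by
    ext1 i; fin_cases i <;> simp [shear]) (by
    ext1 i; fin_cases i <;> simp [shear])
open MvPolynomial in
theorem shear_eval (α β : ℂ) (f) (z x y : ℂ) : eval ![z,x,y] (shear α β f) = eval ![z, x+α*z, y+β*z] f := by
  induction f using MvPolynomial.induction_on with
  | C a => simp [shear]
  | add p q hp hq => simp only [map_add, hp, hq]
  | mul_X p i hp => 
    rw [map_mul, map_mul, hp, map_mul]
    congr 1
    fin_cases i <;> simp [shear]

theorem sqf_equiv {A B : Type} [CommRing A] [CommRing B] (e : A ≃+* B) {x : A} (h : Squarefree x) : Squarefree (e x) := by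
  intro y hy
  have h1 : e.symm y * e.symm y ∣ x := by
    have := map_dvd e.symm hy
    simpa using this
  have h2 := h _ h1
  have := h2.map e
  simpa using this

set_option maxHeartbeats 1000000 in
theorem ex_q0 {f : MvPolynomial (Fin 3) ℂ} {n : ℕ} (hf : f.IsHomogeneous n) (hs : Squarefree f) :
    ∃ α β a : ℂ, a ≠ 0 ∧ ∃ P : Polynomial (MvPolynomial (Fin 2) ℂ), P.Monic ∧ P.natDegree = n ∧ Squarefree P ∧
      ∀ x y z, (P.map (MvPolynomial.eval ![x,y])).eval z = a * MvPolynomial.eval ![z, x+α*z, y+β*z] f := by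
  have hf0 : f ≠ 0 := hs.ne_zero
  obtain ⟨α, β, hb⟩ : ∃ α β : ℂ, MvPolynomial.eval ![1,α,β] f ≠ 0 := by
    by_contra! hc
    have : f * MvPolynomial.X 0 = 0 := by
      apply MvPolynomial.funext
      intro x
      rw [map_mul, map_zero, MvPolynomial.eval_X]
      by_cases h0 : x 0 = 0
      · rw [h0, mul_zero]
      · have h1 := hom_eval hf (x 0) ![1, x 1 / x 0, x 2 / x 0]
        rw [hc, mul_zero] at h1
        have h2 : (fun i => x 0 * (![1, x 1 / x 0, x 2 / x 0] : Fin 3 → ℂ) i) = x := by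
          funext i
          fin_cases i
          · simp
          · simp [mul_div_cancel₀, h0]
          · simp [mul_div_cancel₀, h0]
        rw [h2] at h1
        rw [h1, zero_mul]
    rcases mul_eq_zero.1 this with h | h
    · exact hf0 h
    · exact MvPolynomial.X_ne_zero 0 h
  set b := MvPolynomial.eval ![1,α,β] f with hbdef
  set g := shear α β f with hg
  have hgs : Squarefree g := sqf_equiv (shearE α β).toRingEquiv hs
  have hgh : g.IsHomogeneous n := by
    have := MvPolynomial.IsHomogeneous.aeval (n := 1) hf
      (![MvPolynomial.X 0, MvPolynomial.X 1 + MvPolynomial.C α * MvPolynomial.X 0, MvPolynomial.X 2 + MvPolynomial.C β * MvPolynomial.X 0] : Fin 3 → MvPolynomial (Fin 3) ℂ) (by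
        have hh : ∀ (i : Fin 3) (c : ℂ), (MvPolynomial.X i + MvPolynomial.C c * MvPolynomial.X 0 : MvPolynomial (Fin 3) ℂ).IsHomogeneous 1 := by
          intro i c
          refine (MvPolynomial.isHomogeneous_X _ _).add ?_
          simpa using (MvPolynomial.isHomogeneous_C (Fin 3) c).mul (MvPolynomial.isHomogeneous_X ℂ (0 : Fin 3))
        intro i
        fin_cases i
        · exact MvPolynomial.isHomogeneous_X _ _
        · exact hh _ _
        · exact hh _ _)
    rwa [one_mul] at this
  set P := MvPolynomial.finSuccEquiv ℂ 2 g with hP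
  have hPe : ∀ x y z, (P.map (MvPolynomial.eval ![x,y])).eval z = MvPolynomial.eval ![z, x+α*z, y+β*z] f := by
    intro x y z
    rw [hP, ← MvPolynomial.eval_eq_eval_mv_eval', ← shear_eval]
    rfl
  have hPs : Squarefree P := sqf_equiv (MvPolynomial.finSuccEquiv ℂ 2).toRingEquiv hgs
  have hdeg : P.natDegree ≤ n := by
    have h1 := MvPolynomial.natDegree_finSuccEquiv g
    have h2 := MvPolynomial.degreeOf_le_totalDegree g 0
    have h3 := hgh.totalDegree hgs.ne_zero
    rw [← h3]; exact h1.le.trans h2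
  have hco : P.coeff n = MvPolynomial.C b := by
    have h1 := hgh.finSuccEquiv_coeff_isHomogeneous n 0 (add_zero _)
    have h2 : P.coeff n = MvPolynomial.C (MvPolynomial.coeff 0 (P.coeff n)) := by
      rw [← MvPolynomial.totalDegree_eq_zero_iff_eq_C]
      exact (MvPolynomial.totalDegree_zero_iff_isHomogeneous _).2 h1
    have h3 : P.map (MvPolynomial.eval ![0,0]) = Polynomial.C b * Polynomial.X ^ n := by
      apply Polynomial.funext
      intro z
      rw [hPe]
      have := hom_eval hf z ![1,α,β]
      rw [show (fun i => z * (![1,α,β] : Fin 3 → ℂ) i) = ![z, 0 + α * z, 0 + β * z] by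
        funext i; fin_cases i <;> simp [mul_comm]] at this
      rw [this, Polynomial.eval_mul, Polynomial.eval_C, Polynomial.eval_pow, Polynomial.eval_X, mul_comm]
    have h4 := congrArg (fun p => p.coeff n) h3
    simp only [Polynomial.coeff_map, Polynomial.coeff_C_mul, Polynomial.coeff_X_pow, if_true, mul_one] at h4
    rw [h2] at h4 ⊢
    rw [MvPolynomial.eval_C] at h4
    rw [h4]
  have hle : (Polynomial.C (MvPolynomial.C b⁻¹) * P).natDegree ≤ n := (Polynomial.natDegree_C_mul_le _ _).trans hdeg
  have hcn : (Polynomial.C (MvPolynomial.C b⁻¹) * P).coeff n = 1 := by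
    rw [Polynomial.coeff_C_mul, hco, ← map_mul, inv_mul_cancel₀ hb, map_one]
  refine ⟨α, β, b⁻¹, inv_ne_zero hb, Polynomial.C (MvPolynomial.C b⁻¹) * P, ?_, ?_, ?_, ?_⟩
  · exact Polynomial.monic_of_natDegree_le_of_coeff_eq_one n hle hcn
  · refine le_antisymm hle (Polynomial.le_natDegree_of_ne_zero ?_)
    rw [hcn]; exact one_ne_zero
  · intro y hy
    refine hPs y (hy.trans ?_)
    refine ⟨Polynomial.C (MvPolynomial.C b), ?_⟩
    rw [mul_comm, ← mul_assoc, ← Polynomial.C_mul, ← MvPolynomial.C_mul, mul_inv_cancel₀ hb, MvPolynomial.C_1, Polynomial.C_1, one_mul]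
  · intro x y z
    rw [Polynomial.map_mul, Polynomial.eval_mul, hPe, Polynomial.map_C, MvPolynomial.eval_C, Polynomial.eval_C]
end

section
open Filter Topology Set

theorem sep_comp {p : Polynomial ℂ} (hp : p.Separable) {l : ℂ} (hl : l ≠ 0) :
    (p.comp (Polynomial.C l * Polynomial.X)).Separable := by
  obtain ⟨a, b, h⟩ := hp
  have h1 := congrArg (fun r => Polynomial.comp r (Polynomial.C l * Polynomial.X)) h
  simp only [Polynomial.add_comp, Polynomial.mul_comp, Polynomial.one_comp] at h1
  refine ⟨a.comp (Polynomial.C l * Polynomial.X), Polynomial.C l⁻¹ * b.comp (Polynomial.C l * Polynomial.X), ?_⟩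
  rw [Polynomial.derivative_comp]
  have h2 : Polynomial.C l⁻¹ * Polynomial.C l = (1 : Polynomial ℂ) := by
    rw [← Polynomial.C_mul, inv_mul_cancel₀ hl, Polynomial.C_1]
  simp only [Polynomial.derivative_mul, Polynomial.derivative_C, Polynomial.derivative_X, zero_mul, zero_add, mul_one]
  linear_combination h1 + (b.comp (Polynomial.C l * Polynomial.X) * (Polynomial.derivative p).comp (Polynomial.C l * Polynomial.X)) * h2

theorem sep_smul {q : ℂ × ℂ → Polynomial ℂ} {d : ℕ} (hom : ∀ (l : ℂ) v z, (q (l • v)).eval (l * z) = l ^ d * (q v).eval z)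
    {v : ℂ × ℂ} {l : ℂ} (hl : l ≠ 0) (h : (q v).Separable) : (q (l • v)).Separable := by
  have e : q (l • v) = Polynomial.C (l^d) * (q v).comp (Polynomial.C l⁻¹ * Polynomial.X) := by
    apply Polynomial.funext
    intro z
    have := hom l v (l⁻¹ * z)
    rw [mul_inv_cancel_left₀ hl] at this
    rw [this]; simp
  rw [e]
  have h1 := sep_comp h (inv_ne_zero hl)
  have hu : IsUnit (Polynomial.C (l^d)) := Polynomial.isUnit_C.2 (pow_ne_zero _ hl).isUnit
  unfold Polynomial.Separable at *
  rw [Polynomial.derivative_C_mul, isCoprime_mul_unit_left hu]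
  exact h1

structure Q0 (f : MvPolynomial (Fin 3) ℂ) (n : ℕ) where
  α : ℂ
  β : ℂ
  a : ℂ
  ha : a ≠ 0
  q : ℂ × ℂ → Polynomial ℂ
  fam : RFam q n
  hom : ∀ (l : ℂ) v z, (q (l • v)).eval (l * z) = l ^ n * (q v).eval z
  ev : ∀ v z, (q v).eval z = a * MvPolynomial.eval ![z, v.1+α*z, v.2+β*z] f
  c1 : ℂ
  hc1 : (q (1, c1)).Separable
  F : Set ℂ
  Ffin : F.Finite
  hF : ∀ u, u ∉ F → (q (u, 1 + c1 * u)).Separable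

theorem ex_Q0 {f : MvPolynomial (Fin 3) ℂ} {n : ℕ} (hf : f.IsHomogeneous n) (hs : Squarefree f) : Nonempty (Q0 f n) := by
  obtain ⟨α, β, a, ha, P, hm, hd, hPs, hev⟩ := ex_q0 hf hs
  obtain ⟨D, hD0, hD⟩ := ex_disc hm hPs
  let q : ℂ × ℂ → Polynomial ℂ := fun v => P.map (MvPolynomial.eval ![v.1, v.2])
  have ev : ∀ v z, (q v).eval z = a * MvPolynomial.eval ![z, v.1+α*z, v.2+β*z] f := fun v z => hev _ _ _
  have hom : ∀ (l : ℂ) v z, (q (l • v)).eval (l * z) = l ^ n * (q v).eval z := by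
    intro l v z
    rw [ev, ev]
    have := hom_eval hf l ![z, v.1+α*z, v.2+β*z]
    rw [show (fun i => l * (![z, v.1+α*z, v.2+β*z] : Fin 3 → ℂ) i) = ![l * z, (l • v).1 + α * (l * z), (l • v).2 + β * (l * z)] by
      funext i; fin_cases i <;> simp <;> ring] at this
    rw [this]; ring
  have fam : RFam q n := by
    refine ⟨fun b => hm.map _, fun b => ?_, ?_⟩
    · rw [← hd]; exact hm.natDegree_map _
    · simp only [ev]
      refine continuous_const.mul ?_
      refine (MvPolynomial.continuous_eval f).comp ?_
      refine continuous_pi fun i => ?_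
      fin_cases i
      · exact continuous_snd
      · show Continuous fun x : (ℂ × ℂ) × ℂ => x.1.1 + α * x.2
        fun_prop
      · show Continuous fun x : (ℂ × ℂ) × ℂ => x.1.2 + β * x.2
        fun_prop
  obtain ⟨c, e, hc, hce⟩ : ∃ c e : ℂ, c ≠ 0 ∧ MvPolynomial.eval ![c, e] D ≠ 0 := by
    by_contra! h
    have : D * MvPolynomial.X 0 = 0 := by
      apply MvPolynomial.funext
      intro x
      rw [map_mul, map_zero, MvPolynomial.eval_X]
      by_cases h0 : x 0 = 0
      · rw [h0, mul_zero]
      · have := h (x 0) (x 1) h0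
        rw [show ![x 0, x 1] = x by funext i; fin_cases i <;> rfl] at this
        rw [this, zero_mul]
    rcases mul_eq_zero.1 this with h | h
    · exact hD0 h
    · exact MvPolynomial.X_ne_zero 0 h
  let h : Polynomial ℂ := MvPolynomial.aeval ![Polynomial.C c, Polynomial.C c * Polynomial.X] D
  have hh : ∀ u, h.eval u = MvPolynomial.eval ![c, c * u] D := by
    intro u
    show (Polynomial.evalRingHom u) (MvPolynomial.aeval _ D) = _
    rw [MvPolynomial.aeval_def, MvPolynomial.hom_eval₂, MvPolynomial.eval, MvPolynomial.coe_eval₂Hom]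
    congr 1
    · ext x; simp
    · funext i; fin_cases i <;> simp
  have hh0 : h ≠ 0 := by
    intro h0
    have := hh (e / c)
    rw [h0, mul_div_cancel₀ _ hc] at this
    exact hce (by simpa using this.symm)
  let G : Set ℂ := {u | h.IsRoot u}
  have hG : G.Finite := Polynomial.finite_setOf_isRoot hh0
  have hGs : ∀ u, u ∉ G → (q (1, u)).Separable := by
    intro u hu
    have h1 : (q (c, c * u)).Separable := hD _ (by
      rw [← hh]; exact hu)
    have := sep_smul hom (inv_ne_zero hc) h1
    simpa [hc] using this
  obtain ⟨c1, hc1⟩ := hG.infinite_compl.nonempty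
  refine ⟨⟨α, β, a, ha, q, fam, hom, ev, c1, hGs _ hc1, {0} ∪ (fun g => (g - c1)⁻¹) '' G, (finite_singleton _).union (hG.image _), ?_⟩⟩
  intro u hu
  simp only [mem_union, mem_singleton_iff, not_or] at hu
  obtain ⟨hu0, hu1⟩ := hu
  have h1 : u⁻¹ + c1 ∉ G := fun h => hu1 ⟨_, h, by simp⟩
  have := sep_smul hom hu0 (hGs _ h1)
  have e : u • ((1 : ℂ), u⁻¹ + c1) = (u, 1 + c1 * u) := by
    ext <;> simp [mul_add, hu0, mul_comm]
  rwa [e] at this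
end

section
open Filter Topology Set
open scoped Real

theorem pick_c {F : Set ℂ} (hF : F.Finite) : ∃ c : ℂ, (∀ u ∈ F, u - c ≠ 0) ∧ (∀ u ∈ F, (u - c).arg ≠ π) ∧
    (∀ u ∈ F, ∀ w ∈ F, (u - c).arg = (w - c).arg → u = w) := by
  let I : Set (ℂ × ℂ) := F ×ˢ (insert 1 (image2 (fun w u => w - u) F F))
  have hI : I.Finite := hF.prod ((hF.image2 _ hF).insert 1)
  haveI : Finite I := hI
  let B : Set ℂ := ⋃ i : I, range (fun t : ℝ => i.1.1 + (t : ℂ) * i.1.2)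
  have hB : dimH B ≤ 1 := by
    rw [dimH_iUnion]
    refine iSup_le fun i => ?_
    have : ContDiff ℝ 1 (fun t : ℝ => i.1.1 + (t : ℂ) * i.1.2) :=
      contDiff_const.add (Complex.ofRealCLM.contDiff.mul contDiff_const)
    refine (ContDiff.dimH_range_le this).trans ?_
    simp
  have hd : Dense Bᶜ := by
    apply dense_compl_of_dimH_lt_finrank
    refine hB.trans_lt ?_
    rw [Complex.finrank_real_complex]; norm_num
  obtain ⟨c, hc⟩ := hd.nonempty
  have h1 : ∀ u ∈ F, ∀ t : ℝ, c ≠ u + t := by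
    intro u hu t h
    refine hc (mem_iUnion.2 ⟨⟨(u, 1), hu, Or.inl rfl⟩, t, ?_⟩)
    simp [h]
  have h2 : ∀ u ∈ F, ∀ w ∈ F, ∀ t : ℝ, c ≠ u + t * (w - u) := by
    intro u hu w hw t h
    exact hc (mem_iUnion.2 ⟨⟨(u, w - u), hu, Or.inr ⟨w, hw, u, hu, rfl⟩⟩, t, h.symm⟩)
  have h0 : ∀ u ∈ F, u - c ≠ 0 := fun u hu h => h1 u hu 0 (by simp [sub_eq_zero.1 h])
  refine ⟨c, h0, ?_, ?_⟩
  · intro u hu h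
    obtain ⟨h3, h4⟩ := Complex.arg_eq_pi_iff.1 h
    have : u - c = ((u - c).re : ℂ) := Complex.ext rfl (by simpa using h4)
    exact h1 u hu (-(u-c).re) (by push_cast [← this]; ring)
  · intro u hu w hw h
    by_contra hne
    rw [Complex.arg_eq_arg_iff (h0 u hu) (h0 w hw)] at h
    set r : ℝ := ‖w - c‖ / ‖u - c‖ with hr
    have h' : (r : ℂ) * (u - c) = w - c := by rw [← h, hr]; push_cast; rfl
    have hr1 : r ≠ 1 := by
      intro h1; rw [h1] at h'; apply hne; simpa using h'
    have hr2 : (1 - r : ℂ) ≠ 0 := by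
      intro h; apply hr1; exact_mod_cast (sub_eq_zero.1 h).symm
    refine h2 u hu w hw (1 / (1 - r)) ?_
    push_cast
    field_simp
    linear_combination h'

theorem ex_RData {f : MvPolynomial (Fin 3) ℂ} {n : ℕ} (Q : Q0 f n) : ∃ (D : RData n) (c : ℂ),
    ∀ s t, D.q (s, t) = Q.q (c * s + t, s + Q.c1 * (c * s + t)) := by
  classical
  obtain ⟨c, hc0, hc1, hc2⟩ := pick_c Q.Ffin
  let S : Finset ℝ := (Q.Ffin.image (fun u => (u - c).arg)).toFinset
  have hS : ∀ x, x ∈ S ↔ ∃ u ∈ Q.F, (u - c).arg = x := by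
    intro x; simp [S]
  let m := S.card
  let e : Fin m ↪o ℝ := S.orderEmbOfFin rfl
  have he : ∀ i, ∃ u ∈ Q.F, (u - c).arg = e i := fun i => (hS _).1 (S.orderEmbOfFin_mem rfl i)
  have he' : ∀ x ∈ S, ∃ i, e i = x := by
    intro x hx
    have := S.range_orderEmbOfFin rfl
    have h2 : x ∈ range e := by rw [this]; exact hx
    exact h2
  choose w hw hwa using he
  let th : ℕ → ℝ := fun j => if j = 0 then -π else if h : j - 1 < m then e ⟨j - 1, h⟩ else π
  let ph : ℕ → ℝ := fun j => if h : j < m then Real.arctan ‖w ⟨j, h⟩ - c‖ else 0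
  have th1 : ∀ i (h : i < m), th (i+1) = e ⟨i, h⟩ := by
    intro i h; simp [th, h]
  have ph1 : ∀ i (h : i < m), ph i = Real.arctan ‖w ⟨i, h⟩ - c‖ := by
    intro i h; simp [ph, h]
  have thm : th (m+1) = π := by simp [th]
  have th0 : th 0 = -π := by simp [th]
  have elt : ∀ i, e i < π := fun i => by
    rw [← hwa]; exact lt_of_le_of_ne (Complex.arg_le_pi _) (hc1 _ (hw i))
  have egt : ∀ i, -π < e i := fun i => by
    rw [← hwa]; exact Complex.neg_pi_lt_arg _
  let L : ℂ × ℂ → ℂ × ℂ := fun v => (c * v.1 + v.2, v.1 + Q.c1 * (c * v.1 + v.2))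
  have hL : Continuous L := by fun_prop
  have hLs : ∀ (l : ℂ) v, L (l • v) = l • L v := by
    intro l v; ext <;> simp [L] <;> ring
  have hom : ∀ (l : ℂ) v z, (Q.q (L (l • v))).eval (l * z) = l ^ n * (Q.q (L v)).eval z := by
    intro l v z; rw [hLs, Q.hom]
  refine ⟨⟨m, th, ph, th0, thm, ?_, ?_, ?_, fun v => Q.q (L v), ?_, hom, ?_⟩, c, fun s t => rfl⟩
  · intro j hj
    rcases Nat.eq_zero_or_pos j with rfl | hj0
    · rw [th0]
      rcases Nat.eq_zero_or_pos m with hm | hm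
      · have : th (0+1) = π := by rw [← hm]; exact thm
        rw [this]; linarith [Real.pi_pos]
      · rw [th1 0 hm]; exact egt _
    · obtain ⟨i, rfl⟩ : ∃ i, j = i + 1 := ⟨j - 1, by omega⟩
      rw [th1 i (by omega)]
      rcases Nat.lt_or_ge (i+1) m with h | h
      · rw [th1 _ h]
        exact e.strictMono (by simp [Fin.lt_def])
      · have : i + 1 = m := le_antisymm hj h
        rw [this, thm]; exact elt _
  · intro i hi
    rw [ph1 i hi, Real.arctan_pos, norm_pos_iff]
    exact hc0 _ (hw _)
  · intro i hi
    rw [ph1 i hi]; exact Real.arctan_lt_pi_div_two _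
  · exact Q.fam.comp L hL
  · rintro ⟨s, t⟩ hv hne
    by_cases hs : s = 0
    · subst hs
      have ht : t ≠ 0 := by rintro rfl; exact hv rfl
      have := sep_smul Q.hom ht Q.hc1
      have e : L (0, t) = t • ((1 : ℂ), Q.c1) := by ext <;> simp [L, mul_comm]
      show (Q.q (L (0, t))).Separable
      rwa [e]
    · have hn : t / s + c ∉ Q.F := by
        intro hF
        obtain ⟨i, hi⟩ := he' _ ((hS _).2 ⟨_, hF, rfl⟩)
        have h1 := hc2 _ hF _ (hw i) (by rw [hwa, hi])
        have h2 : w i - c = t / s := by rw [← h1]; ring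
        have hcos := Real.cos_arctan_pos ‖w i - c‖
        refine hne i.1 i.2 (s / (Real.cos (Real.arctan ‖w i - c‖) : ℝ)) ?_
        rw [ph1 i.1 i.2, th1 i.1 i.2]
        have hcc : ((Real.cos (Real.arctan ‖w i - c‖) : ℝ) : ℂ) ≠ 0 := by exact_mod_cast hcos.ne'
        have hsin : ((Real.sin (Real.arctan ‖w i - c‖) : ℝ) : ℂ) = ‖w i - c‖ * (Real.cos (Real.arctan ‖w i - c‖) : ℝ) := by
          rw [← Complex.ofReal_mul]; congr 1
          rw [← Real.tan_mul_cos hcos.ne', Real.tan_arctan]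
        unfold pt
        ext
        · show s = s / _ * _
          rw [div_mul_cancel₀ _ hcc]
        · show t = s / _ * (_ * _)
          have h3 : (‖w i - c‖ : ℂ) * Complex.exp ((e i : ℝ) * Complex.I) = t / s := by
            rw [← hwa, Complex.norm_mul_exp_arg_mul_I, h2]
          show t = s / _ * (((Real.sin (Real.arctan ‖w i - c‖) : ℝ) : ℂ) * Complex.exp ((e i : ℝ) * Complex.I))
          rw [hsin]
          have h4 : (‖w i - c‖ : ℂ) * (Real.cos (Real.arctan ‖w i - c‖) : ℝ) * Complex.exp ((e i : ℝ) * Complex.I) = (t / s) * (Real.cos (Real.arctan ‖w i - c‖) : ℝ) := by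
            rw [← h3]; ring
          rw [h4, mul_comm (t/s), ← mul_assoc, div_mul_cancel₀ _ hcc, mul_div_cancel₀ _ hs]
      have := sep_smul Q.hom hs (Q.hF _ hn)
      have e : L (s, t) = s • (t / s + c, 1 + Q.c1 * (t / s + c)) := by
        ext <;> simp [L] <;> field_simp <;> ring
      show (Q.q (L (s, t))).Separable
      rwa [e]
end

section
open Filter Topology Set

def coordE (α β c1 c : ℂ) : E3 ≃ₗ[ℂ] ℂ × ℂ × ℂ where
  toFun x := (x 2 - β * x 0 - c1 * (x 1 - α * x 0), (x 1 - α * x 0) - c * (x 2 - β * x 0 - c1 * (x 1 - α * x 0)), x 0)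
  invFun y := WithLp.toLp 2 ![y.2.2, (c * y.1 + y.2.1) + α * y.2.2, (y.1 + c1 * (c * y.1 + y.2.1)) + β * y.2.2]
  map_add' x y := by ext <;> simp <;> ring
  map_smul' l x := by ext <;> simp <;> ring
  left_inv x := by ext i; fin_cases i <;> simp
  right_inv y := by ext <;> simp

theorem ex_model {f : MvPolynomial (Fin 3) ℂ} {n : ℕ} (hf : f.IsHomogeneous n) (hs : Squarefree f) :
    ∃ (D : RData n) (L : E3 ≃L[ℂ] ℂ × ℂ × ℂ), ∀ x, L.symm x ∈ pV f ↔ x ∈ D.V := by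
  obtain ⟨Q⟩ := ex_Q0 hf hs
  obtain ⟨D, c, hD⟩ := ex_RData Q
  refine ⟨D, (coordE Q.α Q.β Q.c1 c).toContinuousLinearEquiv, fun y => ?_⟩
  have h2 : y ∈ D.V ↔ Polynomial.eval y.2.2 (D.q (y.1, y.2.1)) = 0 := Iff.rfl
  rw [h2, hD, Q.ev, mul_eq_zero, or_iff_right Q.ha]
  exact Iff.rfl

theorem pV_cone {f : MvPolynomial (Fin 3) ℂ} {n : ℕ} (hf : f.IsHomogeneous n) : ∀ (t : ℝ), ∀ x ∈ pV f, t • x ∈ pV f := by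
  intro t x hx
  have h1 : MvPolynomial.eval (x : Fin 3 → ℂ) f = 0 := hx
  have h2 := hom_eval hf (t : ℂ) x
  rw [h1, mul_zero] at h2
  show MvPolynomial.eval _ f = 0
  rw [← h2]
  rfl

theorem pV_closed (f : MvPolynomial (Fin 3) ℂ) : IsClosed (pV f) := by
  have : Continuous fun x : E3 => MvPolynomial.eval (x : Fin 3 → ℂ) f :=
    (MvPolynomial.continuous_eval f).comp (PiLp.continuous_ofLp 2 _)
  exact isClosed_singleton.preimage this

theorem bilip_main
    (f g : MvPolynomial (Fin 3) ℂ)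
    (hfsf : Squarefree f) (hgsf : Squarefree g)
    (hfhom : f.IsHomogeneous f.totalDegree) (hghom : g.IsHomogeneous g.totalDegree)
    (hφ : BiLipGermHomeo (pV f) (pV g)) :
    f.totalDegree = g.totalDegree := by
  obtain ⟨Φ, Ψ, K, hΦ, hΨ, h1, h2, h3, h4, h5, h6⟩ := blowup hφ (pV_cone hfhom) (pV_cone hghom) (pV_closed f) (pV_closed g)
  obtain ⟨D, L, hL⟩ := ex_model hfhom hfsf
  obtain ⟨D', L', hL'⟩ := ex_model hghom hgsf
  obtain ⟨K1, k1⟩ : ∃ K1, LipschitzWith K1 (fun x => L' (Φ (L.symm x))) :=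
    ⟨_, L'.lipschitz.comp (hΦ.comp L.symm.lipschitz)⟩
  obtain ⟨K2, k2⟩ : ∃ K2, LipschitzWith K2 (fun x => L (Ψ (L'.symm x))) :=
    ⟨_, L.lipschitz.comp (hΨ.comp L'.symm.lipschitz)⟩
  refine RData.deg_eq D D' (k1.weaken (le_max_left K1 K2)) (k2.weaken (le_max_right K1 K2)) ?_ ?_ ?_ ?_ ?_ ?_
  · intro x hx
    rw [← hL']
    rw [← hL] at hx
    simpa using h1 hx
  · intro x hx
    rw [← hL]
    rw [← hL'] at hx
    simpa using h2 hx
  · intro x; simp [h3]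
  · intro x; simp [h4]
  · simp [h5]
  · simp [h6]
end

/-- Theorem: if `f, g ∈ ℂ[z₁, z₂, z₃]` are nonconstant square-free homogeneous
polynomials and there is a bi-Lipschitz homeomorphism `(ℂ³, V(f), 0) → (ℂ³, V(g), 0)`,
then `deg f = deg g`. -/
theorem bilip_invariance_degree_squarefree_homogeneous_C3
    (f g : MvPolynomial (Fin 3) ℂ)
    (hfdeg : 0 < f.totalDegree) (hgdeg : 0 < g.totalDegree)
    (hfsf : Squarefree f) (hgsf : Squarefree g)
    (hfhom : f.IsHomogeneous f.totalDegree) (hghom : g.IsHomogeneous g.totalDegree)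
    (hφ : BiLipGermHomeo (pV f) (pV g)) :
    f.totalDegree = g.totalDegree := by
  exact bilip_main f g hfsf hgsf hfhom hghom hφ
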